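/- Let 2<p≤3 and let u be a nonnegative classical solution of u_t−Δu=|∇u|^p in Q_T with u=0 on Γ_T, having an isolated gradient blowup point at (0,0,T) and satisfying x·u_x≤0 in Q_T. Then there exist constants C≥c>0 and ρ>0 such that −C ≤ u_xx(0,y,T) ≤ −c < 0 for all 0<y<ρ. In particular, since u_xx(x,0,T)=0 for x≠0, the function u_xx(·,·,T) is discontinuous near the origin. -/

import Mathlib

open Real Set Filter MeasureTheory

noncomputable section

/-- Partial derivative of `u(x,y,t)` with respect to `x`. -/
def pdx (u : ℝ → ℝ → ℝ → ℝ) (x y t : ℝ) : ℝ := deriv (fun s => u s y t) x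

/-- Partial derivative with respect to `y`. -/
def pdy (u : ℝ → ℝ → ℝ → ℝ) (x y t : ℝ) : ℝ := deriv (fun s => u x s t) y

/-- Partial derivative with respect to `t`. -/
def pdt (u : ℝ → ℝ → ℝ → ℝ) (x y t : ℝ) : ℝ := deriv (fun s => u x y s) t

/-- Second partial derivative with respect to `x`. -/
def pdxx (u : ℝ → ℝ → ℝ → ℝ) (x y t : ℝ) : ℝ := deriv (fun s => pdx u s y t) x

/-- Second partial derivative with respect to `y`. -/
def pdyy (u : ℝ → ℝ → ℝ → ℝ) (x y t : ℝ) : ℝ := deriv (fun s => pdy u x s t) y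

/-- Mixed second partial derivative `u_{xy}` (first `x`, then `y`). -/
def pdxy (u : ℝ → ℝ → ℝ → ℝ) (x y t : ℝ) : ℝ := deriv (fun s => pdx u x s t) y

/-- The norm of the spatial gradient, `|∇u| = (u_x² + u_y²)^{1/2}`. -/
def gradNorm (u : ℝ → ℝ → ℝ → ℝ) (x y t : ℝ) : ℝ :=
  Real.sqrt ((pdx u x y t) ^ 2 + (pdy u x y t) ^ 2)

/-- `C^{2,1}`-type regularity of `u` at the point `(x,y,t)`: twice (continuously)
differentiable in the space variables and once in time. -/
def C21At (u : ℝ → ℝ → ℝ → ℝ) (x y t : ℝ) : Prop :=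
  DifferentiableAt ℝ (fun s => u s y t) x ∧
  DifferentiableAt ℝ (fun s => u x s t) y ∧
  DifferentiableAt ℝ (fun s => u x y s) t ∧
  DifferentiableAt ℝ (fun s => pdx u s y t) x ∧
  DifferentiableAt ℝ (fun s => pdy u x s t) y ∧
  DifferentiableAt ℝ (fun s => pdx u x s t) y ∧
  ContinuousAt (fun q : ℝ × ℝ × ℝ => u q.1 q.2.1 q.2.2) (x, y, t) ∧
  ContinuousAt (fun q : ℝ × ℝ × ℝ => pdx u q.1 q.2.1 q.2.2) (x, y, t) ∧
  ContinuousAt (fun q : ℝ × ℝ × ℝ => pdy u q.1 q.2.1 q.2.2) (x, y, t) ∧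
  ContinuousAt (fun q : ℝ × ℝ × ℝ => pdt u q.1 q.2.1 q.2.2) (x, y, t) ∧
  ContinuousAt (fun q : ℝ × ℝ × ℝ => pdxx u q.1 q.2.1 q.2.2) (x, y, t) ∧
  ContinuousAt (fun q : ℝ × ℝ × ℝ => pdyy u q.1 q.2.1 q.2.2) (x, y, t) ∧
  ContinuousAt (fun q : ℝ × ℝ × ℝ => pdxy u q.1 q.2.1 q.2.2) (x, y, t)

/-- `u` is a nonnegative classical solution of `u_t - Δu = |∇u|^p` in
`Q_T = ω × (0,T)`, `ω = (-L,L) × (0,L)`, with `u = 0` on `Γ_T = (-L,L) × {0} × (0,T)`. -/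
structure ClassicalSolution (p L T : ℝ) (u : ℝ → ℝ → ℝ → ℝ) : Prop where
  nonneg : ∀ ⦃x y t : ℝ⦄, |x| ≤ L → y ∈ Icc (0:ℝ) L → t ∈ Ioo 0 T → 0 ≤ u x y t
  smooth : ∀ ⦃x y t : ℝ⦄, |x| ≤ L → y ∈ Icc (0:ℝ) L → t ∈ Ioo 0 T → C21At u x y t
  pde : ∀ ⦃x y t : ℝ⦄, |x| < L → y ∈ Ioo (0:ℝ) L → t ∈ Ioo 0 T →
    pdt u x y t - (pdxx u x y t + pdyy u x y t) = gradNorm u x y t ^ p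
  bc : ∀ ⦃x t : ℝ⦄, |x| < L → t ∈ Ioo 0 T → u x 0 t = 0

/-- `u` has an isolated gradient blow-up point at `(0,0,T)`:
`limsup |∇u| = ∞` at `(0,0,T)` while `∇u` stays bounded on `K × (0,T)` for every
compact `K ⊆ ω̄ \ {(0,0)}`. -/
structure IsolatedGBU (L T : ℝ) (u : ℝ → ℝ → ℝ → ℝ) : Prop where
  blowup : ∀ M : ℝ, ∀ δ > (0:ℝ), ∃ x y t : ℝ, |x| ≤ L ∧ y ∈ Icc (0:ℝ) L ∧
    t ∈ Ioo 0 T ∧ |x| < δ ∧ |y| < δ ∧ T - δ < t ∧ M < gradNorm u x y t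
  bounded : ∀ K : Set (ℝ × ℝ), IsCompact K →
    K ⊆ (Icc (-L) L ×ˢ Icc (0:ℝ) L) \ {((0:ℝ), (0:ℝ))} →
    ∃ M : ℝ, ∀ q ∈ K, ∀ t ∈ Ioo (0:ℝ) T, gradNorm u q.1 q.2 t ≤ M

/-- `u` extends as a `C^{2,1}` function to `(ω̄' × [T/2,T]) \ {(0,0,T)}`,
`ω' = (-L/2,L/2) × (0,L/2)`; values and derivatives at `t = T` refer to this extension. -/
def ExtC21 (L T : ℝ) (u : ℝ → ℝ → ℝ → ℝ) : Prop :=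
  ∀ ⦃x y t : ℝ⦄, |x| ≤ L / 2 → y ∈ Icc (0:ℝ) (L / 2) → t ∈ Icc (T / 2) T →
    ¬(x = 0 ∧ y = 0 ∧ t = T) → C21At u x y t

/-- The monotonicity condition `x·u_x ≤ 0` in `Q_T`. -/
def MonCond (L T : ℝ) (u : ℝ → ℝ → ℝ → ℝ) : Prop :=
  ∀ ⦃x y t : ℝ⦄, |x| < L → y ∈ Ioo (0:ℝ) L → t ∈ Ioo 0 T → x * pdx u x y t ≤ 0

section Calc

theorem snd_deriv_nonpos {f f' : ℝ → ℝ} {x c : ℝ} (hmax : IsLocalMax f x)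
    (hf : ∀ᶠ s in nhds x, HasDerivAt f (f' s) s) (hf' : HasDerivAt f' c x) : c ≤ 0 := by
  by_contra hc
  push Not at hc
  have h0 : f' x = 0 := hmax.hasDerivAt_eq_zero hf.self_of_nhds
  have hpos : ∀ᶠ s in nhdsWithin x (Ioi x), 0 < f' s := by
    have h1 := hasDerivAt_iff_tendsto_slope.1 hf'
    have h2 := h1.eventually (lt_mem_nhds hc)
    have h3 : nhdsWithin x (Ioi x) ≤ nhdsWithin x {x}ᶜ :=
      nhdsWithin_mono _ (fun y hy => ne_of_gt hy)
    filter_upwards [h3 h2, self_mem_nhdsWithin] with s hs hsx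
    rw [slope_def_field, h0, sub_zero] at hs
    have : 0 < s - x := sub_pos.2 hsx
    exact (div_pos_iff_of_pos_right this).1 hs
  obtain ⟨e1, he1, H1⟩ := (mem_nhdsGT_iff_exists_Ioo_subset).1 hpos
  have hboth := hmax.and hf
  obtain ⟨r, hr, H2⟩ := Metric.eventually_nhds_iff.1 hboth
  set b := min ((x + e1) / 2) (x + r / 2) with hb
  have he1' : x < e1 := he1
  have hxb : x < b := lt_min (by linarith) (by linarith)
  have hbe : b < e1 := lt_of_le_of_lt (min_le_left _ _) (by linarith)
  have hbr : b < x + r := lt_of_le_of_lt (min_le_right _ _) (by linarith)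
  have hd : ∀ s ∈ Icc x b, HasDerivAt f (f' s) s := by
    intro s hs
    refine (H2 ?_).2
    rw [Real.dist_eq, abs_lt]; constructor <;> linarith [hs.1, hs.2]
  obtain ⟨ξ, hξ, hξe⟩ := exists_hasDerivAt_eq_slope f f' hxb
    (fun s hs => (hd s hs).continuousAt.continuousWithinAt)
    (fun s hs => hd s ⟨hs.1.le, hs.2.le⟩)
  have h1 : 0 < f' ξ := H1 ⟨hξ.1, hξ.2.trans hbe⟩
  have h2 : f b ≤ f x := (H2 (by
    rw [Real.dist_eq, abs_lt]; constructor <;> linarith)).1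
  rw [hξe] at h1
  have := (div_pos_iff_of_pos_right (sub_pos.2 hxb)).1 h1
  linarith

theorem deriv_left_nonneg {f : ℝ → ℝ} {x d t0 : ℝ} (ht : t0 < x)
    (h : ∀ s ∈ Icc t0 x, f s ≤ f x) (hd : HasDerivAt f d x) : 0 ≤ d := by
  have h1 := (hasDerivAt_iff_tendsto_slope.1 hd)
  have h3 : nhdsWithin x (Iio x) ≤ nhdsWithin x {x}ᶜ :=
      nhdsWithin_mono _ (fun y hy => ne_of_lt hy)
  refine ge_of_tendsto (h1.mono_left h3) ?_
  filter_upwards [Ioo_mem_nhdsLT ht] with s hs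
  rw [slope_def_field]
  exact div_nonneg_of_nonpos (by linarith [h s ⟨hs.1.le, hs.2.le⟩]) (by linarith [hs.2])

theorem deriv_right_nonpos {f : ℝ → ℝ} {x d t0 : ℝ} (ht : x < t0)
    (h : ∀ s ∈ Ioo x t0, f s ≤ f x) (hd : HasDerivAt f d x) : d ≤ 0 := by
  have h1 := (hasDerivAt_iff_tendsto_slope.1 hd)
  have h3 : nhdsWithin x (Ioi x) ≤ nhdsWithin x {x}ᶜ :=
      nhdsWithin_mono _ (fun y hy => ne_of_gt hy)
  refine le_of_tendsto (h1.mono_left h3) ?_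
  filter_upwards [Ioo_mem_nhdsGT ht] with s hs
  rw [slope_def_field]
  exact div_nonpos_of_nonpos_of_nonneg (by linarith [h s hs]) (by linarith [hs.1])

/-- mean value inequality, lower -/
theorem mvt_ge {f f' : ℝ → ℝ} {a b m : ℝ} (hab : a ≤ b)
    (hf : ContinuousOn f (Icc a b))
    (hd : ∀ s ∈ Ioo a b, HasDerivAt f (f' s) s) (hm : ∀ s ∈ Ioo a b, m ≤ f' s) :
    m * (b - a) ≤ f b - f a := by
  rcases hab.eq_or_lt with rfl | hlt
  · simp
  obtain ⟨ξ, hξ, he⟩ := exists_hasDerivAt_eq_slope f f' hlt hf hd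
  have := hm ξ hξ
  rw [he, le_div_iff₀ (sub_pos.2 hlt)] at this
  exact this

theorem mvt_le {f f' : ℝ → ℝ} {a b m : ℝ} (hab : a ≤ b)
    (hf : ContinuousOn f (Icc a b))
    (hd : ∀ s ∈ Ioo a b, HasDerivAt f (f' s) s) (hm : ∀ s ∈ Ioo a b, f' s ≤ m) :
    f b - f a ≤ m * (b - a) := by
  rcases hab.eq_or_lt with rfl | hlt
  · simp
  obtain ⟨ξ, hξ, he⟩ := exists_hasDerivAt_eq_slope f f' hlt hf hd
  have := hm ξ hξ
  rw [he, div_le_iff₀ (sub_pos.2 hlt)] at this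
  exact this

theorem snd_diff_ge {f f' f'' : ℝ → ℝ} {x h m : ℝ} (hh : 0 ≤ h)
    (hd : ∀ s ∈ Icc (x - h) (x + h), HasDerivAt f (f' s) s)
    (hd2 : ∀ s ∈ Icc (x - h) (x + h), HasDerivAt f' (f'' s) s)
    (hm : ∀ s ∈ Icc (x - h) (x + h), m ≤ f'' s) :
    m * h ^ 2 ≤ f (x + h) + f (x - h) - 2 * f x := by
  have key : ∀ s ∈ Ioo 0 h, 0 ≤ f' (x + s) - f' (x - s) - 2 * m * s := by
    intro s hs
    have := mvt_ge (f := f') (f' := f'') (a := x - s) (b := x + s) (m := m)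
      (by linarith [hs.1])
      (fun z hz => (hd2 z ⟨by linarith [hz.1, hs.2], by linarith [hz.2, hs.2]⟩).continuousAt.continuousWithinAt)
      (fun z hz => hd2 z ⟨by linarith [hz.1, hs.2], by linarith [hz.2, hs.2]⟩)
      (fun z hz => hm z ⟨by linarith [hz.1, hs.2], by linarith [hz.2, hs.2]⟩)
    nlinarith
  have hD : ∀ s ∈ Icc 0 h, HasDerivAt (fun s => f (x + s) + f (x - s) - m * s ^ 2)
      (f' (x + s) - f' (x - s) - 2 * m * s) s := by
    intro s hs
    have h1 := (hd (x + s) ⟨by linarith [hs.1, hs.2], by linarith [hs.2]⟩).comp_const_add x s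
    have h2 := (hd (x - s) ⟨by linarith [hs.1, hs.2], by linarith [hs.1, hs.2]⟩).comp_const_sub x s
    have h3 := ((hasDerivAt_id s).pow 2).const_mul m
    refine ((h1.add h2).sub h3).congr_deriv ?_
    simp; ring
  have := mvt_ge (a := 0) (b := h) (m := 0) hh
    (fun s hs => (hD s hs).continuousAt.continuousWithinAt)
    (fun s hs => hD s ⟨hs.1.le, hs.2.le⟩) key
  simp only [add_zero, sub_zero] at this
  nlinarith

theorem pow_grad_ineq {p : ℝ} (hp : 2 < p) (a b c d : ℝ) :
    √(a ^ 2 + b ^ 2) ^ p - √(c ^ 2 + d ^ 2) ^ p ≤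
      p * √(a ^ 2 + b ^ 2) ^ (p - 2) * (a * (a - c) + b * (b - d)) := by
  set P := √(a ^ 2 + b ^ 2) with hP
  set Q := √(c ^ 2 + d ^ 2) with hQ
  have hP0 : 0 ≤ P := Real.sqrt_nonneg _
  have hQ0 : 0 ≤ Q := Real.sqrt_nonneg _
  have hP2 : P ^ 2 = a ^ 2 + b ^ 2 := Real.sq_sqrt (by positivity)
  have hQ2 : Q ^ 2 = c ^ 2 + d ^ 2 := Real.sq_sqrt (by positivity)
  have hcs : a * c + b * d ≤ P * Q := by
    rw [hP, hQ, ← Real.sqrt_mul (by positivity)]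
    apply Real.le_sqrt_of_sq_le
    nlinarith [sq_nonneg (a * d - b * c)]
  rcases hP0.eq_or_lt with h0 | h0
  · rw [← h0, Real.zero_rpow (by linarith), Real.zero_rpow (by linarith)]
    have := Real.rpow_nonneg hQ0 p
    linarith
  have hb := one_add_mul_self_le_rpow_one_add (s := Q / P - 1) (by
    have := div_nonneg hQ0 hP0; linarith) (p := p) (by linarith)
  have e1 : 1 + (Q / P - 1) = Q / P := by ring
  rw [e1, Real.div_rpow hQ0 hP0, le_div_iff₀ (Real.rpow_pos_of_pos h0 p)] at hb
  have e2 : P ^ p = P ^ (p - 2) * P ^ 2 := by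
    rw [← Real.rpow_natCast, ← Real.rpow_add h0]; norm_num
  have hR : 0 < P ^ (p - 2) := Real.rpow_pos_of_pos h0 _
  have e3 : (1 + p * (Q / P - 1)) * P ^ p = P ^ p + p * P ^ (p - 2) * (P * Q - P ^ 2) := by
    rw [e2]; field_simp
  rw [e3] at hb
  have : p * P ^ (p - 2) * (P ^ 2 - P * Q) ≤ p * P ^ (p - 2) * (a * (a - c) + b * (b - d)) := by
    apply mul_le_mul_of_nonneg_left _ (by positivity)
    nlinarith
  nlinarith

theorem box_max (f : ℝ → ℝ → ℝ → ℝ) {x0 x1 y0 y1 t0 t1 : ℝ}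
    (hc : ContinuousOn (fun q : ℝ × ℝ × ℝ => f q.1 q.2.1 q.2.2)
      (Icc x0 x1 ×ˢ Icc y0 y1 ×ˢ Icc t0 t1))
    (hb : ∀ x ∈ Icc x0 x1, ∀ y ∈ Icc y0 y1, ∀ t ∈ Icc t0 t1,
      (x = x0 ∨ x = x1 ∨ y = y0 ∨ y = y1 ∨ t = t0) → f x y t ≤ 0)
    (hint : ∀ x ∈ Ioo x0 x1, ∀ y ∈ Ioo y0 y1, ∀ t ∈ Ioc t0 t1, 0 < f x y t →
      IsLocalMax (fun s => f s y t) x → IsLocalMax (fun s => f x s t) y →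
      (∀ s ∈ Icc t0 t, f x y s ≤ f x y t) → False) :
    ∀ x ∈ Icc x0 x1, ∀ y ∈ Icc y0 y1, ∀ t ∈ Icc t0 t1, f x y t ≤ 0 := by
  intro x hx y hy t ht
  by_contra hpos
  push Not at hpos
  have hK : IsCompact (Icc x0 x1 ×ˢ Icc y0 y1 ×ˢ Icc t0 t1) :=
    isCompact_Icc.prod (isCompact_Icc.prod isCompact_Icc)
  obtain ⟨⟨a, b, c⟩, ⟨ha, hbb, hcc⟩, hmax⟩ := hK.exists_isMaxOn ⟨(x, y, t), hx, hy, ht⟩ hc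
  have hM : ∀ x ∈ Icc x0 x1, ∀ y ∈ Icc y0 y1, ∀ t ∈ Icc t0 t1, f x y t ≤ f a b c :=
    fun x hx y hy t ht => hmax (show (x, y, t) ∈ _ from ⟨hx, hy, ht⟩)
  simp only at ha hbb hcc
  have hp : 0 < f a b c := hpos.trans_le (hM x hx y hy t ht)
  have hnb : ¬ (a = x0 ∨ a = x1 ∨ b = y0 ∨ b = y1 ∨ c = t0) :=
    fun h => absurd (hb a ha b hbb c hcc h) (not_le.2 hp)
  push Not at hnb
  obtain ⟨n1, n2, n3, n4, n5⟩ := hnb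
  have ha' : a ∈ Ioo x0 x1 := ⟨lt_of_le_of_ne ha.1 (Ne.symm n1), lt_of_le_of_ne ha.2 n2⟩
  have hb' : b ∈ Ioo y0 y1 := ⟨lt_of_le_of_ne hbb.1 (Ne.symm n3), lt_of_le_of_ne hbb.2 n4⟩
  refine hint a ha' b hb' c ⟨lt_of_le_of_ne hcc.1 (Ne.symm n5), hcc.2⟩ hp ?_ ?_ ?_
  · filter_upwards [Icc_mem_nhds ha'.1 ha'.2] with s hs using hM s hs b hbb c hcc
  · filter_upwards [Icc_mem_nhds hb'.1 hb'.2] with s hs using hM a ha s hs c hcc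
  · intro s hs
    exact hM a ha b hbb s ⟨hs.1, hs.2.trans hcc.2⟩

end Calc

section Basic

variable {u : ℝ → ℝ → ℝ → ℝ} {x y t : ℝ}

theorem C21At.dx (h : C21At u x y t) : HasDerivAt (fun s => u s y t) (pdx u x y t) x :=
  h.1.hasDerivAt
theorem C21At.dy (h : C21At u x y t) : HasDerivAt (fun s => u x s t) (pdy u x y t) y :=
  h.2.1.hasDerivAt
theorem C21At.dt (h : C21At u x y t) : HasDerivAt (fun s => u x y s) (pdt u x y t) t :=
  h.2.2.1.hasDerivAt
theorem C21At.dxx (h : C21At u x y t) : HasDerivAt (fun s => pdx u s y t) (pdxx u x y t) x :=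
  h.2.2.2.1.hasDerivAt
theorem C21At.dyy (h : C21At u x y t) : HasDerivAt (fun s => pdy u x s t) (pdyy u x y t) y :=
  h.2.2.2.2.1.hasDerivAt
theorem C21At.cu (h : C21At u x y t) :
    ContinuousAt (fun q : ℝ × ℝ × ℝ => u q.1 q.2.1 q.2.2) (x, y, t) := h.2.2.2.2.2.2.1
theorem C21At.cx (h : C21At u x y t) :
    ContinuousAt (fun q : ℝ × ℝ × ℝ => pdx u q.1 q.2.1 q.2.2) (x, y, t) := h.2.2.2.2.2.2.2.1
theorem C21At.cy (h : C21At u x y t) :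
    ContinuousAt (fun q : ℝ × ℝ × ℝ => pdy u q.1 q.2.1 q.2.2) (x, y, t) := h.2.2.2.2.2.2.2.2.1
theorem C21At.ct (h : C21At u x y t) :
    ContinuousAt (fun q : ℝ × ℝ × ℝ => pdt u q.1 q.2.1 q.2.2) (x, y, t) := h.2.2.2.2.2.2.2.2.2.1
theorem C21At.cxx (h : C21At u x y t) :
    ContinuousAt (fun q : ℝ × ℝ × ℝ => pdxx u q.1 q.2.1 q.2.2) (x, y, t) :=
  h.2.2.2.2.2.2.2.2.2.2.1

structure Good (p l T : ℝ) (u : ℝ → ℝ → ℝ → ℝ) : Prop where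
  hp : 2 < p
  hp3 : p ≤ 3
  hl : 0 < l
  hT : 0 < T
  reg : ∀ x y t : ℝ, |x| ≤ 2 * l → 0 ≤ y → y ≤ 2 * l → T / 2 ≤ t → t ≤ T →
    ¬(x = 0 ∧ y = 0 ∧ t = T) → C21At u x y t
  pde : ∀ x y t : ℝ, |x| ≤ 2 * l → 0 < y → y ≤ 2 * l → T / 2 ≤ t → t < T →
    pdt u x y t - (pdxx u x y t + pdyy u x y t) = gradNorm u x y t ^ p
  bc : ∀ x t : ℝ, |x| ≤ 2 * l → T / 2 ≤ t → t < T → u x 0 t = 0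
  nonneg : ∀ x y t : ℝ, |x| ≤ 2 * l → 0 ≤ y → y ≤ 2 * l → T / 2 ≤ t → t < T → 0 ≤ u x y t
  mon : ∀ x y t : ℝ, |x| ≤ 2 * l → 0 < y → y ≤ 2 * l → T / 2 ≤ t → t < T → x * pdx u x y t ≤ 0
  blow : ∀ M : ℝ, ∀ δ > (0:ℝ), ∃ x y t : ℝ, 0 ≤ y ∧ t < T ∧ |x| < δ ∧ |y| < δ ∧ T - δ < t ∧
    M < gradNorm u x y t

variable {p l T : ℝ}

theorem Good.reg' (G : Good p l T u) {x y t : ℝ} (hx : |x| ≤ 2 * l) (hy : 0 ≤ y) (hy2 : y ≤ 2 * l)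
    (ht : T / 2 ≤ t) (ht2 : t < T) : C21At u x y t :=
  G.reg x y t hx hy hy2 ht ht2.le (fun h => absurd h.2.2 ht2.ne)

theorem Good.bddK (G : Good p l T u) {δ : ℝ} (hδ : 0 < δ) : ∃ M > 0, ∀ x y t : ℝ,
    |x| ≤ 2 * l → 0 ≤ y → y ≤ 2 * l → T / 2 ≤ t → t ≤ T → (δ ≤ |x| ∨ δ ≤ y ∨ t ≤ T - δ) →
    |pdx u x y t| ≤ M ∧ |pdy u x y t| ≤ M ∧ |pdt u x y t| ≤ M ∧ |pdxx u x y t| ≤ M := by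
  let K : Set (ℝ × ℝ × ℝ) := (Icc (-(2 * l)) (2 * l) ×ˢ Icc 0 (2 * l) ×ˢ Icc (T / 2) T) ∩
    ({q | δ ≤ |q.1|} ∪ ({q | δ ≤ q.2.1} ∪ {q | q.2.2 ≤ T - δ}))
  have hK : IsCompact K := by
    refine (isCompact_Icc.prod (isCompact_Icc.prod isCompact_Icc)).inter_right ?_
    refine IsClosed.union ?_ (IsClosed.union ?_ ?_)
    · exact isClosed_le continuous_const (by fun_prop)
    · exact isClosed_le continuous_const (by fun_prop)
    · exact isClosed_le (by fun_prop) continuous_const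
  have hreg : ∀ q ∈ K, C21At u q.1 q.2.1 q.2.2 := by
    rintro ⟨x, y, t⟩ ⟨⟨hx, hy, ht⟩, h⟩
    refine G.reg x y t (abs_le.2 hx) hy.1 hy.2 ht.1 ht.2 ?_
    rintro ⟨rfl, rfl, rfl⟩
    simp only [mem_union, mem_ofPred_eq, abs_zero] at h
    rcases h with h | h | h <;> linarith
  have bd : ∀ f : ℝ × ℝ × ℝ → ℝ, (∀ q ∈ K, ContinuousAt f q) → ∃ M, ∀ q ∈ K, |f q| ≤ M := by
    intro f hf
    obtain ⟨M, hM⟩ := hK.exists_bound_of_continuousOn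
      (fun q hq => (hf q hq).continuousWithinAt)
    exact ⟨M, fun q hq => by simpa using hM q hq⟩
  obtain ⟨M1, h1⟩ := bd _ (fun q hq => (hreg q hq).cx)
  obtain ⟨M2, h2⟩ := bd _ (fun q hq => (hreg q hq).cy)
  obtain ⟨M3, h3⟩ := bd _ (fun q hq => (hreg q hq).ct)
  obtain ⟨M4, h4⟩ := bd _ (fun q hq => (hreg q hq).cxx)
  refine ⟨|M1| + |M2| + |M3| + |M4| + 1, by positivity, ?_⟩
  intro x y t hx hy hy2 ht ht2 h
  have hq : (x, y, t) ∈ K := ⟨⟨abs_le.1 hx, ⟨hy, hy2⟩, ⟨ht, ht2⟩⟩, h⟩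
  have a1 := h1 _ hq
  have a2 := h2 _ hq
  have a3 := h3 _ hq
  have a4 := h4 _ hq
  simp only at a1 a2 a3 a4
  have := le_abs_self M1
  have := le_abs_self M2
  have := le_abs_self M3
  have := le_abs_self M4
  have := abs_nonneg M1
  have := abs_nonneg M2
  have := abs_nonneg M3
  have := abs_nonneg M4
  refine ⟨?_, ?_, ?_, ?_⟩ <;> linarith

theorem cont_comp {f : ℝ × ℝ × ℝ → ℝ} {g : ℝ × ℝ × ℝ → ℝ × ℝ × ℝ} {q : ℝ × ℝ × ℝ}
    (hg : Continuous g) (hf : ContinuousAt f (g q)) : ContinuousAt (fun q => f (g q)) q :=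
  ContinuousAt.comp (f := g) (g := f) hf hg.continuousAt

theorem Good.tdiff (G : Good p l T u) : ∃ M > 0, ∀ σ : ℝ, (σ = 1 ∨ σ = -1) → ∀ h, 0 < h → h < T / 8 →
    ∀ x ∈ Icc (-l) l, ∀ y ∈ Icc 0 l, ∀ t, T / 2 ≤ t → t + h < T →
    σ * (u x y (t + h) - u x y t) ≤ M * h := by
  have hl := G.hl
  have hT := G.hT
  obtain ⟨M, hM, hB⟩ := G.bddK (δ := min l (T / 4)) (lt_min hl (by linarith))
  have hδl : min l (T / 4) ≤ l := min_le_left _ _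
  have hδT : min l (T / 4) ≤ T / 4 := min_le_right _ _
  generalize min l (T / 4) = δ at *
  refine ⟨M, hM, ?_⟩
  intro σ hσ h hh hhT x hx y hy t1 ht1 ht1h
  have hσ1 : |σ| = 1 := by rcases hσ with rfl | rfl <;> simp
  have key : ∀ ε > 0, ∀ x ∈ Icc (-l) l, ∀ y ∈ Icc 0 l, ∀ t ∈ Icc (T / 2) t1,
      σ * (u x y (t + h) - u x y t) - M * h - ε * (t - T / 2) ≤ 0 := by
    intro ε hε
    have ax : ∀ x ∈ Icc (-l) l, |x| ≤ 2 * l := fun x hx => abs_le.2 ⟨by linarith [hx.1], by linarith [hx.2]⟩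
    have R1 : ∀ x ∈ Icc (-l) l, ∀ y ∈ Icc 0 l, ∀ t ∈ Icc (T / 2) t1, C21At u x y t :=
      fun x hx y hy t ht => G.reg' (ax x hx) hy.1 (by linarith [hy.2]) ht.1 (by linarith [ht.2])
    have R2 : ∀ x ∈ Icc (-l) l, ∀ y ∈ Icc 0 l, ∀ t ∈ Icc (T / 2) t1, C21At u x y (t + h) :=
      fun x hx y hy t ht => G.reg' (ax x hx) hy.1 (by linarith [hy.2]) (by linarith [ht.1])
        (by linarith [ht.2])
    refine box_max (fun x y t => σ * (u x y (t + h) - u x y t) - M * h - ε * (t - T / 2)) ?_ ?_ ?_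
    · rintro ⟨x, y, t⟩ ⟨hx, hy, ht⟩
      refine ContinuousAt.continuousWithinAt ?_
      have c1 := (R1 x hx y hy t ht).cu
      have c2 := cont_comp (g := fun q : ℝ × ℝ × ℝ => (q.1, q.2.1, q.2.2 + h)) (q := (x, y, t))
        (by fun_prop) (R2 x hx y hy t ht).cu
      exact ((continuousAt_const.mul (c2.sub c1)).sub continuousAt_const).sub (by fun_prop)
    · intro x hx y hy t ht hbd
      have h0 : 0 ≤ ε * (t - T / 2) := mul_nonneg hε.le (by linarith [ht.1])
      by_cases hy0 : y = 0
      · subst hy0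
        rw [G.bc x _ (ax x hx) (by linarith [ht.1]) (by linarith [ht.2]),
          G.bc x _ (ax x hx) ht.1 (by linarith [ht.2])]
        have := mul_pos hM hh
        linarith
      have hd : ∀ s ∈ Icc t (t + h), |pdt u x y s| ≤ M := by
        intro s hs
        refine (hB x y s (ax x hx) hy.1 (by linarith [hy.2]) (by linarith [hs.1, ht.1])
          (by linarith [hs.2, ht.2]) ?_).2.2.1
        rcases hbd with rfl | rfl | rfl | rfl | rfl
        · left; rw [abs_neg, abs_of_pos hl]; exact hδl
        · left; rw [abs_of_pos (by linarith)]; exact hδl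
        · exact absurd rfl hy0
        · right; left; exact hδl
        · right; right; linarith [hs.2]
      have hder : ∀ s ∈ Icc t (t + h), HasDerivAt (fun s => σ * u x y s) (σ * pdt u x y s) s := by
        intro s hs
        exact ((G.reg' (ax x hx) hy.1 (by linarith [hy.2]) (by linarith [hs.1, ht.1])
          (by linarith [hs.2, ht.2])).dt).const_mul σ
      have := mvt_le (m := M) (by linarith : t ≤ t + h)
        (fun s hs => (hder s hs).continuousAt.continuousWithinAt)
        (fun s hs => hder s ⟨hs.1.le, hs.2.le⟩)
        (fun s hs => by
          have h1 := hd s ⟨hs.1.le, hs.2.le⟩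
          have h2 := le_abs_self (σ * pdt u x y s)
          rw [abs_mul, hσ1, one_mul] at h2
          linarith)
      nlinarith
    · intro x hx y hy t ht hpos mx my mt
      have hx' : x ∈ Icc (-l) l := ⟨hx.1.le, hx.2.le⟩
      have hy' : y ∈ Icc 0 l := ⟨hy.1.le, hy.2.le⟩
      have ht' : t ∈ Icc (T / 2) t1 := ⟨ht.1.le, ht.2⟩
      have dX : ∀ s ∈ Icc (-l) l, HasDerivAt
          (fun s => σ * (u s y (t + h) - u s y t) - M * h - ε * (t - T / 2))
          (σ * (pdx u s y (t + h) - pdx u s y t)) s := fun s hs =>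
        ((((R2 s hs y hy' t ht').dx.sub (R1 s hs y hy' t ht').dx).const_mul σ).sub_const _).sub_const _
      have dY : ∀ s ∈ Icc 0 l, HasDerivAt
          (fun s => σ * (u x s (t + h) - u x s t) - M * h - ε * (t - T / 2))
          (σ * (pdy u x s (t + h) - pdy u x s t)) s := fun s hs =>
        ((((R2 x hx' s hs t ht').dy.sub (R1 x hx' s hs t ht').dy).const_mul σ).sub_const _).sub_const _
      have dXX : HasDerivAt (fun s => σ * (pdx u s y (t + h) - pdx u s y t))
          (σ * (pdxx u x y (t + h) - pdxx u x y t)) x :=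
        ((R2 x hx' y hy' t ht').dxx.sub (R1 x hx' y hy' t ht').dxx).const_mul σ
      have dYY : HasDerivAt (fun s => σ * (pdy u x s (t + h) - pdy u x s t))
          (σ * (pdyy u x y (t + h) - pdyy u x y t)) y :=
        ((R2 x hx' y hy' t ht').dyy.sub (R1 x hx' y hy' t ht').dyy).const_mul σ
      have dT : HasDerivAt
          (fun s => σ * (u x y (s + h) - u x y s) - M * h - ε * (s - T / 2))
          (σ * (pdt u x y (t + h) - pdt u x y t) - ε) t := by
        have e1 := (R2 x hx' y hy' t ht').dt.comp_add_const t h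
        have e2 := (((hasDerivAt_id t).sub_const (T / 2)).const_mul ε)
        refine ((((e1.sub (R1 x hx' y hy' t ht').dt).const_mul σ).sub_const (M * h)).sub e2).congr_deriv ?_
        simp
      have s1 := mx.hasDerivAt_eq_zero (dX x hx')
      have s2 := my.hasDerivAt_eq_zero (dY y hy')
      have s3 := snd_deriv_nonpos mx (by
        filter_upwards [Icc_mem_nhds hx.1 hx.2] with s hs using dX s hs) dXX
      have s4 := snd_deriv_nonpos my (by
        filter_upwards [Icc_mem_nhds hy.1 hy.2] with s hs using dY s hs) dYY
      have s5 := deriv_left_nonneg ht.1 mt dT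
      have hσ0 : σ ≠ 0 := by rcases hσ with rfl | rfl <;> norm_num
      have g1 : pdx u x y (t + h) = pdx u x y t := by
        have := (mul_eq_zero.1 s1).resolve_left hσ0; linarith
      have g2 : pdy u x y (t + h) = pdy u x y t := by
        have := (mul_eq_zero.1 s2).resolve_left hσ0; linarith
      have P1 := G.pde x y t (ax x hx') hy.1 (by linarith [hy.2]) ht.1.le (by linarith [ht.2])
      have P2 := G.pde x y (t + h) (ax x hx') hy.1 (by linarith [hy.2]) (by linarith [ht.1])
        (by linarith [ht.2])
      have gg : gradNorm u x y (t + h) = gradNorm u x y t := by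
        unfold gradNorm; rw [g1, g2]
      rw [gg] at P2
      have : pdt u x y (t + h) - pdt u x y t = (pdxx u x y (t + h) - pdxx u x y t) +
        (pdyy u x y (t + h) - pdyy u x y t) := by linarith
      rw [this] at s5
      linarith
  refine le_of_forall_pos_le_add ?_
  intro ε hε
  have h2 : 0 < T := hT
  have := key (ε / T) (by positivity) x hx y hy t1 ⟨ht1, le_refl _⟩
  have h3 : ε / T * (t1 - T / 2) ≤ ε / T * T :=
    mul_le_mul_of_nonneg_left (by linarith) (by positivity)
  rw [div_mul_cancel₀ _ hT.ne'] at h3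
  linarith

theorem Good.ut (G : Good p l T u) : ∃ M > 0, ∀ x ∈ Icc (-l) l, ∀ y ∈ Icc 0 l, ∀ t, T / 2 ≤ t → t < T →
    |pdt u x y t| ≤ M := by
  obtain ⟨M, hM, hD⟩ := G.tdiff
  refine ⟨M, hM, ?_⟩
  intro x hx y hy t ht htT
  have hl := G.hl
  have hT := G.hT
  have ax : |x| ≤ 2 * l := abs_le.2 ⟨by linarith [hx.1], by linarith [hx.2]⟩
  have R := G.reg' ax hy.1 (by linarith [hy.2]) ht htT
  have main : ∀ σ : ℝ, (σ = 1 ∨ σ = -1) → σ * pdt u x y t ≤ M := by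
    intro σ hσ
    have hd : HasDerivAt (fun s => σ * u x y s - M * s) (σ * pdt u x y t - M) t := by
      refine ((R.dt.const_mul σ).sub ((hasDerivAt_id t).const_mul M)).congr_deriv ?_
      simp
    have := deriv_right_nonpos (t0 := min T (t + T / 8)) (lt_min htT (by linarith)) (f := fun s => σ * u x y s - M * s) (by
      intro s hs
      have h1 : s < T := hs.2.trans_le (min_le_left _ _)
      have h2 : s < t + T / 8 := hs.2.trans_le (min_le_right _ _)
      have := hD σ hσ (s - t) (by linarith [hs.1]) (by linarith) x hx y hy t ht (by linarith)
      rw [add_sub_cancel] at this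
      linarith) hd
    linarith
  rw [abs_le]
  have a := main 1 (Or.inl rfl)
  have b := main (-1) (Or.inr rfl)
  constructor <;> linarith

theorem Good.xdiff (G : Good p l T u) : ∃ M > 0, ∀ h, 0 < h → h < l / 2 →
    ∀ x ∈ Icc (-l) l, ∀ y ∈ Icc 0 l, ∀ t, T / 2 ≤ t → t < T →
    -(M * h ^ 2) ≤ u (x + h) y t + u (x - h) y t - 2 * u x y t := by
  have hl := G.hl
  have hT := G.hT
  obtain ⟨M, hM, hB⟩ := G.bddK (δ := min (l / 2) (T / 4)) (lt_min (by linarith) (by linarith))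
  have hδl : min (l / 2) (T / 4) ≤ l / 2 := min_le_left _ _
  have hδT : min (l / 2) (T / 4) ≤ T / 4 := min_le_right _ _
  generalize min (l / 2) (T / 4) = δ at *
  refine ⟨M, hM, ?_⟩
  intro h hh hhl x hx y hy t1 ht1 ht1T
  have key : ∀ ε > 0, ∀ x ∈ Icc (-l) l, ∀ y ∈ Icc 0 l, ∀ t ∈ Icc (T / 2) t1,
      2 * u x y t - u (x + h) y t - u (x - h) y t - M * h ^ 2 - ε * (t - T / 2) ≤ 0 := by
    intro ε hε
    have ax : ∀ x ∈ Icc (-l) l, |x| ≤ 2 * l := fun x hx => abs_le.2 ⟨by linarith [hx.1], by linarith [hx.2]⟩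
    have axp : ∀ x ∈ Icc (-l) l, |x + h| ≤ 2 * l := fun x hx => abs_le.2 ⟨by linarith [hx.1], by linarith [hx.2]⟩
    have axm : ∀ x ∈ Icc (-l) l, |x - h| ≤ 2 * l := fun x hx => abs_le.2 ⟨by linarith [hx.1], by linarith [hx.2]⟩
    have R0 : ∀ x, |x| ≤ 2 * l → ∀ y ∈ Icc 0 l, ∀ t ∈ Icc (T / 2) t1, C21At u x y t :=
      fun x hx y hy t ht => G.reg' hx hy.1 (by linarith [hy.2]) ht.1 (by linarith [ht.2])
    refine box_max (fun x y t => 2 * u x y t - u (x + h) y t - u (x - h) y t - M * h ^ 2 - ε * (t - T / 2)) ?_ ?_ ?_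
    · rintro ⟨x, y, t⟩ ⟨hx, hy, ht⟩
      refine ContinuousAt.continuousWithinAt ?_
      have c1 := (R0 x (ax x hx) y hy t ht).cu
      have c2 := cont_comp (g := fun q : ℝ × ℝ × ℝ => (q.1 + h, q.2.1, q.2.2)) (q := (x, y, t))
        (by fun_prop) (R0 (x + h) (axp x hx) y hy t ht).cu
      have c3 := cont_comp (g := fun q : ℝ × ℝ × ℝ => (q.1 - h, q.2.1, q.2.2)) (q := (x, y, t))
        (by fun_prop) (R0 (x - h) (axm x hx) y hy t ht).cu
      exact ((((continuousAt_const.mul c1).sub c2).sub c3).sub continuousAt_const).sub (by fun_prop)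
    · intro x hx y hy t ht hbd
      have h0 : 0 ≤ ε * (t - T / 2) := mul_nonneg hε.le (by linarith [ht.1])
      by_cases hy0 : y = 0
      · subst hy0
        rw [G.bc x _ (ax x hx) (by linarith [ht.1]) (by linarith [ht.2]),
          G.bc _ _ (axp x hx) ht.1 (by linarith [ht.2]), G.bc _ _ (axm x hx) ht.1 (by linarith [ht.2])]
        have := mul_pos hM (pow_pos hh 2)
        linarith
      have axs : ∀ s ∈ Icc (x - h) (x + h), |s| ≤ 2 * l := fun s hs =>
        abs_le.2 ⟨by linarith [hs.1, hx.1], by linarith [hs.2, hx.2]⟩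
      have := snd_diff_ge (f := fun s => u s y t) (f' := fun s => pdx u s y t)
        (f'' := fun s => pdxx u s y t) (x := x) (h := h) (m := -M) hh.le
        (fun s hs => (R0 s (axs s hs) y hy t ht).dx)
        (fun s hs => (R0 s (axs s hs) y hy t ht).dxx) (by
          intro s hs
          refine (abs_le.1 (hB s y t (axs s hs) hy.1 (by linarith [hy.2]) ht.1
            (by linarith [ht.2]) ?_).2.2.2).1
          rcases hbd with rfl | rfl | rfl | rfl | rfl
          · left; rw [abs_of_nonpos (by linarith [hs.2])]; linarith [hs.2]
          · left; rw [abs_of_nonneg (by linarith [hs.1])]; linarith [hs.1]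
          · exact absurd rfl hy0
          · right; left; linarith
          · right; right; linarith)
      linarith
    · intro x hx y hy t ht hpos mx my mt
      have hx' : x ∈ Icc (-l) l := ⟨hx.1.le, hx.2.le⟩
      have hy' : y ∈ Icc 0 l := ⟨hy.1.le, hy.2.le⟩
      have ht' : t ∈ Icc (T / 2) t1 := ⟨ht.1.le, ht.2⟩
      have dX : ∀ s ∈ Icc (-l) l, HasDerivAt
          (fun s => 2 * u s y t - u (s + h) y t - u (s - h) y t - M * h ^ 2 - ε * (t - T / 2))
          (2 * pdx u s y t - pdx u (s + h) y t - pdx u (s - h) y t) s := fun s hs =>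
        (((((R0 s (ax s hs) y hy' t ht').dx.const_mul 2).sub
          ((R0 _ (axp s hs) y hy' t ht').dx.comp_add_const s h)).sub
          ((R0 _ (axm s hs) y hy' t ht').dx.comp_sub_const s h)).sub_const _).sub_const _
      have dY : ∀ s ∈ Icc 0 l, HasDerivAt
          (fun s => 2 * u x s t - u (x + h) s t - u (x - h) s t - M * h ^ 2 - ε * (t - T / 2))
          (2 * pdy u x s t - pdy u (x + h) s t - pdy u (x - h) s t) s := fun s hs =>
        (((((R0 x (ax x hx') s hs t ht').dy.const_mul 2).sub
          (R0 _ (axp x hx') s hs t ht').dy).sub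
          (R0 _ (axm x hx') s hs t ht').dy).sub_const _).sub_const _
      have dXX : HasDerivAt (fun s => 2 * pdx u s y t - pdx u (s + h) y t - pdx u (s - h) y t)
          (2 * pdxx u x y t - pdxx u (x + h) y t - pdxx u (x - h) y t) x :=
        (((R0 x (ax x hx') y hy' t ht').dxx.const_mul 2).sub
          ((R0 _ (axp x hx') y hy' t ht').dxx.comp_add_const x h)).sub
          ((R0 _ (axm x hx') y hy' t ht').dxx.comp_sub_const x h)
      have dYY : HasDerivAt (fun s => 2 * pdy u x s t - pdy u (x + h) s t - pdy u (x - h) s t)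
          (2 * pdyy u x y t - pdyy u (x + h) y t - pdyy u (x - h) y t) y :=
        (((R0 x (ax x hx') y hy' t ht').dyy.const_mul 2).sub
          (R0 _ (axp x hx') y hy' t ht').dyy).sub
          (R0 _ (axm x hx') y hy' t ht').dyy
      have dT : HasDerivAt
          (fun s => 2 * u x y s - u (x + h) y s - u (x - h) y s - M * h ^ 2 - ε * (s - T / 2))
          (2 * pdt u x y t - pdt u (x + h) y t - pdt u (x - h) y t - ε) t := by
        have e2 := (((hasDerivAt_id t).sub_const (T / 2)).const_mul ε)
        refine ((((((R0 x (ax x hx') y hy' t ht').dt.const_mul 2).sub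
          (R0 _ (axp x hx') y hy' t ht').dt).sub
          (R0 _ (axm x hx') y hy' t ht').dt).sub_const (M * h ^ 2)).sub e2).congr_deriv ?_
        simp
      have s1 := mx.hasDerivAt_eq_zero (dX x hx')
      have s2 := my.hasDerivAt_eq_zero (dY y hy')
      have s3 := snd_deriv_nonpos mx (by
        filter_upwards [Icc_mem_nhds hx.1 hx.2] with s hs using dX s hs) dXX
      have s4 := snd_deriv_nonpos my (by
        filter_upwards [Icc_mem_nhds hy.1 hy.2] with s hs using dY s hs) dYY
      have s5 := deriv_left_nonneg ht.1 mt dT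
      have pp : ∀ z, |z| ≤ 2 * l → _ := fun z hz =>
        G.pde z y t hz hy.1 (by linarith [hy.2]) ht.1.le (by linarith [ht.2])
      have P1 := pp x (ax x hx')
      have P2 := pp _ (axp x hx')
      have P3 := pp _ (axm x hx')
      have I1 := pow_grad_ineq G.hp (pdx u x y t) (pdy u x y t) (pdx u (x + h) y t) (pdy u (x + h) y t)
      have I2 := pow_grad_ineq G.hp (pdx u x y t) (pdy u x y t) (pdx u (x - h) y t) (pdy u (x - h) y t)
      have I3 : p * √(pdx u x y t ^ 2 + pdy u x y t ^ 2) ^ (p - 2) *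
          (pdx u x y t * (pdx u x y t - pdx u (x + h) y t) + pdy u x y t * (pdy u x y t - pdy u (x + h) y t))
          + p * √(pdx u x y t ^ 2 + pdy u x y t ^ 2) ^ (p - 2) *
          (pdx u x y t * (pdx u x y t - pdx u (x - h) y t) + pdy u x y t * (pdy u x y t - pdy u (x - h) y t))
          = p * √(pdx u x y t ^ 2 + pdy u x y t ^ 2) ^ (p - 2) *
          (pdx u x y t * (2 * pdx u x y t - pdx u (x + h) y t - pdx u (x - h) y t) +
            pdy u x y t * (2 * pdy u x y t - pdy u (x + h) y t - pdy u (x - h) y t)) := by ring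
      rw [s1, s2, mul_zero, mul_zero, add_zero, mul_zero] at I3
      change _ = √(pdx u x y t ^ 2 + pdy u x y t ^ 2) ^ p at P1
      change _ = √(pdx u (x + h) y t ^ 2 + pdy u (x + h) y t ^ 2) ^ p at P2
      change _ = √(pdx u (x - h) y t ^ 2 + pdy u (x - h) y t ^ 2) ^ p at P3
      linarith
  have : 2 * u x y t1 - u (x + h) y t1 - u (x - h) y t1 - M * h ^ 2 ≤ 0 := by
    refine le_of_forall_pos_le_add ?_
    intro ε hε
    have := key (ε / T) (by positivity) x hx y hy t1 ⟨ht1, le_refl _⟩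
    have h3 : ε / T * (t1 - T / 2) ≤ ε / T * T :=
      mul_le_mul_of_nonneg_left (by linarith) (by positivity)
    rw [div_mul_cancel₀ _ hT.ne'] at h3
    linarith
  linarith

theorem Good.uxx (G : Good p l T u) : ∃ M > 0, ∀ x ∈ Icc (-l) l, ∀ y ∈ Icc 0 l, ∀ t, T / 2 ≤ t → t < T →
    -M ≤ pdxx u x y t := by
  obtain ⟨M, hM, hD⟩ := G.xdiff
  refine ⟨M, hM, ?_⟩
  intro x hx y hy t ht htT
  have hl := G.hl
  by_contra hc
  push Not at hc
  have ax : |x| ≤ 2 * l := abs_le.2 ⟨by linarith [hx.1], by linarith [hx.2]⟩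
  have R := G.reg' ax hy.1 (by linarith [hy.2]) ht htT
  obtain ⟨m, hm1, hm2⟩ := exists_between hc
  have c1 : ContinuousAt (fun s => pdxx u s y t) x :=
    ContinuousAt.comp (f := fun s : ℝ => ((s, y, t) : ℝ × ℝ × ℝ)) (x := x) R.cxx (by fun_prop)
  obtain ⟨r, hr, H⟩ := Metric.eventually_nhds_iff.1 (c1.eventually (gt_mem_nhds hm1))
  set h := min (r / 2) (l / 4) with hh
  have h0 : 0 < h := lt_min (by linarith) (by linarith)
  have h1 : h ≤ r / 2 := min_le_left _ _
  have h2 : h ≤ l / 4 := min_le_right _ _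
  have axs : ∀ s ∈ Icc (x - h) (x + h), |s| ≤ 2 * l := fun s hs =>
        abs_le.2 ⟨by linarith [hs.1, hx.1], by linarith [hs.2, hx.2]⟩
  have R0 : ∀ s ∈ Icc (x - h) (x + h), C21At u s y t := fun s hs =>
    G.reg' (axs s hs) hy.1 (by linarith [hy.2]) ht htT
  have := snd_diff_ge (f := fun s => - u s y t) (f' := fun s => - pdx u s y t)
        (f'' := fun s => - pdxx u s y t) (x := x) (h := h) (m := -m) h0.le
        (fun s hs => (R0 s hs).dx.neg)
        (fun s hs => (R0 s hs).dxx.neg) (by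
          intro s hs
          have := H (y := s) (by rw [Real.dist_eq, abs_lt]; constructor <;> linarith [hs.1, hs.2])
          linarith)
  have h3 := hD h h0 (by linarith) x hx y hy t ht htT
  have h4 : 0 < h ^ 2 := by positivity
  nlinarith

end Basic

def al (p : ℝ) : ℝ := (p - 2) / (p - 1)
def dd (p : ℝ) : ℝ := (1 - al p) ^ (1 - al p)

section Params
variable {p : ℝ}

theorem al_pos (hp : 2 < p) : 0 < al p := div_pos (by linarith) (by linarith)
theorem al_le (hp : 2 < p) (hp3 : p ≤ 3) : al p ≤ 1 / 2 := by
  unfold al; rw [div_le_iff₀ (by linarith)]; linarith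
theorem al_mul (hp : 2 < p) : (1 - al p) * (p - 1) = 1 := by
  unfold al
  have : p - 1 ≠ 0 := by linarith
  field_simp
  ring
theorem al_lt (hp : 2 < p) : al p < 1 := by
  unfold al; rw [div_lt_one (by linarith)]; linarith
theorem dd_pos (hp : 2 < p) : 0 < dd p := Real.rpow_pos_of_pos (by linarith [al_lt hp]) _
theorem dd_pow (hp : 2 < p) : dd p ^ (p - 1) = 1 - al p := by
  unfold dd
  rw [← Real.rpow_mul (by linarith [al_lt hp]), al_mul hp, Real.rpow_one]
theorem dd_pow1 (hp : 2 < p) {s : ℝ} (hs : 0 < s) :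
    (dd p * s ^ (al p - 1)) ^ (p - 1) = (1 - al p) * s⁻¹ := by
  rw [Real.mul_rpow (dd_pos hp).le (Real.rpow_nonneg hs.le _), dd_pow hp, ← Real.rpow_mul hs.le]
  have : (al p - 1) * (p - 1) = -1 := by linarith [al_mul hp]
  rw [this, Real.rpow_neg_one]
theorem dd_powp (hp : 2 < p) {s : ℝ} (hs : 0 < s) :
    (dd p * s ^ (al p - 1)) ^ p = dd p * (1 - al p) * s ^ (al p - 2) := by
  have h0 : 0 < dd p * s ^ (al p - 1) := mul_pos (dd_pos hp) (Real.rpow_pos_of_pos hs _)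
  have e : (dd p * s ^ (al p - 1)) ^ p = (dd p * s ^ (al p - 1)) ^ (1 + (p - 1)) := by
    congr 1; ring
  rw [e, Real.rpow_add h0, Real.rpow_one, dd_pow1 hp hs]
  have : s ^ (al p - 2) = s ^ (al p - 1) * s⁻¹ := by
    rw [← Real.rpow_neg_one, ← Real.rpow_add hs]; congr 1; ring
  rw [this]; ring
end Params

section ODE
variable {u : ℝ → ℝ → ℝ → ℝ} {p l T : ℝ}

theorem Good.pdx_bc (G : Good p l T u) {x t : ℝ} (hx : |x| ≤ l) (ht : T / 2 ≤ t) (htT : t < T) :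
    pdx u x 0 t = 0 := by
  have hl := G.hl
  have hx := abs_le.1 hx
  have : (fun s => u s 0 t) =ᶠ[nhds x] fun _ => 0 := by
    filter_upwards [Ioo_mem_nhds (show -(2 * l) < x by linarith) (show x < 2 * l by linarith)] with s hs
    exact G.bc s t (abs_le.2 ⟨hs.1.le, hs.2.le⟩) ht htT
  unfold pdx
  rw [this.deriv_eq]; simp

theorem Good.pdx_cx (G : Good p l T u) {x y t : ℝ} (hx : |x| ≤ 2 * l) (hy : 0 ≤ y) (hy2 : y ≤ 2 * l)
    (ht : T / 2 ≤ t) (htT : t < T) : ContinuousAt (fun s => pdx u s y t) x :=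
  ContinuousAt.comp (f := fun s : ℝ => ((s, y, t) : ℝ × ℝ × ℝ)) (x := x)
    (G.reg' hx hy hy2 ht htT).cx (by fun_prop)

theorem Good.pdx_zero (G : Good p l T u) {y t : ℝ} (hy : 0 ≤ y) (hy2 : y ≤ 2 * l)
    (ht : T / 2 ≤ t) (htT : t < T) : pdx u 0 y t = 0 := by
  have hl := G.hl
  rcases hy.eq_or_lt with rfl | hy0
  · exact G.pdx_bc (by simpa using hl.le) ht htT
  have hc := G.pdx_cx (x := 0) (by simp; linarith) hy hy2 ht htT
  apply le_antisymm
  · refine le_of_tendsto (hc.mono_left (nhdsWithin_le_nhds (s := Ioi 0))) ?_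
    filter_upwards [Ioo_mem_nhdsGT hl] with s hs
    have := G.mon s y t (abs_le.2 ⟨by linarith [hs.1], by linarith [hs.2]⟩) hy0 hy2 ht htT
    nlinarith [hs.1]
  · refine ge_of_tendsto (hc.mono_left (nhdsWithin_le_nhds (s := Iio 0))) ?_
    filter_upwards [Ioo_mem_nhdsLT (show -l < 0 by linarith)] with s hs
    have := G.mon s y t (abs_le.2 ⟨by linarith [hs.1], by linarith [hs.2]⟩) hy0 hy2 ht htT
    nlinarith [hs.2]

theorem Good.pdx_le (G : Good p l T u) {x y t : ℝ} (hx0 : 0 ≤ x) (hx : x ≤ l) (hy : 0 ≤ y) (hy2 : y ≤ 2 * l)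
    (ht : T / 2 ≤ t) (htT : t < T) : pdx u x y t ≤ 0 := by
  have hl := G.hl
  rcases hy.eq_or_lt with rfl | hy0
  · exact (G.pdx_bc (by rw [abs_of_nonneg hx0]; exact hx) ht htT).le
  rcases hx0.eq_or_lt with rfl | hx0
  · exact (G.pdx_zero hy hy2 ht htT).le
  have := G.mon x y t (abs_le.2 ⟨by linarith, by linarith⟩) hy0 hy2 ht htT
  nlinarith

theorem Good.pdxx_zero (G : Good p l T u) {y t : ℝ} (hy : 0 ≤ y) (hy2 : y ≤ 2 * l)
    (ht : T / 2 ≤ t) (htT : t < T) : pdxx u 0 y t ≤ 0 := by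
  have hl := G.hl
  refine deriv_right_nonpos (t0 := l) hl (f := fun s => pdx u s y t) ?_
    (G.reg' (by simp; linarith) hy hy2 ht htT).dxx
  intro s hs
  have := G.pdx_le hs.1.le hs.2.le hy hy2 ht htT
  have h2 := G.pdx_zero hy hy2 ht htT
  simp only [h2]
  exact this

theorem pdy_le_grad (u : ℝ → ℝ → ℝ → ℝ) (x y t : ℝ) : |pdy u x y t| ≤ gradNorm u x y t := by
  unfold gradNorm
  apply Real.le_sqrt_of_sq_le
  rw [sq_abs]; nlinarith [sq_nonneg (pdx u x y t)]
theorem pdx_le_grad (u : ℝ → ℝ → ℝ → ℝ) (x y t : ℝ) : |pdx u x y t| ≤ gradNorm u x y t := by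
  unfold gradNorm
  apply Real.le_sqrt_of_sq_le
  rw [sq_abs]; nlinarith [sq_nonneg (pdy u x y t)]
theorem gradNorm_nonneg (u : ℝ → ℝ → ℝ → ℝ) (x y t : ℝ) : 0 ≤ gradNorm u x y t := Real.sqrt_nonneg _

structure Cst (l T : ℝ) (u : ℝ → ℝ → ℝ → ℝ) (C : ℝ) : Prop where
  pos : 0 < C
  ut : ∀ x ∈ Icc (-l) l, ∀ y ∈ Icc 0 l, ∀ t, T / 2 ≤ t → t < T → |pdt u x y t| ≤ C
  uxx : ∀ x ∈ Icc (-l) l, ∀ y ∈ Icc 0 l, ∀ t, T / 2 ≤ t → t < T → -C ≤ pdxx u x y t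
  bulk : ∀ x ∈ Icc (-l) l, ∀ t, T / 2 ≤ t → t < T → |pdy u x l t| ≤ C

theorem Good.cst (G : Good p l T u) : ∃ C, Cst l T u C ∧ ∀ x ∈ Icc (-l) l, ∀ y ∈ Ioc 0 l, ∀ t, T / 2 ≤ t → t < T →
    pdyy u x y t ≤ C - gradNorm u x y t ^ p := by
  obtain ⟨M1, h1, H1⟩ := G.ut
  obtain ⟨M2, h2, H2⟩ := G.uxx
  obtain ⟨M3, h3, H3⟩ := G.bddK G.hl
  have hl := G.hl
  have ax : ∀ x ∈ Icc (-l) l, |x| ≤ 2 * l := fun x hx => abs_le.2 ⟨by linarith [hx.1], by linarith [hx.2]⟩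
  refine ⟨M1 + M2 + M3, ⟨by positivity, ?_, ?_, ?_⟩, ?_⟩
  · intro x hx y hy t ht htT; linarith [H1 x hx y hy t ht htT]
  · intro x hx y hy t ht htT; linarith [H2 x hx y hy t ht htT]
  · intro x hx t ht htT
    linarith [(H3 x l t (ax x hx) hl.le (by linarith) ht htT.le (by simp)).2.1]
  · intro x hx y hy t ht htT
    have a := H1 x hx y ⟨hy.1.le, hy.2⟩ t ht htT
    have b := H2 x hx y ⟨hy.1.le, hy.2⟩ t ht htT
    have c := G.pde x y t (ax x hx) hy.1 (by linarith [hy.2]) ht htT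
    linarith [(abs_le.1 a).2]

theorem Good.w_le (G : Good p l T u) {C : ℝ} (hC : 0 < C) (H : ∀ x ∈ Icc (-l) l, ∀ y ∈ Ioc 0 l, ∀ t, T / 2 ≤ t → t < T →
    pdyy u x y t ≤ C - gradNorm u x y t ^ p) {x : ℝ} (hx : x ∈ Icc (-l) l) {t : ℝ} (ht : T / 2 ≤ t) (htT : t < T)
    {y : ℝ} (hy : 0 < y) (hy2 : y ≤ l) : pdy u x y t ≤ dd p * y ^ (al p - 1) + C * y := by
  have hl := G.hl
  have hp := G.hp
  have ax : |x| ≤ 2 * l := abs_le.2 ⟨by linarith [hx.1], by linarith [hx.2]⟩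
  have R : ∀ s ∈ Icc 0 l, C21At u x s t := fun s hs => G.reg' ax hs.1 (by linarith [hs.2]) ht htT
  have hz : ∀ s > 0, HasDerivAt (fun s => dd p * s ^ (al p - 1) + C * s)
      (C - (dd p * s ^ (al p - 1)) ^ p) s := by
    intro s hs
    refine (((Real.hasDerivAt_rpow_const (p := al p - 1) (Or.inl hs.ne')).const_mul (dd p)).add
      ((hasDerivAt_id s).const_mul C)).congr_deriv ?_
    rw [dd_powp hp hs, show al p - 1 - 1 = al p - 2 by ring]; ring
  -- starting point
  have c0 : ContinuousAt (fun s => pdy u x s t) 0 := (R 0 ⟨le_refl _, hl.le⟩).dyy.continuousAt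
  have e1 : ∀ᶠ s in nhdsWithin (0:ℝ) (Ioi 0), pdy u x s t < pdy u x 0 t + 1 :=
    (c0.mono_left nhdsWithin_le_nhds).eventually (gt_mem_nhds (by simp))
  have e2 : ∀ᶠ s in nhdsWithin (0:ℝ) (Ioi 0), (pdy u x 0 t + 1) / dd p < s ^ (al p - 1) := by
    have : Tendsto (fun s : ℝ => s ^ (al p - 1)) (nhdsWithin 0 (Ioi 0)) atTop := by
      apply tendsto_rpow_neg_nhdsGT_zero
      linarith [al_lt hp]
    exact this.eventually_gt_atTop _
  obtain ⟨η, ⟨h1, h2⟩, hη⟩ := ((e1.and e2).and (Ioo_mem_nhdsGT hy)).exists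
  rw [div_lt_iff₀ (dd_pos hp)] at h2
  have := image_le_of_deriv_right_lt_deriv_boundary' (f := fun s => pdy u x s t) (f' := fun s => pdyy u x s t)
    (a := η) (b := y) (fun s hs => (R s ⟨by linarith [hs.1, hη.1], by linarith [hs.2]⟩).dyy.continuousAt.continuousWithinAt)
    (fun s hs => (R s ⟨by linarith [hs.1, hη.1], by linarith [hs.2]⟩).dyy.hasDerivWithinAt)
    (B := fun s => dd p * s ^ (al p - 1) + C * s) (B' := fun s => C - (dd p * s ^ (al p - 1)) ^ p)
    (by have := mul_pos hC hη.1; linarith)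
    (fun s hs => (hz s (by linarith [hs.1, hη.1])).continuousAt.continuousWithinAt)
    (fun s hs => (hz s (by linarith [hs.1, hη.1])).hasDerivWithinAt)
    (by
      intro s hs he
      have hs0 : 0 < s := by linarith [hs.1, hη.1]
      have k1 := H x hx s ⟨hs0, by linarith [hs.2]⟩ t ht htT
      have k2 : dd p * s ^ (al p - 1) < gradNorm u x s t := by
        have := pdy_le_grad u x s t
        have h4 := le_abs_self (pdy u x s t)
        have := mul_pos hC hs0
        linarith
      have k3 := Real.rpow_lt_rpow (mul_pos (dd_pos hp) (Real.rpow_pos_of_pos hs0 (al p - 1))).le k2 (by linarith : 0 < p)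
      linarith)
  exact this ⟨hη.2.le, le_refl _⟩

theorem Good.u_le (G : Good p l T u) {C : ℝ} (hC : 0 < C) (H : ∀ x ∈ Icc (-l) l, ∀ y ∈ Ioc 0 l, ∀ t, T / 2 ≤ t → t < T →
    pdyy u x y t ≤ C - gradNorm u x y t ^ p) {x : ℝ} (hx : x ∈ Icc (-l) l) {t : ℝ} (ht : T / 2 ≤ t) (htT : t < T)
    {y : ℝ} (hy : 0 < y) (hy2 : y ≤ l) : u x y t ≤ dd p / al p * y ^ (al p) + C * y ^ 2 / 2 := by
  have hl := G.hl
  have hp := G.hp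
  have hα := al_pos hp
  have ax : |x| ≤ 2 * l := abs_le.2 ⟨by linarith [hx.1], by linarith [hx.2]⟩
  have R : ∀ s ∈ Icc 0 l, C21At u x s t := fun s hs => G.reg' ax hs.1 (by linarith [hs.2]) ht htT
  have := mvt_ge (f := fun s => dd p / al p * s ^ (al p) + C * s ^ 2 / 2 - u x s t)
    (f' := fun s => dd p * s ^ (al p - 1) + C * s - pdy u x s t) (a := 0) (b := y) (m := 0) hy.le
    (by
      intro s hs
      refine ContinuousAt.continuousWithinAt ?_
      have := (R s ⟨hs.1, by linarith [hs.2]⟩).dy.continuousAt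
      refine ContinuousAt.sub (ContinuousAt.add (continuousAt_const.mul ?_) (by fun_prop)) this
      exact Real.continuousAt_rpow_const _ _ (Or.inr hα.le))
    (by
      intro s hs
      refine ((((Real.hasDerivAt_rpow_const (p := al p) (Or.inl hs.1.ne')).const_mul (dd p / al p)).add
        ((((hasDerivAt_id s).pow 2).const_mul C).div_const 2)).sub
          (R s ⟨hs.1.le, by linarith [hs.2]⟩).dy).congr_deriv ?_
      simp
      field_simp)
    (by
      intro s hs
      have := G.w_le hC H hx ht htT hs.1 (by linarith [hs.2])
      linarith)
  simp only [G.bc x t ax ht htT, Real.zero_rpow hα.ne'] at this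
  linarith

theorem Good.u_mono (G : Good p l T u) {x y t : ℝ} (hx : x ∈ Icc (-l) l) (hy : 0 ≤ y) (hy2 : y ≤ l)
    (ht : T / 2 ≤ t) (htT : t < T) : u x y t ≤ u 0 y t := by
  have hl := G.hl
  rcases hy.eq_or_lt with rfl | hy0
  · rw [G.bc _ _ (abs_le.2 ⟨by linarith [hx.1], by linarith [hx.2]⟩) ht htT, G.bc 0 t (by simp; linarith) ht htT]
  have R : ∀ s ∈ Icc (-l) l, HasDerivAt (fun s => u s y t) (pdx u s y t) s := fun s hs =>
    (G.reg' (abs_le.2 ⟨by linarith [hs.1], by linarith [hs.2]⟩) hy (by linarith) ht htT).dx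
  have mm : ∀ s ∈ Icc (-l) l, s * pdx u s y t ≤ 0 := fun s hs =>
    G.mon s y t (abs_le.2 ⟨by linarith [hs.1], by linarith [hs.2]⟩) hy0 (by linarith) ht htT
  rcases le_total 0 x with h | h
  · have := mvt_le (f := fun s => u s y t) (f' := fun s => pdx u s y t) (m := 0) h
      (fun s hs => (R s ⟨by linarith [hs.1], by linarith [hs.2, hx.2]⟩).continuousAt.continuousWithinAt)
      (fun s hs => R s ⟨by linarith [hs.1], by linarith [hs.2, hx.2]⟩)
      (fun s hs => by
        have := mm s ⟨by linarith [hs.1], by linarith [hs.2, hx.2]⟩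
        nlinarith [hs.1])
    linarith
  · have := mvt_ge (f := fun s => u s y t) (f' := fun s => pdx u s y t) (m := 0) h
      (fun s hs => (R s ⟨by linarith [hs.1, hx.1], by linarith [hs.2]⟩).continuousAt.continuousWithinAt)
      (fun s hs => R s ⟨by linarith [hs.1, hx.1], by linarith [hs.2]⟩)
      (fun s hs => by
        have := mm s ⟨by linarith [hs.1, hx.1], by linarith [hs.2]⟩
        nlinarith [hs.2])
    linarith

theorem Good.w0_mono (G : Good p l T u) {x t : ℝ} (hx : x ∈ Icc (-l) l)
    (ht : T / 2 ≤ t) (htT : t < T) : pdy u x 0 t ≤ pdy u 0 0 t := by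
  have hl := G.hl
  have ax : |x| ≤ 2 * l := abs_le.2 ⟨by linarith [hx.1], by linarith [hx.2]⟩
  have a0 : |(0:ℝ)| ≤ 2 * l := by simp; linarith
  have := deriv_right_nonpos (x := 0) (t0 := l) hl (f := fun s => u x s t - u 0 s t) (by
    intro s hs
    have := G.u_mono hx hs.1.le hs.2.le ht htT
    simp only [G.bc _ _ ax ht htT, G.bc _ _ a0 ht htT]
    linarith) ((G.reg' ax le_rfl (by linarith) ht htT).dy.sub (G.reg' a0 le_rfl (by linarith) ht htT).dy)
  linarith

theorem Good.pdx_abs (G : Good p l T u) {C : ℝ} (hC : Cst l T u C) {x y t : ℝ} (hx : x ∈ Icc (-l) l) (hy : 0 ≤ y) (hy2 : y ≤ l)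
    (ht : T / 2 ≤ t) (htT : t < T) : |pdx u x y t| ≤ C * |x| := by
  have hl := G.hl
  have R : ∀ s ∈ Icc (-l) l, HasDerivAt (fun s => pdx u s y t) (pdxx u s y t) s := fun s hs =>
    (G.reg' (abs_le.2 ⟨by linarith [hs.1], by linarith [hs.2]⟩) hy (by linarith) ht htT).dxx
  have z := G.pdx_zero hy (by linarith) ht htT
  rcases hy.eq_or_lt with rfl | hy0
  · rw [G.pdx_bc (abs_le.2 hx) ht htT]; have := hC.pos; simp; positivity
  have mm := G.mon x y t (abs_le.2 ⟨by linarith [hx.1], by linarith [hx.2]⟩) hy0 (by linarith) ht htT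
  rcases le_total 0 x with h | h
  · have := mvt_ge (f := fun s => pdx u s y t) (f' := fun s => pdxx u s y t) (m := -C) h
      (fun s hs => (R s ⟨by linarith [hs.1], by linarith [hs.2, hx.2]⟩).continuousAt.continuousWithinAt)
      (fun s hs => R s ⟨by linarith [hs.1], by linarith [hs.2, hx.2]⟩)
      (fun s hs => hC.uxx s ⟨by linarith [hs.1], by linarith [hs.2, hx.2]⟩ y ⟨hy, hy2⟩ t ht htT)
    simp only [z] at this
    have h1 := G.pdx_le h hx.2 hy (by linarith) ht htT
    rw [abs_of_nonpos h1, abs_of_nonneg h]; linarith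
  · have := mvt_ge (f := fun s => pdx u s y t) (f' := fun s => pdxx u s y t) (m := -C) h
      (fun s hs => (R s ⟨by linarith [hs.1, hx.1], by linarith [hs.2]⟩).continuousAt.continuousWithinAt)
      (fun s hs => R s ⟨by linarith [hs.1, hx.1], by linarith [hs.2]⟩)
      (fun s hs => hC.uxx s ⟨by linarith [hs.1, hx.1], by linarith [hs.2]⟩ y ⟨hy, hy2⟩ t ht htT)
    simp only [z] at this
    rcases h.eq_or_lt with rfl | h'
    · simp [z]
    have h1 : 0 ≤ pdx u x y t := by nlinarith
    rw [abs_of_nonneg h1, abs_of_nonpos h]; linarith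

theorem Good.blow0 (G : Good p l T u) {C : ℝ} (hC : Cst l T u C) (H : ∀ x ∈ Icc (-l) l, ∀ y ∈ Ioc 0 l, ∀ t, T / 2 ≤ t → t < T →
    pdyy u x y t ≤ C - gradNorm u x y t ^ p) : ∀ M, ∀ δ > 0, ∃ t, T - δ < t ∧ T / 2 ≤ t ∧ t < T ∧ M < pdy u 0 0 t := by
  intro M δ hδ
  by_contra hcon
  push Not at hcon
  have hl := G.hl
  have hT := G.hT
  have hC0 := hC.pos
  obtain ⟨x, y, t, hy0, htT, hx, hy, ht, hM⟩ := G.blow (|M| + C * l + C + C * l) (min (min δ l) (T / 2))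
    (lt_min (lt_min hδ hl) (by linarith))
  have m1 : min (min δ l) (T / 2) ≤ δ := (min_le_left _ _).trans (min_le_left _ _)
  have m2 : min (min δ l) (T / 2) ≤ l := (min_le_left _ _).trans (min_le_right _ _)
  have m3 : min (min δ l) (T / 2) ≤ T / 2 := min_le_right _ _
  have hx' : x ∈ Icc (-l) l := abs_le.1 (by linarith)
  have hyl : y ≤ l := by rw [abs_of_nonneg hy0] at hy; linarith
  have ht2 : T / 2 ≤ t := by linarith
  have ax : |x| ≤ 2 * l := by linarith
  have k1 := G.pdx_abs hC hx' hy0 hyl ht2 htT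
  have k2 : C * |x| ≤ C * l := mul_le_mul_of_nonneg_left (by linarith) hC.pos.le
  have k3 := hcon t (by linarith) ht2 htT
  have k4 := G.w0_mono hx' ht2 htT
  have R : ∀ s ∈ Icc 0 l, HasDerivAt (fun s => pdy u x s t) (pdyy u x s t) s := fun s hs =>
    (G.reg' ax hs.1 (by linarith [hs.2]) ht2 htT).dyy
  have bd : ∀ s ∈ Ioo 0 l, pdyy u x s t ≤ C := fun s hs => by
    have := H x hx' s ⟨hs.1, hs.2.le⟩ t ht2 htT
    have h2 : 0 ≤ gradNorm u x s t ^ p := Real.rpow_nonneg (gradNorm_nonneg _ _ _ _) _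
    linarith
  have k5 := mvt_le (f := fun s => pdy u x s t) (f' := fun s => pdyy u x s t) (m := C) hy0
    (fun s hs => (R s ⟨hs.1, by linarith [hs.2]⟩).continuousAt.continuousWithinAt)
    (fun s hs => R s ⟨hs.1.le, by linarith [hs.2]⟩) (fun s hs => bd s ⟨hs.1, by linarith [hs.2]⟩)
  have k6 := mvt_le (f := fun s => pdy u x s t) (f' := fun s => pdyy u x s t) (m := C) hyl
    (fun s hs => (R s ⟨by linarith [hs.1], hs.2⟩).continuousAt.continuousWithinAt)
    (fun s hs => R s ⟨by linarith [hs.1], hs.2.le⟩) (fun s hs => bd s ⟨by linarith [hs.1], hs.2⟩)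
  have k7 := abs_le.1 (hC.bulk x hx' t ht2 htT)
  have k8 : C * y ≤ C * l := mul_le_mul_of_nonneg_left hyl hC.pos.le
  have k9 : 0 ≤ C * y := by positivity
  have k10 : |pdy u x y t| ≤ |M| + C * l + C := by
    have := le_abs_self M
    have := abs_nonneg M
    simp only [sub_zero] at k5 k6
    rw [abs_le]; constructor <;> nlinarith [k7.1]
  have k11 : gradNorm u x y t ≤ |pdx u x y t| + |pdy u x y t| := by
    unfold gradNorm
    apply Real.sqrt_le_iff.2
    refine ⟨by positivity, ?_⟩
    have h1 := abs_nonneg (pdx u x y t)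
    have h2 := abs_nonneg (pdy u x y t)
    rw [← sq_abs (pdx u x y t), ← sq_abs (pdy u x y t)]
    nlinarith [mul_nonneg h1 h2]
  linarith

end ODE

section Lower
variable {u : ℝ → ℝ → ℝ → ℝ} {p l T : ℝ}

theorem Good.u_final_ge (G : Good p l T u) {C : ℝ} (hC : Cst l T u C) (H : ∀ x ∈ Icc (-l) l, ∀ y ∈ Ioc 0 l, ∀ t, T / 2 ≤ t → t < T →
    pdyy u x y t ≤ C - gradNorm u x y t ^ p) : ∃ c0 > 0, ∃ ρ > 0, ∀ y, 0 < y → y < ρ → c0 * y ^ (al p) ≤ u 0 y T := by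
  have hl := G.hl
  have hT := G.hT
  have hp := G.hp
  have hC0 := hC.pos
  have hα := al_pos hp
  have hα1 := al_lt hp
  have hd := dd_pos hp
  have hd4 : 0 < dd p * (1 - al p) / 4 := by
    have : 0 < 1 - al p := by linarith
    positivity
  have e1 : ∀ᶠ s in nhdsWithin (0:ℝ) (Ioi 0), C / (dd p * (1 - al p) / 4) < s ^ (al p - 2) := by
    have : Tendsto (fun s : ℝ => s ^ (al p - 2)) (nhdsWithin 0 (Ioi 0)) atTop := by
      apply tendsto_rpow_neg_nhdsGT_zero
      linarith
    exact this.eventually_gt_atTop _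
  obtain ⟨ρ, hρ0, hρ⟩ := mem_nhdsGT_iff_exists_Ioo_subset.1 e1
  have hρ0 : 0 < ρ := hρ0
  refine ⟨dd p / 2 * 2 ^ (al p - 1), by positivity, min (ρ / 2) l, lt_min (by linarith) hl, ?_⟩
  intro y hy hyρ
  have hy1 : y < ρ / 2 := hyρ.trans_le (min_le_left _ _)
  have hy2 : y < l := hyρ.trans_le (min_le_right _ _)
  have a0 : |(0:ℝ)| ≤ 2 * l := by simp; linarith
  have m0 : (0:ℝ) ∈ Icc (-l) l := ⟨by linarith, by linarith⟩
  have key : ∀ t, T / 2 ≤ t → t < T → dd p / 2 * y ^ (al p - 1) < pdy u 0 0 t →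
      dd p / 2 * 2 ^ (al p - 1) * y ^ (al p) ≤ u 0 y t := by
    intro t ht htT hw
    have R : ∀ s ∈ Icc 0 l, C21At u 0 s t := fun s hs => G.reg' a0 hs.1 (by linarith [hs.2]) ht htT
    have hz : ∀ s, 0 ≤ s → HasDerivAt (fun s => dd p / 2 * (s + y) ^ (al p - 1))
        (dd p / 2 * ((al p - 1) * (s + y) ^ (al p - 2))) s := by
      intro s hs
      have h1 : HasDerivAt (fun s : ℝ => s + y) 1 s := (hasDerivAt_id s).add_const y
      refine ((h1.rpow_const (p := al p - 1) (Or.inl (by positivity))).const_mul (dd p / 2)).congr_deriv ?_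
      rw [show al p - 1 - 1 = al p - 2 by ring]; ring
    have B := image_le_of_deriv_right_lt_deriv_boundary' (f := fun s => dd p / 2 * (s + y) ^ (al p - 1))
      (f' := fun s => dd p / 2 * ((al p - 1) * (s + y) ^ (al p - 2))) (a := 0) (b := y)
      (fun s hs => (hz s hs.1).continuousAt.continuousWithinAt)
      (fun s hs => (hz s hs.1).hasDerivWithinAt)
      (B := fun s => pdy u 0 s t) (B' := fun s => pdyy u 0 s t)
      (by rw [zero_add]; exact hw.le)
      (fun s hs => (R s ⟨hs.1, by linarith [hs.2]⟩).dyy.continuousAt.continuousWithinAt)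
      (fun s hs => (R s ⟨hs.1, by linarith [hs.2]⟩).dyy.hasDerivWithinAt)
      (by
        intro s hs he
        rcases hs.1.eq_or_lt with rfl | hs0
        · rw [zero_add] at he; linarith
        have hsy : 0 < s + y := by linarith
        have q1 := hρ ⟨hsy, by linarith [hs.2]⟩
        have q1 : C / (dd p * (1 - al p) / 4) < (s + y) ^ (al p - 2) := q1
        rw [div_lt_iff₀ hd4] at q1
        have q2 := G.pde 0 s t a0 hs0 (by linarith [hs.2]) ht htT
        have q3 := G.pdxx_zero hs.1 (by linarith [hs.2]) ht htT
        have q4 := (abs_le.1 (hC.ut 0 m0 s ⟨hs.1, by linarith [hs.2]⟩ t ht htT)).1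
        have hr : 0 < (s + y) ^ (al p - 2) := Real.rpow_pos_of_pos hsy _
        have hr1 : 0 < (s + y) ^ (al p - 1) := Real.rpow_pos_of_pos hsy _
        have q5 : gradNorm u 0 s t = dd p / 2 * (s + y) ^ (al p - 1) := by
          unfold gradNorm
          rw [G.pdx_zero hs.1 (by linarith [hs.2]) ht htT, ← he]
          simp only [ne_eq, OfNat.ofNat_ne_zero, not_false_eq_true, zero_pow, zero_add]
          exact Real.sqrt_sq (by positivity)
        have q6 : gradNorm u 0 s t ^ p = (1 / 2) ^ p * (dd p * (1 - al p) * (s + y) ^ (al p - 2)) := by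
          rw [q5, ← dd_powp hp hsy, ← Real.mul_rpow (by norm_num) (by positivity)]
          congr 1; ring
        have q7 : ((1:ℝ) / 2) ^ p ≤ 1 / 4 := by
          have := Real.rpow_le_rpow_of_exponent_ge (x := (1:ℝ) / 2) (by norm_num) (by norm_num) hp.le
          refine this.trans ?_
          norm_num
        have q8 : 0 < dd p * (1 - al p) * (s + y) ^ (al p - 2) := by
          have : 0 < 1 - al p := by linarith
          positivity
        have q9 := mul_le_mul_of_nonneg_right q7 q8.le
        rw [q6] at q2
        nlinarith)
    have h2y : 0 < (2 * y) ^ (al p - 1) := Real.rpow_pos_of_pos (by linarith) _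
    have := mvt_ge (f := fun s => u 0 s t) (f' := fun s => pdy u 0 s t) (a := 0) (b := y)
      (m := dd p / 2 * (2 * y) ^ (al p - 1)) hy.le
      (fun s hs => (R s ⟨hs.1, by linarith [hs.2]⟩).dy.continuousAt.continuousWithinAt)
      (fun s hs => (R s ⟨hs.1.le, by linarith [hs.2]⟩).dy)
      (fun s hs => by
        refine le_trans ?_ (B ⟨hs.1.le, hs.2.le⟩)
        refine mul_le_mul_of_nonneg_left ?_ (by positivity)
        exact Real.rpow_le_rpow_of_nonpos (by linarith [hs.1]) (by linarith [hs.2]) (by linarith))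
    simp only [G.bc 0 t a0 ht htT, sub_zero] at this
    refine le_trans (le_of_eq ?_) this
    rw [Real.mul_rpow (by norm_num) hy.le]
    have : y ^ (al p) = y ^ (al p - 1) * y := by
      rw [← Real.rpow_add_one hy.ne']; congr 1; ring
    rw [this]; ring
  by_contra hcon
  push Not at hcon
  have cT : ContinuousAt (fun s => u 0 y s) T :=
    ContinuousAt.comp (f := fun s : ℝ => (((0:ℝ), y, s) : ℝ × ℝ × ℝ)) (x := T)
      (G.reg 0 y T a0 hy.le (by linarith) (by linarith) le_rfl (by rintro ⟨-, h, -⟩; linarith)).cu (by fun_prop)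
  obtain ⟨r, hr, Hr⟩ := Metric.eventually_nhds_iff.1 (cT.eventually (gt_mem_nhds hcon))
  obtain ⟨t, h1, h2, h3, h4⟩ := G.blow0 hC H (dd p / 2 * y ^ (al p - 1)) r hr
  have := Hr (y := t) (by rw [Real.dist_eq, abs_lt]; constructor <;> linarith)
  linarith [key t h2 h3 h4]

end Lower

section JJ
variable {u : ℝ → ℝ → ℝ → ℝ} {p l T : ℝ}

theorem Good.diffq (G : Good p l T u) {t1 : ℝ} (ht1 : t1 < T) {m : ℝ} (hm : 0 < m) :
    ∃ h > 0, h < l ∧ ∀ x y t, 0 ≤ x → x ≤ l → 0 ≤ y → y ≤ l → T / 2 ≤ t → t ≤ t1 →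
      |(u x y t - u (x - h) y t) / h - pdx u x y t| ≤ m := by
  have hl := G.hl
  have R0 : ∀ x ∈ Icc (-l) l, ∀ y ∈ Icc 0 l, ∀ t ∈ Icc (T / 2) t1, C21At u x y t :=
    fun x hx y hy t ht => G.reg' (abs_le.2 ⟨by linarith [hx.1], by linarith [hx.2]⟩) hy.1 (by linarith [hy.2])
      ht.1 (by linarith [ht.2])
  have hK : IsCompact (Icc (-l) l ×ˢ Icc 0 l ×ˢ Icc (T / 2) t1) :=
    isCompact_Icc.prod (isCompact_Icc.prod isCompact_Icc)
  have uc := hK.uniformContinuousOn_of_continuous (f := fun q : ℝ × ℝ × ℝ => pdx u q.1 q.2.1 q.2.2)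
    (by rintro ⟨x, y, t⟩ ⟨hx, hy, ht⟩; exact (R0 x hx y hy t ht).cx.continuousWithinAt)
  obtain ⟨δ, hδ, hu⟩ := Metric.uniformContinuousOn_iff.1 uc m hm
  have m1 : min (δ / 2) (l / 2) ≤ δ / 2 := min_le_left _ _
  have m2 : min (δ / 2) (l / 2) ≤ l / 2 := min_le_right _ _
  refine ⟨min (δ / 2) (l / 2), lt_min (by linarith) (by linarith), by linarith, ?_⟩
  have m3 : 0 < min (δ / 2) (l / 2) := lt_min (by linarith) (by linarith)
  generalize min (δ / 2) (l / 2) = h at *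
  intro x y t hx0 hx hy0 hy ht ht1
  have D : ∀ s ∈ Icc (-l) l, HasDerivAt (fun s => u s y t) (pdx u s y t) s := fun s hs =>
    (R0 s hs y ⟨hy0, hy⟩ t ⟨ht, ht1⟩).dx
  obtain ⟨ξ, hξ, he⟩ := exists_hasDerivAt_eq_slope (fun s => u s y t) (fun s => pdx u s y t)
    (show x - h < x by linarith)
    (fun s hs => (D s ⟨by linarith [hs.1], by linarith [hs.2]⟩).continuousAt.continuousWithinAt)
    (fun s hs => D s ⟨by linarith [hs.1], by linarith [hs.2]⟩)
  rw [sub_sub_cancel] at he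
  rw [← he]
  have := hu (ξ, y, t) ⟨⟨by linarith [hξ.1], by linarith [hξ.2]⟩, ⟨hy0, hy⟩, ⟨ht, ht1⟩⟩ (x, y, t)
    ⟨⟨by linarith, hx⟩, ⟨hy0, hy⟩, ⟨ht, ht1⟩⟩ (by
      rw [Prod.dist_eq]
      simp only [dist_self, max_lt_iff]
      rw [Real.dist_eq]
      exact ⟨abs_lt.2 ⟨by linarith [hξ.1], by linarith [hξ.2]⟩, by simpa using hδ⟩)
  rw [Real.dist_eq] at this
  exact this.le

theorem Good.Jlem (G : Good p l T u) (g : ℝ → ℝ → ℝ → ℝ) {x0 x1 y0 y1 t0 t1 : ℝ}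
    (hx0 : 0 ≤ x0) (hx1 : x1 ≤ l) (hy0 : 0 ≤ y0) (hy1 : y1 ≤ l) (ht0 : T / 2 ≤ t0) (ht1 : t1 < T)
    (hg : ContinuousOn (fun q : ℝ × ℝ × ℝ => g q.1 q.2.1 q.2.2)
      (Icc x0 x1 ×ˢ Icc y0 y1 ×ˢ Icc t0 t1))
    (hb : ∀ x ∈ Icc x0 x1, ∀ y ∈ Icc y0 y1, ∀ t ∈ Icc t0 t1,
      (x = x0 ∨ x = x1 ∨ y = y0 ∨ y = y1 ∨ t = t0) → pdx u x y t + g x y t ≤ 0)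
    (hint : ∀ x ∈ Ioo x0 x1, ∀ y ∈ Ioo y0 y1, ∀ t ∈ Ioc t0 t1, 0 < pdx u x y t + g x y t →
      ∃ (gx gy : ℝ → ℝ) (gxx gyy gt : ℝ),
        (∀ᶠ s in nhds x, HasDerivAt (fun s => g s y t) (gx s) s) ∧ HasDerivAt gx gxx x ∧
        (∀ᶠ s in nhds y, HasDerivAt (fun s => g x s t) (gy s) s) ∧ HasDerivAt gy gyy y ∧
        HasDerivAt (fun s => g x y s) gt t ∧
        gt - gxx - gyy - p * gradNorm u x y t ^ (p - 2) * (pdx u x y t * gx x + pdy u x y t * gy y) ≤ 0) :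
    ∀ x ∈ Icc x0 x1, ∀ y ∈ Icc y0 y1, ∀ t ∈ Icc t0 t1, pdx u x y t + g x y t ≤ 0 := by
  intro xs hxs ys hys ts hts
  by_contra hm
  push Not at hm
  set m := pdx u xs ys ts + g xs ys ts with hmdef
  have hl := G.hl
  obtain ⟨h, hh, hhl, hD⟩ := G.diffq ht1 (show 0 < m / 8 by linarith)
  have htt : t0 ≤ t1 := hts.1.trans hts.2
  set ε := m / (4 * (t1 - t0 + 1)) with hε
  have hε0 : 0 < ε := div_pos hm (by linarith)
  have hε1 : ε * (t1 - t0) ≤ m / 4 := by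
    have h2 : ε * (t1 - t0 + 1) = m / 4 := by
      have : t1 - t0 + 1 ≠ 0 := by linarith
      rw [hε]; field_simp
    linarith
  have ax : ∀ x ∈ Icc x0 x1, |x| ≤ 2 * l := fun x hx => abs_le.2 ⟨by linarith [hx.1], by linarith [hx.2]⟩
  have axm : ∀ x ∈ Icc x0 x1, |x - h| ≤ 2 * l := fun x hx => abs_le.2 ⟨by linarith [hx.1], by linarith [hx.2]⟩
  have R0 : ∀ x, |x| ≤ 2 * l → ∀ y ∈ Icc y0 y1, ∀ t ∈ Icc t0 t1, C21At u x y t :=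
      fun x hx y hy t ht => G.reg' hx (by linarith [hy.1]) (by linarith [hy.2]) (by linarith [ht.1]) (by linarith [ht.2])
  have hD' : ∀ x ∈ Icc x0 x1, ∀ y ∈ Icc y0 y1, ∀ t ∈ Icc t0 t1, _ := fun x hx y hy t ht =>
    abs_le.1 (hD x y t (by linarith [hx.1]) (by linarith [hx.2]) (by linarith [hy.1]) (by linarith [hy.2])
      (by linarith [ht.1]) (by linarith [ht.2]))
  have key := box_max (fun x y t => (u x y t - u (x - h) y t) / h + g x y t - ε * (t - t0) - m / 4)
    (x0 := x0) (x1 := x1) (y0 := y0) (y1 := y1) (t0 := t0) (t1 := t1) ?_ ?_ ?_ xs hxs ys hys ts hts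
  · have k1 := hD' xs hxs ys hys ts hts
    have k2 : ε * (ts - t0) ≤ ε * (t1 - t0) := mul_le_mul_of_nonneg_left (by linarith [hts.2]) hε0.le
    linarith [k1.1]
  · refine ContinuousOn.sub (ContinuousOn.sub (ContinuousOn.add ?_ hg) (by fun_prop)) continuousOn_const
    rintro ⟨x, y, t⟩ ⟨hx, hy, ht⟩
    refine ContinuousAt.continuousWithinAt ?_
    have c1 := (R0 x (ax x hx) y hy t ht).cu
    have c3 := cont_comp (g := fun q : ℝ × ℝ × ℝ => (q.1 - h, q.2.1, q.2.2)) (q := (x, y, t))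
        (by fun_prop) (R0 (x - h) (axm x hx) y hy t ht).cu
    exact (c1.sub c3).div_const h
  · intro x hx y hy t ht hbd
    have k1 := hD' x hx y hy t ht
    have k2 := hb x hx y hy t ht hbd
    have k3 : 0 ≤ ε * (t - t0) := mul_nonneg hε0.le (by linarith [ht.1])
    linarith [k1.2]
  · intro x hx y hy t ht hpos mx my mt
    have hx' : x ∈ Icc x0 x1 := ⟨hx.1.le, hx.2.le⟩
    have hy' : y ∈ Icc y0 y1 := ⟨hy.1.le, hy.2.le⟩
    have ht' : t ∈ Icc t0 t1 := ⟨ht.1.le, ht.2⟩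
    have k1 := hD' x hx' y hy' t ht'
    have k3 : 0 ≤ ε * (t - t0) := mul_nonneg hε0.le (by linarith [ht.1])
    obtain ⟨gx, gy, gxx, gyy, gt, e1, e2, e3, e4, e5, e6⟩ := hint x hx y hy t ht (by linarith [k1.2])
    have dX : ∀ᶠ s in nhds x, HasDerivAt
        (fun s => (u s y t - u (s - h) y t) / h + g s y t - ε * (t - t0) - m / 4)
        ((pdx u s y t - pdx u (s - h) y t) / h + gx s) s := by
      filter_upwards [e1, Icc_mem_nhds hx.1 hx.2] with s hs1 hs
      exact ((((R0 s (ax s hs) y hy' t ht').dx.sub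
          ((R0 _ (axm s hs) y hy' t ht').dx.comp_sub_const s h)).div_const h).add hs1).sub_const _ |>.sub_const _
    have dY : ∀ᶠ s in nhds y, HasDerivAt
        (fun s => (u x s t - u (x - h) s t) / h + g x s t - ε * (t - t0) - m / 4)
        ((pdy u x s t - pdy u (x - h) s t) / h + gy s) s := by
      filter_upwards [e3, Icc_mem_nhds hy.1 hy.2] with s hs1 hs
      exact ((((R0 x (ax x hx') s hs t ht').dy.sub
          ((R0 _ (axm x hx') s hs t ht').dy)).div_const h).add hs1).sub_const _ |>.sub_const _
    have dXX : HasDerivAt (fun s => (pdx u s y t - pdx u (s - h) y t) / h + gx s)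
        ((pdxx u x y t - pdxx u (x - h) y t) / h + gxx) x :=
      (((R0 x (ax x hx') y hy' t ht').dxx.sub
          ((R0 _ (axm x hx') y hy' t ht').dxx.comp_sub_const x h)).div_const h).add e2
    have dYY : HasDerivAt (fun s => (pdy u x s t - pdy u (x - h) s t) / h + gy s)
        ((pdyy u x y t - pdyy u (x - h) y t) / h + gyy) y :=
      (((R0 x (ax x hx') y hy' t ht').dyy.sub
          ((R0 _ (axm x hx') y hy' t ht').dyy)).div_const h).add e4
    have dT : HasDerivAt
        (fun s => (u x y s - u (x - h) y s) / h + g x y s - ε * (s - t0) - m / 4)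
        ((pdt u x y t - pdt u (x - h) y t) / h + gt - ε) t := by
      have e2 := (((hasDerivAt_id t).sub_const t0).const_mul ε)
      refine (((((R0 x (ax x hx') y hy' t ht').dt.sub
          ((R0 _ (axm x hx') y hy' t ht').dt)).div_const h).add e5).sub e2 |>.sub_const _).congr_deriv ?_
      simp
    have s1 := mx.hasDerivAt_eq_zero dX.self_of_nhds
    have s2 := my.hasDerivAt_eq_zero dY.self_of_nhds
    have s3 := snd_deriv_nonpos mx dX dXX
    have s4 := snd_deriv_nonpos my dY dYY
    have s5 := deriv_left_nonneg ht.1 mt dT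
    have pp : ∀ z, |z| ≤ 2 * l → _ := fun z hz =>
        G.pde z y t hz (by linarith [hy.1]) (by linarith [hy.2]) (by linarith [ht.1]) (by linarith [ht.2])
    have P1 := pp x (ax x hx')
    have P3 := pp _ (axm x hx')
    have I2 := pow_grad_ineq G.hp (pdx u x y t) (pdy u x y t) (pdx u (x - h) y t) (pdy u (x - h) y t)
    change _ ≤ p * gradNorm u x y t ^ (p - 2) * _ at I2
    change _ = √(pdx u (x - h) y t ^ 2 + pdy u (x - h) y t ^ 2) ^ p at P3
    change _ = √(pdx u x y t ^ 2 + pdy u x y t ^ 2) ^ p at P1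
    have w1 : pdx u x y t - pdx u (x - h) y t = -h * gx x := by
      have : (pdx u x y t - pdx u (x - h) y t) / h = - gx x := by linarith
      rw [div_eq_iff hh.ne'] at this; linarith
    have w2 : pdy u x y t - pdy u (x - h) y t = -h * gy y := by
      have : (pdy u x y t - pdy u (x - h) y t) / h = - gy y := by linarith
      rw [div_eq_iff hh.ne'] at this; linarith
    rw [w1, w2] at I2
    have v3 : pdxx u x y t - pdxx u (x - h) y t ≤ - gxx * h := by
      have : (pdxx u x y t - pdxx u (x - h) y t) / h ≤ - gxx := by linarith
      rwa [div_le_iff₀ hh] at this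
    have v4 : pdyy u x y t - pdyy u (x - h) y t ≤ - gyy * h := by
      have : (pdyy u x y t - pdyy u (x - h) y t) / h ≤ - gyy := by linarith
      rwa [div_le_iff₀ hh] at this
    have v5 : (ε - gt) * h ≤ pdt u x y t - pdt u (x - h) y t := by
      have : ε - gt ≤ (pdt u x y t - pdt u (x - h) y t) / h := by linarith
      rwa [le_div_iff₀ hh] at this
    have e7 := mul_le_mul_of_nonneg_left e6 hh.le
    have : 0 < h * ε := by positivity
    have e8 : p * gradNorm u x y t ^ (p - 2) * (pdx u x y t * (-h * gx x) + pdy u x y t * (-h * gy y)) =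
      -(h * (p * gradNorm u x y t ^ (p - 2) * (pdx u x y t * gx x + pdy u x y t * gy y))) := by ring
    rw [e8] at I2
    linarith

end JJ

section Pos

def Xf (N a1 th x : ℝ) : ℝ := max (Real.exp (N * x) - Real.exp (N * th)) 0 * (a1 - x) ^ 2

theorem Xf_nonneg (N a1 th x : ℝ) : 0 ≤ Xf N a1 th x := mul_nonneg (le_max_right _ _) (sq_nonneg _)

theorem Xf_le {N a1 th x : ℝ} (hN : 0 < N) (hx : x ≤ a1) :
    Xf N a1 th x ≤ N * Real.exp (N * a1) * (max (x - th) 0 * (a1 - x) ^ 2) := by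
  unfold Xf
  rw [← mul_assoc]
  refine mul_le_mul_of_nonneg_right ?_ (sq_nonneg _)
  have h0 : 0 ≤ N * Real.exp (N * a1) * max (x - th) 0 :=
    mul_nonneg (by positivity) (le_max_right _ _)
  refine max_le ?_ h0
  rcases le_total x th with h | h
  · have : Real.exp (N * x) ≤ Real.exp (N * th) := Real.exp_le_exp.2 (by nlinarith)
    linarith
  · rw [max_eq_left (by linarith)]
    have h1 : Real.exp (N * x) - Real.exp (N * th) ≤ Real.exp (N * x) * (N * (x - th)) := by
      have := Real.add_one_le_exp (-(N * (x - th)))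
      have h2 : Real.exp (N * th) = Real.exp (N * x) * Real.exp (-(N * (x - th))) := by
        rw [← Real.exp_add]; congr 1; ring
      rw [h2]
      nlinarith [Real.exp_pos (N * x)]
    have h3 : Real.exp (N * x) ≤ Real.exp (N * a1) := Real.exp_le_exp.2 (by nlinarith)
    have h4 : 0 ≤ N * (x - th) := mul_nonneg hN.le (by linarith)
    nlinarith

theorem le_Xf {N a1 th x : ℝ} (hN : 0 < N) (hth : 0 ≤ th) :
    N * (max (x - th) 0 * (a1 - x) ^ 2) ≤ Xf N a1 th x := by
  unfold Xf
  rw [← mul_assoc]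
  refine mul_le_mul_of_nonneg_right ?_ (sq_nonneg _)
  rcases le_total x th with h | h
  · rw [max_eq_right (by linarith), mul_zero]; exact le_max_right _ _
  · rw [max_eq_left (by linarith)]
    refine le_trans ?_ (le_max_left _ _)
    have := Real.add_one_le_exp (N * (x - th))
    have h2 : Real.exp (N * x) = Real.exp (N * th) * Real.exp (N * (x - th)) := by
      rw [← Real.exp_add]; congr 1; ring
    have h3 : 1 ≤ Real.exp (N * th) := Real.one_le_exp (by positivity)
    have h4 : 0 ≤ N * (x - th) := mul_nonneg hN.le (by linarith)
    rw [h2]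
    nlinarith

theorem Xf_cont (N a1 : ℝ) : Continuous (fun q : ℝ × ℝ => Xf N a1 q.1 q.2) := by
  unfold Xf; fun_prop

theorem Xf_dx {N a1 th x : ℝ} (hN : 0 < N) (h : th < x) :
    ∀ᶠ s in nhds x, HasDerivAt (fun s => Xf N a1 th s)
      (N * Real.exp (N * s) * (a1 - s) ^ 2 - 2 * (Real.exp (N * s) - Real.exp (N * th)) * (a1 - s)) s := by
  filter_upwards [Ioi_mem_nhds h] with s hs
  have e : (fun s => Xf N a1 th s) =ᶠ[nhds s]
      fun s => (Real.exp (N * s) - Real.exp (N * th)) * (a1 - s) ^ 2 := by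
    filter_upwards [Ioi_mem_nhds hs] with r hr
    have hr : th < r := hr
    unfold Xf
    rw [max_eq_left]
    have : Real.exp (N * th) ≤ Real.exp (N * r) := Real.exp_le_exp.2 (by nlinarith)
    linarith
  refine HasDerivAt.congr_of_eventuallyEq ?_ e
  have h1 : HasDerivAt (fun s : ℝ => N * s) N s := by simpa using (hasDerivAt_id s).const_mul N
  have h2 : HasDerivAt (fun s : ℝ => a1 - s) (-1) s := by simpa using (hasDerivAt_id s).const_sub a1
  refine ((h1.exp.sub_const _).mul (h2.pow 2)).congr_deriv ?_
  simp; ring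

theorem Xf_dxx {N a1 th x : ℝ} :
    HasDerivAt (fun s => N * Real.exp (N * s) * (a1 - s) ^ 2 - 2 * (Real.exp (N * s) - Real.exp (N * th)) * (a1 - s))
      (N ^ 2 * Real.exp (N * x) * (a1 - x) ^ 2 - 4 * N * Real.exp (N * x) * (a1 - x)
        + 2 * (Real.exp (N * x) - Real.exp (N * th))) x := by
  have h1 : HasDerivAt (fun s : ℝ => N * s) N x := by simpa using (hasDerivAt_id x).const_mul N
  have h2 : HasDerivAt (fun s : ℝ => a1 - s) (-1) x := by simpa using (hasDerivAt_id x).const_sub a1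
  refine (((h1.exp.const_mul N).mul (h2.pow 2)).sub (((h1.exp.sub_const _).const_mul 2).mul h2)).congr_deriv ?_
  simp; ring

theorem Xf_dt {N a1 θ κ s0 x t : ℝ} (hN : 0 < N) (h : θ - κ * (t - s0) < x) :
    HasDerivAt (fun τ => Xf N a1 (θ - κ * (τ - s0)) x)
      (κ * N * Real.exp (N * (θ - κ * (t - s0))) * (a1 - x) ^ 2) t := by
  have e : (fun τ => Xf N a1 (θ - κ * (τ - s0)) x) =ᶠ[nhds t]
      fun τ => (Real.exp (N * x) - Real.exp (N * (θ - κ * (τ - s0)))) * (a1 - x) ^ 2 := by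
    have hc : ContinuousAt (fun τ => θ - κ * (τ - s0)) t := by fun_prop
    filter_upwards [hc.eventually (gt_mem_nhds h)] with r hr
    unfold Xf
    rw [max_eq_left]
    have : Real.exp (N * (θ - κ * (r - s0))) ≤ Real.exp (N * x) := Real.exp_le_exp.2 (by nlinarith)
    linarith
  refine HasDerivAt.congr_of_eventuallyEq ?_ e
  have h1 : HasDerivAt (fun τ : ℝ => N * (θ - κ * (τ - s0))) (N * (-κ)) t := by
    have := (((hasDerivAt_id t).sub_const s0).const_mul κ).const_sub θ |>.const_mul N
    simpa using this
  refine ((h1.exp.const_sub _).mul_const _).congr_deriv ?_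
  ring

theorem bar1 {e f s N κ M b lam : ℝ} (he : 0 < e) (hfe : f < e) (hs : 0 < s)
    (hκ : 0 ≤ κ) (hN : κ + M ≤ N) (hN0 : 0 < N) (hb : |b| ≤ M) (hlam : (4 * N + M) ^ 2 ≤ lam)
    (hc : e / 2 ≤ e - f ∨ 4 ≤ (N - κ - M) * s) :
    κ * N * f * s ^ 2 - (N ^ 2 * e * s ^ 2 - 4 * N * e * s + 2 * (e - f))
      - b * (N * e * s ^ 2 - 2 * (e - f) * s) ≤ lam / 2 * ((e - f) * s ^ 2) := by
  set E := e - f with hE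
  have hE0 : 0 < E := by linarith
  have h1 : κ * N * f * s ^ 2 ≤ κ * N * e * s ^ 2 := by
    have : 0 ≤ κ * N * s ^ 2 := by positivity
    nlinarith
  have h2 : -b * (N * e * s ^ 2 - 2 * E * s) ≤ M * (N * e * s ^ 2) + M * (2 * E * s) := by
    have b1 := (abs_le.1 hb).1
    have b2 := (abs_le.1 hb).2
    have p1 : 0 ≤ N * e * s ^ 2 := by positivity
    have p2 : 0 ≤ 2 * E * s := by positivity
    nlinarith
  have h3 : (8 * N + 2 * M) * s - 2 ≤ lam / 2 * s ^ 2 := by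
    have : 0 ≤ s ^ 2 := by positivity
    nlinarith [sq_nonneg ((4 * N + M) * s - 2)]
  have h4 : E * ((8 * N + 2 * M) * s - 2) ≤ E * (lam / 2 * s ^ 2) := mul_le_mul_of_nonneg_left h3 hE0.le
  have h5 : 4 * N * e * s - N * (N - κ - M) * e * s ^ 2 ≤ 8 * N * E * s := by
    have q : 0 ≤ N * e * s := by positivity
    rcases hc with hc | hc
    · have : 0 ≤ N * (N - κ - M) * e * s ^ 2 := by
        have : 0 ≤ N - κ - M := by linarith
        positivity
      have : 0 ≤ N * s := by positivity
      nlinarith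
    · have : 0 ≤ 8 * N * E * s := by positivity
      nlinarith
  nlinarith

theorem bar1c {N x θ a1 D κ M : ℝ} (hN : 0 < N) (hx : x < a1)  (hD : 0 < D) (hθ : θ + D ≤ a1)
    (hN1 : κ + M + 8 / D ≤ N) (hκ : 0 ≤ κ) (hM : 0 ≤ M) :
    Real.exp (N * x) / 2 ≤ Real.exp (N * x) - Real.exp (N * θ) ∨ 4 ≤ (N - κ - M) * (a1 - x) := by
  by_cases h : D / 2 ≤ a1 - x
  · right
    have : 8 / D * (D / 2) = 4 := by field_simp; norm_num
    have h8 : 0 < 8 / D := by positivity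
    have : 8 / D * (D / 2) ≤ (N - κ - M) * (a1 - x) :=
      mul_le_mul (by linarith) h (by linarith) (by linarith)
    linarith
  · left
    push Not at h
    have h8 : 8 / D * D = 8 := by field_simp
    have h9 : 1 ≤ N * (x - θ) := by
      have h10 : D / 2 ≤ x - θ := by linarith
      have : 8 / D * (D / 2) ≤ N * (x - θ) := mul_le_mul (by linarith) h10 (by linarith) hN.le
      linarith
    have h2 : Real.exp (N * x) = Real.exp (N * θ) * Real.exp (N * (x - θ)) := by
      rw [← Real.exp_add]; congr 1; ring
    have h3 := Real.add_one_le_exp (N * (x - θ))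
    have := Real.exp_pos (N * θ)
    rw [h2]
    nlinarith

variable {u : ℝ → ℝ → ℝ → ℝ} {p l T : ℝ}

set_option maxHeartbeats 1600000 in
theorem Good.posl (G : Good p l T u) {a0 a1 b0 b1 s0 s1 κ1 κ2 θ1 θ2 ε0 M : ℝ}
    (ha0 : 0 ≤ a0) (ha1 : a1 ≤ l) (hb0 : 0 ≤ b0) (hb1 : b1 ≤ l) (hs0 : T / 2 ≤ s0)
    (hκ1 : 0 ≤ κ1) (hκ2 : 0 ≤ κ2) (hθ1 : θ1 < a1) (hθ2 : θ2 < b1)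
    (hθ1' : ∀ t ∈ (Icc s0 s1 ∩ Iio T), a0 ≤ θ1 - κ1 * (t - s0)) (hθ2' : ∀ t ∈ (Icc s0 s1 ∩ Iio T), b0 ≤ θ2 - κ2 * (t - s0))
    (hM0 : 0 ≤ M) (hM : ∀ x ∈ Icc a0 a1, ∀ y ∈ Icc b0 b1, ∀ t ∈ (Icc s0 s1 ∩ Iio T),
      |p * gradNorm u x y t ^ (p - 2) * pdx u x y t| ≤ M ∧ |p * gradNorm u x y t ^ (p - 2) * pdy u x y t| ≤ M)
    (hε0 : 0 < ε0) (hinit : ∀ x ∈ Icc a0 a1, ∀ y ∈ Icc b0 b1,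
      ε0 * ((max (x - θ1) 0 * (a1 - x) ^ 2) * (max (y - θ2) 0 * (b1 - y) ^ 2)) ≤ - pdx u x y s0) :
    ∃ c > 0, ∀ x ∈ Icc a0 a1, ∀ y ∈ Icc b0 b1, ∀ t ∈ (Icc s0 s1 ∩ Iio T),
      c * ((max (x - (θ1 - κ1 * (t - s0))) 0 * (a1 - x) ^ 2) *
        (max (y - (θ2 - κ2 * (t - s0))) 0 * (b1 - y) ^ 2)) ≤ - pdx u x y t := by
  have hD1 : 0 < a1 - θ1 := by linarith
  have hD2 : 0 < b1 - θ2 := by linarith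
  have hD1' : 0 < 8 / (a1 - θ1) := by positivity
  have hD2' : 0 < 8 / (b1 - θ2) := by positivity
  obtain ⟨N, hN⟩ : ∃ N, N = κ1 + κ2 + M + 8 / (a1 - θ1) + 8 / (b1 - θ2) := ⟨_, rfl⟩
  have hN0 : 0 < N := by rw [hN]; positivity
  obtain ⟨lam, hlam⟩ : ∃ lam, lam = (4 * N + M) ^ 2 := ⟨_, rfl⟩
  have hlam0 : 0 ≤ lam := by rw [hlam]; positivity
  obtain ⟨ε, hε⟩ : ∃ ε, ε = ε0 / ((N * Real.exp (N * a1)) * (N * Real.exp (N * b1))) := ⟨_, rfl⟩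
  have hεp : 0 < ε := by rw [hε]; positivity
  refine ⟨ε * Real.exp (-lam * (s1 - s0)) * N ^ 2, by positivity, ?_⟩
  intro xs hxs ys hys ts hts
  have hnp : ∀ x ∈ Icc a0 a1, ∀ y ∈ Icc b0 b1, ∀ t ∈ (Icc s0 s1 ∩ Iio T), pdx u x y t ≤ 0 := fun x hx y hy t ht =>
    G.pdx_le (by linarith [hx.1]) (by linarith [hx.2]) (by linarith [hy.1]) (by linarith [hy.2, G.hl])
      (by linarith [ht.1.1]) ht.2
  have J := G.Jlem (fun x y t => ε * Real.exp (-lam * (t - s0)) *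
      (Xf N a1 (θ1 - κ1 * (t - s0)) x * Xf N b1 (θ2 - κ2 * (t - s0)) y))
    (x0 := a0) (x1 := a1) (y0 := b0) (y1 := b1) (t0 := s0) (t1 := ts) ha0 ha1 hb0 hb1 hs0
    hts.2 ?_ ?_ ?_ xs hxs ys hys ts ⟨hts.1.1, le_rfl⟩
  · have l1 := le_Xf (N := N) (a1 := a1) (x := xs) hN0 (ha0.trans (hθ1' ts hts))
    have l2 := le_Xf (N := N) (a1 := b1) (x := ys) hN0 (hb0.trans (hθ2' ts hts))
    have l3 : Real.exp (-lam * (s1 - s0)) ≤ Real.exp (-lam * (ts - s0)) :=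
      Real.exp_le_exp.2 (by nlinarith [hts.1.2])
    have n1 : 0 ≤ max (xs - (θ1 - κ1 * (ts - s0))) 0 * (a1 - xs) ^ 2 :=
      mul_nonneg (le_max_right _ _) (sq_nonneg _)
    have n2 : 0 ≤ max (ys - (θ2 - κ2 * (ts - s0))) 0 * (b1 - ys) ^ 2 :=
      mul_nonneg (le_max_right _ _) (sq_nonneg _)
    have l4 := mul_le_mul l1 l2 (by positivity) (Xf_nonneg _ _ _ _)
    have l5 := mul_le_mul (mul_le_mul_of_nonneg_left l3 hεp.le) l4 (by positivity) (by positivity)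
    calc _ = _ := by ring
      _ ≤ _ := l5
      _ ≤ _ := by linarith
  · have c1 : Continuous (fun q : ℝ × ℝ × ℝ => Xf N a1 (θ1 - κ1 * (q.2.2 - s0)) q.1) :=
      (Xf_cont N a1).comp (by fun_prop : Continuous (fun q : ℝ × ℝ × ℝ => (θ1 - κ1 * (q.2.2 - s0), q.1)))
    have c2 : Continuous (fun q : ℝ × ℝ × ℝ => Xf N b1 (θ2 - κ2 * (q.2.2 - s0)) q.2.1) :=
      (Xf_cont N b1).comp (by fun_prop : Continuous (fun q : ℝ × ℝ × ℝ => (θ2 - κ2 * (q.2.2 - s0), q.2.1)))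
    have c3 : Continuous (fun q : ℝ × ℝ × ℝ => ε * Real.exp (-lam * (q.2.2 - s0))) := by fun_prop
    exact (c3.mul (c1.mul c2)).continuousOn
  · intro x hx y hy t ht hbd
    have htI : t ∈ (Icc s0 s1 ∩ Iio T) := ⟨⟨ht.1, ht.2.trans hts.1.2⟩, ht.2.trans_lt hts.2⟩
    have np := hnp x hx y hy t htI
    have z : ∀ θ a x, x ≤ θ → Xf N a θ x = 0 := by
      intro θ a x h
      unfold Xf
      rw [max_eq_right, zero_mul]
      have : Real.exp (N * x) ≤ Real.exp (N * θ) := Real.exp_le_exp.2 (by nlinarith)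
      linarith
    have z2 : ∀ θ a, Xf N a θ a = 0 := by intro θ a; unfold Xf; simp
    rcases hbd with rfl | rfl | rfl | rfl | rfl
    · rw [z _ _ _ (hθ1' t htI)]; simpa using np
    · rw [z2]; simpa using np
    · rw [z _ _ _ (hθ2' t htI)]; simpa using np
    · rw [z2]; simpa using np
    · have i1 := hinit x hx y hy
      simp only [sub_self, mul_zero, sub_zero, Real.exp_zero, mul_one]
      have u1 := Xf_le (N := N) (th := θ1) hN0 hx.2
      have u2 := Xf_le (N := N) (th := θ2) hN0 hy.2
      have n1 : 0 ≤ max (x - θ1) 0 * (a1 - x) ^ 2 := mul_nonneg (le_max_right _ _) (sq_nonneg _)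
      have u3 := mul_le_mul u1 u2 (Xf_nonneg _ _ _ _) (by positivity)
      have u4 := mul_le_mul_of_nonneg_left u3 hεp.le
      have u5 : ε * (N * Real.exp (N * a1) * (max (x - θ1) 0 * (a1 - x) ^ 2) *
          (N * Real.exp (N * b1) * (max (y - θ2) 0 * (b1 - y) ^ 2))) =
          ε0 * ((max (x - θ1) 0 * (a1 - x) ^ 2) * (max (y - θ2) 0 * (b1 - y) ^ 2)) := by
        rw [hε]
        have := Real.exp_pos (N * a1)
        have := Real.exp_pos (N * b1)
        field_simp
      linarith
  · intro x hx y hy t ht hpos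
    have htI : t ∈ (Icc s0 s1 ∩ Iio T) := ⟨⟨ht.1.le, ht.2.trans hts.1.2⟩, ht.2.trans_lt hts.2⟩
    have hx' : x ∈ Icc a0 a1 := ⟨hx.1.le, hx.2.le⟩
    have hy' : y ∈ Icc b0 b1 := ⟨hy.1.le, hy.2.le⟩
    have np := hnp x hx' y hy' t htI
    have gpos : 0 < ε * Real.exp (-lam * (t - s0)) *
      (Xf N a1 (θ1 - κ1 * (t - s0)) x * Xf N b1 (θ2 - κ2 * (t - s0)) y) := by linarith
    have gpos2 := (pos_iff_pos_of_mul_pos gpos).1 (by positivity)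
    have z : ∀ θ a x, 0 < Xf N a θ x → θ < x := by
      intro θ a x h
      by_contra hc
      push Not at hc
      unfold Xf at h
      rw [max_eq_right, zero_mul] at h
      · exact lt_irrefl _ h
      have : Real.exp (N * x) ≤ Real.exp (N * θ) := Real.exp_le_exp.2 (by nlinarith)
      linarith
    have X0 := Xf_nonneg N a1 (θ1 - κ1 * (t - s0)) x
    have Y0 := Xf_nonneg N b1 (θ2 - κ2 * (t - s0)) y
    have X1 : 0 < Xf N a1 (θ1 - κ1 * (t - s0)) x := by
      rcases X0.eq_or_lt with h | h
      · rw [← h, zero_mul] at gpos2; exact absurd gpos2 (lt_irrefl _)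
      · exact h
    have Y1 : 0 < Xf N b1 (θ2 - κ2 * (t - s0)) y := by
      rcases Y0.eq_or_lt with h | h
      · rw [← h, mul_zero] at gpos2; exact absurd gpos2 (lt_irrefl _)
      · exact h
    have hxθ := z _ _ _ X1
    have hyθ := z _ _ _ Y1
    obtain ⟨m1, m2⟩ := hM x hx' y hy' t htI
    have t0 : 0 ≤ t - s0 := by linarith [ht.1]
    have B1 := bar1 (e := Real.exp (N * x)) (f := Real.exp (N * (θ1 - κ1 * (t - s0)))) (s := a1 - x)
      (N := N) (κ := κ1) (M := M) (lam := lam) (Real.exp_pos _)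
      (Real.exp_lt_exp.2 (by nlinarith)) (by linarith [hx.2]) hκ1 (by linarith) hN0 m1 hlam.ge
      (bar1c (D := a1 - θ1) hN0 hx.2 hD1 (by nlinarith) (by linarith) hκ1 hM0)
    have B2 := bar1 (e := Real.exp (N * y)) (f := Real.exp (N * (θ2 - κ2 * (t - s0)))) (s := b1 - y)
      (N := N) (κ := κ2) (M := M) (lam := lam) (Real.exp_pos _)
      (Real.exp_lt_exp.2 (by nlinarith)) (by linarith [hy.2]) hκ2 (by linarith) hN0 m2 hlam.ge
      (bar1c (D := b1 - θ2) hN0 hy.2 hD2 (by nlinarith) (by linarith) hκ2 hM0)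
    have eX : Xf N a1 (θ1 - κ1 * (t - s0)) x =
        (Real.exp (N * x) - Real.exp (N * (θ1 - κ1 * (t - s0)))) * (a1 - x) ^ 2 := by
      unfold Xf; rw [max_eq_left]
      have : Real.exp (N * (θ1 - κ1 * (t - s0))) ≤ Real.exp (N * x) := Real.exp_le_exp.2 (by nlinarith)
      linarith
    have eY : Xf N b1 (θ2 - κ2 * (t - s0)) y =
        (Real.exp (N * y) - Real.exp (N * (θ2 - κ2 * (t - s0)))) * (b1 - y) ^ 2 := by
      unfold Xf; rw [max_eq_left]
      have : Real.exp (N * (θ2 - κ2 * (t - s0))) ≤ Real.exp (N * y) := Real.exp_le_exp.2 (by nlinarith)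
      linarith
    rw [← eX] at B1
    rw [← eY] at B2
    have dE : HasDerivAt (fun τ => ε * Real.exp (-lam * (τ - s0))) (-lam * (ε * Real.exp (-lam * (t - s0)))) t := by
      have h1 : HasDerivAt (fun τ : ℝ => -lam * (τ - s0)) (-lam) t := by
        simpa using ((hasDerivAt_id t).sub_const s0).const_mul (-lam)
      refine (h1.exp.const_mul ε).congr_deriv ?_
      ring
    have dT := dE.mul ((Xf_dt (a1 := a1) hN0 hxθ).mul (Xf_dt (a1 := b1) hN0 hyθ))
    have dx1 := Xf_dx (a1 := a1) hN0 hxθ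
    have dy1 := Xf_dx (a1 := b1) hN0 hyθ
    have dx2 := Xf_dxx (a1 := a1) (N := N) (th := θ1 - κ1 * (t - s0)) (x := x)
    have dy2 := Xf_dxx (a1 := b1) (N := N) (th := θ2 - κ2 * (t - s0)) (x := y)
    refine ⟨_, _, _, _, _, dx1.mono (fun s hs => (hs.mul_const _).const_mul _), (dx2.mul_const _).const_mul _,
      dy1.mono (fun s hs => (hs.const_mul _).const_mul _), (dy2.const_mul _).const_mul _, dT, ?_⟩
    have K0 : 0 < ε * Real.exp (-lam * (t - s0)) := by positivity
    generalize ε * Real.exp (-lam * (t - s0)) = K at *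
    have B3 := mul_le_mul_of_nonneg_right B1 Y0
    have B4 := mul_le_mul_of_nonneg_right B2 X0
    have B5 := mul_le_mul_of_nonneg_left (add_le_add B3 B4) K0.le
    clear dT dx1 dy1 dx2 dy2 dE B1 B2 B3 B4 eX eY hpos gpos gpos2 m1 m2
    simp only [Pi.mul_apply]
    refine le_trans (le_of_eq ?_) (sub_nonpos.2 B5)
    ring

end Pos

section App
variable {u : ℝ → ℝ → ℝ → ℝ} {p l T : ℝ}

theorem grad_le_add (u : ℝ → ℝ → ℝ → ℝ) (x y t : ℝ) :
    gradNorm u x y t ≤ |pdx u x y t| + |pdy u x y t| := by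
  unfold gradNorm
  apply Real.sqrt_le_iff.2
  refine ⟨by positivity, ?_⟩
  have h1 := abs_nonneg (pdx u x y t)
  have h2 := abs_nonneg (pdy u x y t)
  rw [← sq_abs (pdx u x y t), ← sq_abs (pdy u x y t)]
  nlinarith [mul_nonneg h1 h2]

theorem Good.drift (G : Good p l T u) {δ : ℝ} (hδ : 0 < δ) : ∃ M, 0 ≤ M ∧ ∀ x y t : ℝ,
    |x| ≤ 2 * l → 0 ≤ y → y ≤ 2 * l → T / 2 ≤ t → t ≤ T → (δ ≤ |x| ∨ δ ≤ y ∨ t ≤ T - δ) →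
    |p * gradNorm u x y t ^ (p - 2) * pdx u x y t| ≤ M ∧ |p * gradNorm u x y t ^ (p - 2) * pdy u x y t| ≤ M := by
  obtain ⟨M, hM, hB⟩ := G.bddK hδ
  have hp := G.hp
  refine ⟨p * (2 * M) ^ (p - 2) * M, by positivity, ?_⟩
  intro x y t h1 h2 h3 h4 h5 h6
  obtain ⟨b1, b2, -, -⟩ := hB x y t h1 h2 h3 h4 h5 h6
  have hg := grad_le_add u x y t
  have hg2 : gradNorm u x y t ^ (p - 2) ≤ (2 * M) ^ (p - 2) :=
    Real.rpow_le_rpow (gradNorm_nonneg _ _ _ _) (by linarith) (by linarith)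
  have hg3 : 0 ≤ gradNorm u x y t ^ (p - 2) := Real.rpow_nonneg (gradNorm_nonneg _ _ _ _) _
  have hp0 : 0 < p := by linarith
  rw [abs_mul, abs_mul, abs_mul, abs_mul, abs_of_pos hp0, abs_of_nonneg hg3]
  constructor
  · exact mul_le_mul (mul_le_mul_of_nonneg_left hg2 hp0.le) b1 (abs_nonneg _) (by positivity)
  · exact mul_le_mul (mul_le_mul_of_nonneg_left hg2 hp0.le) b2 (abs_nonneg _) (by positivity)

theorem Good.pos_pt (G : Good p l T u) {C : ℝ} (hC : Cst l T u C) (H : ∀ x ∈ Icc (-l) l, ∀ y ∈ Ioc 0 l, ∀ t, T / 2 ≤ t → t < T →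
    pdyy u x y t ≤ C - gradNorm u x y t ^ p) {b : ℝ} (hb : 0 < b) (hbl : b ≤ l) :
    ∃ x y t, 0 < x ∧ x < l ∧ 0 < y ∧ y < b ∧ T / 2 < t ∧ t < T ∧ pdx u x y t < 0 := by
  by_contra hcon
  push Not at hcon
  have hl := G.hl
  have hT := G.hT
  obtain ⟨M, hM, hB⟩ := G.bddK (show 0 < l / 2 by linarith)
  obtain ⟨t, h1, h2, h3, h4⟩ := G.blow0 hC H M (T / 2) (by linarith)
  have ht : T / 2 < t := by linarith
  have al2 : |l / 2| ≤ 2 * l := by rw [abs_of_pos (by linarith)]; linarith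
  have a0 : |(0:ℝ)| ≤ 2 * l := by simp; linarith
  have hb2 := (hB (l / 2) 0 t al2 le_rfl (by linarith) h2 h3.le (by left; exact le_abs_self _)).2.1
  have := deriv_right_nonpos (x := 0) (t0 := b) hb (f := fun s => u 0 s t - u (l / 2) s t) (by
    intro s hs
    have R : ∀ r ∈ Icc 0 (l / 2), HasDerivAt (fun r => u r s t) (pdx u r s t) r := fun r hr =>
      (G.reg' (abs_le.2 ⟨by linarith [hr.1], by linarith [hr.2]⟩) hs.1.le (by linarith [hs.2]) h2 h3).dx
    have := mvt_ge (f := fun r => u r s t) (f' := fun r => pdx u r s t) (a := 0) (b := l / 2) (m := 0) (by linarith)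
      (fun r hr => (R r hr).continuousAt.continuousWithinAt) (fun r hr => R r ⟨hr.1.le, hr.2.le⟩)
      (fun r hr => hcon r s t hr.1 (by linarith [hr.2]) hs.1 hs.2 ht h3)
    simp only [G.bc _ _ a0 h2 h3, G.bc _ _ al2 h2 h3]
    linarith) ((G.reg' a0 le_rfl (by linarith) h2 h3).dy.sub (G.reg' al2 le_rfl (by linarith) h2 h3).dy)
  linarith [(abs_le.1 hb2).2]

theorem Good.pos_bdry (G : Good p l T u) {C : ℝ} (hC : Cst l T u C) (H : ∀ x ∈ Icc (-l) l, ∀ y ∈ Ioc 0 l, ∀ t, T / 2 ≤ t → t < T →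
    pdyy u x y t ≤ C - gradNorm u x y t ^ p) {b : ℝ} (hb : 0 < b) (hbl : b ≤ l) :
    ∃ x1 y1 t0 c, 0 < x1 ∧ x1 < l ∧ 0 < y1 ∧ y1 < b ∧ T / 2 < t0 ∧ t0 < T ∧ 0 < c ∧
      (∀ x ∈ Icc 0 x1, ∀ y ∈ Icc 0 y1, c * x * y ≤ - pdx u x y t0) ∧
      (∀ y ∈ Icc 0 y1, ∀ t, t0 ≤ t → t < T → c * y ≤ - pdx u x1 y t) ∧
      (∀ x ∈ Icc 0 x1, ∀ t, t0 ≤ t → t < T → c * x ≤ - pdx u x y1 t) := by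
  have hl := G.hl
  have hT := G.hT
  obtain ⟨x1, y1, tp, hx0, hxl, hy0, hyb, htp, htpT, hneg⟩ := G.pos_pt hC H hb hbl
  have cc : ContinuousAt (fun q : ℝ × ℝ => pdx u q.1 q.2 tp) (x1, y1) :=
    ContinuousAt.comp (f := fun q : ℝ × ℝ => ((q.1, q.2, tp) : ℝ × ℝ × ℝ)) (x := (x1, y1))
      (G.reg' (abs_le.2 ⟨by linarith, by linarith⟩) hy0.le (by linarith) htp.le htpT).cx (by fun_prop)
  obtain ⟨m, hm1, hm2⟩ := exists_between hneg
  obtain ⟨r0, hr0, Hr⟩ := Metric.eventually_nhds_iff.1 (cc.eventually (gt_mem_nhds hm1))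
  obtain ⟨r, hr, hrr, hrx, hry⟩ : ∃ r > 0, r < r0 ∧ x1 + r ≤ l ∧ y1 + r ≤ l := by
    refine ⟨min (r0 / 2) (min (l - x1) (l - y1)), lt_min (by linarith) (lt_min (by linarith) (by linarith)), ?_, ?_, ?_⟩
    · have := min_le_left (r0 / 2) (min (l - x1) (l - y1)); linarith
    · have := min_le_right (r0 / 2) (min (l - x1) (l - y1))
      have := min_le_left (l - x1) (l - y1); linarith
    · have := min_le_right (r0 / 2) (min (l - x1) (l - y1))
      have := min_le_right (l - x1) (l - y1); linarith
  obtain ⟨t0, ht0a, ht0T⟩ := exists_between htpT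
  -- App 1
  obtain ⟨M1, hM1, D1⟩ := G.drift (show 0 < T - t0 by linarith)
  have A1 := G.posl (a0 := 0) (a1 := x1 + r) (b0 := 0) (b1 := y1 + r) (s0 := tp) (s1 := t0)
    (κ1 := x1 / (t0 - tp)) (κ2 := y1 / (t0 - tp)) (θ1 := x1) (θ2 := y1) (ε0 := (-m) / l ^ 6) (M := M1)
    le_rfl hrx le_rfl hry htp.le (div_nonneg hx0.le (by linarith)) (div_nonneg hy0.le (by linarith))
    (by linarith) (by linarith) (by
      intro t ht
      have h1 := ht.1.2
      have : x1 / (t0 - tp) * (t - tp) ≤ x1 / (t0 - tp) * (t0 - tp) :=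
        mul_le_mul_of_nonneg_left (by linarith) (div_nonneg hx0.le (by linarith))
      rw [div_mul_cancel₀ _ (by linarith)] at this
      linarith) (by
      intro t ht
      have h1 := ht.1.2
      have : y1 / (t0 - tp) * (t - tp) ≤ y1 / (t0 - tp) * (t0 - tp) :=
        mul_le_mul_of_nonneg_left (by linarith) (div_nonneg hy0.le (by linarith))
      rw [div_mul_cancel₀ _ (by linarith)] at this
      linarith) hM1 (by
      intro x hx y hy t ht
      exact D1 x y t (abs_le.2 ⟨by linarith [hx.1], by linarith [hx.2]⟩) hy.1 (by linarith [hy.2])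
        (by linarith [ht.1.1]) (by linarith [ht.1.2]) (by right; right; linarith [ht.1.2]))
    (div_pos (by linarith) (by positivity)) (by
      intro x hx y hy
      have np : pdx u x y tp ≤ 0 := G.pdx_le hx.1 (by linarith [hx.2]) hy.1 (by linarith [hy.2]) htp.le htpT
      rcases le_total x x1 with h | h
      · rw [max_eq_right (by linarith)]; simpa using np
      rcases le_total y y1 with h' | h'
      · rw [max_eq_right (a := y - y1) (by linarith)]; simpa using np
      rw [max_eq_left (by linarith), max_eq_left (by linarith)]
      have hv := Hr (y := (x, y)) (by
        rw [Prod.dist_eq]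
        simp only [max_lt_iff, Real.dist_eq]
        exact ⟨abs_lt.2 ⟨by linarith, by linarith [hx.2]⟩, abs_lt.2 ⟨by linarith, by linarith [hy.2]⟩⟩)
      have hv : pdx u x y tp < m := hv
      have q1 : (x - x1) * (x1 + r - x) ^ 2 ≤ l * l ^ 2 :=
        mul_le_mul (by linarith [hx.2]) (pow_le_pow_left₀ (by linarith [hx.2]) (by linarith) 2) (sq_nonneg _) hl.le
      have q2 : (y - y1) * (y1 + r - y) ^ 2 ≤ l * l ^ 2 :=
        mul_le_mul (by linarith [hy.2]) (pow_le_pow_left₀ (by linarith [hy.2]) (by linarith) 2) (sq_nonneg _) hl.le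
      have q3 := mul_le_mul q1 q2 (mul_nonneg (by linarith) (sq_nonneg _)) (by positivity)
      have q4 := mul_le_mul_of_nonneg_left q3 (show 0 ≤ -m / l ^ 6 from div_nonneg (by linarith) (by positivity))
      have q5 : -m / l ^ 6 * (l * l ^ 2 * (l * l ^ 2)) = -m := by field_simp
      linarith)
  obtain ⟨c1, hc1, B1⟩ := A1
  have B1' : ∀ x ∈ Icc 0 (x1 + r), ∀ y ∈ Icc 0 (y1 + r),
      c1 * (x * (x1 + r - x) ^ 2 * (y * (y1 + r - y) ^ 2)) ≤ - pdx u x y t0 := by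
    intro x hx y hy
    have := B1 x hx y hy t0 ⟨⟨ht0a.le, le_rfl⟩, ht0T⟩
    rw [div_mul_cancel₀ _ (by linarith), div_mul_cancel₀ _ (by linarith), sub_self, sub_self, sub_zero, sub_zero,
      max_eq_left hx.1, max_eq_left hy.1] at this
    exact this
  have ht02 : T / 2 < t0 := by linarith
  -- App 2
  obtain ⟨M2, hM2, D2⟩ := G.drift (show 0 < x1 / 2 by linarith)
  obtain ⟨c2, hc2, B2⟩ := G.posl (a0 := x1 / 2) (a1 := x1 + r) (b0 := 0) (b1 := y1 + r) (s0 := t0) (s1 := T)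
    (κ1 := 0) (κ2 := 0) (θ1 := x1 / 2) (θ2 := 0) (ε0 := c1) (M := M2)
    (by linarith) hrx le_rfl hry ht02.le le_rfl le_rfl (by linarith) (by linarith)
    (fun t ht => by linarith) (fun t ht => by linarith) hM2 (by
      intro x hx y hy t ht
      exact D2 x y t (abs_le.2 ⟨by linarith [hx.1], by linarith [hx.2]⟩) hy.1 (by linarith [hy.2])
        (by linarith [ht.1.1]) (by linarith [ht.1.2]) (by left; rw [abs_of_nonneg (by linarith [hx.1])]; exact hx.1))
    hc1 (by
      intro x hx y hy
      refine le_trans ?_ (B1' x ⟨by linarith [hx.1], hx.2⟩ y hy)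
      rw [sub_zero, max_eq_left hy.1, max_eq_left (by linarith [hx.1])]
      have := hy.1
      gcongr
      linarith)
  -- App 3
  obtain ⟨M3, hM3, D3⟩ := G.drift (show 0 < y1 / 2 by linarith)
  obtain ⟨c3, hc3, B3⟩ := G.posl (a0 := 0) (a1 := x1 + r) (b0 := y1 / 2) (b1 := y1 + r) (s0 := t0) (s1 := T)
    (κ1 := 0) (κ2 := 0) (θ1 := 0) (θ2 := y1 / 2) (ε0 := c1) (M := M3)
    le_rfl hrx (by linarith) hry ht02.le le_rfl le_rfl (by linarith) (by linarith)
    (fun t ht => by linarith) (fun t ht => by linarith) hM3 (by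
      intro x hx y hy t ht
      exact D3 x y t (abs_le.2 ⟨by linarith [hx.1], by linarith [hx.2]⟩) (by linarith [hy.1]) (by linarith [hy.2])
        (by linarith [ht.1.1]) (by linarith [ht.1.2]) (by right; left; exact hy.1))
    hc1 (by
      intro x hx y hy
      refine le_trans ?_ (B1' x hx y ⟨by linarith [hy.1], hy.2⟩)
      rw [sub_zero, max_eq_left hx.1, max_eq_left (by linarith [hy.1])]
      have := hx.1
      have : 0 ≤ y - y1 / 2 := by linarith [hy.1]
      gcongr
      linarith)
  have k1 : 0 < c1 * r ^ 4 := by positivity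
  have k2 : 0 < c2 * (x1 / 2) * r ^ 4 := by positivity
  have k3 : 0 < c3 * (y1 / 2) * r ^ 4 := by positivity
  refine ⟨x1, y1, t0, min (c1 * r ^ 4) (min (c2 * (x1 / 2) * r ^ 4) (c3 * (y1 / 2) * r ^ 4)), hx0, hxl, hy0, hyb,
    ht02, ht0T, lt_min k1 (lt_min k2 k3), ?_, ?_, ?_⟩
  · intro x hx y hy
    refine le_trans ?_ (B1' x ⟨hx.1, by linarith [hx.2]⟩ y ⟨hy.1, by linarith [hy.2]⟩)
    have h1 := hx.1
    have h2 := hy.1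
    calc _ ≤ c1 * r ^ 4 * x * y := by
          gcongr; exact min_le_left _ _
      _ = c1 * (x * r ^ 2 * (y * r ^ 2)) := by ring
      _ ≤ _ := by
          gcongr
          · linarith [hx.2]
          · linarith [hy.2]
  · intro y hy t ht htT
    have := B2 x1 ⟨by linarith, by linarith⟩ y ⟨hy.1, by linarith [hy.2]⟩ t ⟨⟨ht, htT.le⟩, htT⟩
    rw [zero_mul, sub_zero, sub_zero, sub_zero, max_eq_left hy.1, max_eq_left (by linarith)] at this
    refine le_trans ?_ this
    have h2 := hy.1
    calc _ ≤ c2 * (x1 / 2) * r ^ 4 * y := by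
          gcongr; exact (min_le_right _ _).trans (min_le_left _ _)
      _ = c2 * ((x1 - x1 / 2) * (x1 + r - x1) ^ 2 * (y * r ^ 2)) := by ring
      _ ≤ _ := by
          have : 0 ≤ x1 - x1 / 2 := by linarith
          gcongr
          · linarith [hy.2]
  · intro x hx t ht htT
    have := B3 x ⟨hx.1, by linarith [hx.2]⟩ y1 ⟨by linarith, by linarith⟩ t ⟨⟨ht, htT.le⟩, htT⟩
    rw [zero_mul, sub_zero, sub_zero, sub_zero, max_eq_left hx.1, max_eq_left (by linarith)] at this
    refine le_trans ?_ this
    have h2 := hx.1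
    calc _ ≤ c3 * (y1 / 2) * r ^ 4 * x := by
          gcongr; exact (min_le_right _ _).trans (min_le_right _ _)
      _ = c3 * (x * r ^ 2 * ((y1 - y1 / 2) * (y1 + r - y1) ^ 2)) := by ring
      _ ≤ _ := by
          have : 0 ≤ y1 - y1 / 2 := by linarith
          gcongr
          · linarith [hx.2]

end App

section Alg

set_option maxHeartbeats 1600000 in
theorem Phi_neg {α q τ y a θ R : ℝ} (hα : 0 < α) (hα2 : α ≤ 1 / 2) (hq : (q - 1) * (α * (1 - α)) = 2)
    (hτ : 0 ≤ τ) (hτq : τ * (q + 1) ≤ 1) (hy : 0 < y) (hy1 : y ≤ α ^ 2) (hR : R ≤ τ * y)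
    (hc : (0 ≤ a ∧ 0 ≤ θ ∧ θ ≤ 1 + τ * y) ∨ (-α ≤ a ∧ a ≤ 0 ∧ θ ≤ 1 + a / α + τ * y) ∨ (a ≤ -α ∧ θ ≤ 0)) :
    q * (a * (2 * α - θ) + a ^ 2 - (1 - θ) * (α * (1 - α))) - (2 - α) * θ * y - (q * a + y) ^ 2 + R ≤ 0 := by
  obtain ⟨β, hβ⟩ : ∃ β, β = α * (1 - α) := ⟨_, rfl⟩
  rw [← hβ] at hq ⊢
  have hβ0 : 0 < β := by rw [hβ]; exact mul_pos hα (by linarith)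
  have hβ4 : β ≤ 1 / 4 := by rw [hβ]; nlinarith [sq_nonneg (α - 1 / 2)]
  have hq9 : 9 ≤ q := by
    by_contra h
    push Not at h
    nlinarith
  have hqβ : q * β = 2 + β := by linarith
  have hα4 : α ^ 2 ≤ 1 / 4 := by nlinarith
  have hτ1 : τ ≤ 1 / 10 := by nlinarith
  rcases hc with ⟨ha, hθ0, hθ⟩ | ⟨ha1, ha2, hθ⟩ | ⟨ha, hθ⟩
  · rcases le_total θ 1 with h1 | h1
    · have e1 : q * (a * (2 * α - θ)) ≤ q * (a * (1 - θ)) := by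
        have : 0 ≤ q * a := by positivity
        nlinarith
      -- AM-GM
      have e2 : a * (1 - θ) ≤ (q - 1) * a ^ 2 + (1 - θ) * (β / 8) := by
        have s1 : 0 ≤ (4 * a - β * (1 - θ)) ^ 2 := sq_nonneg _
        have s2 : (1 - θ) ^ 2 ≤ 1 - θ := by nlinarith
        have s3 : 8 * β * (a * (1 - θ)) ≤ 16 * a ^ 2 + β ^ 2 * (1 - θ) := by nlinarith [sq_nonneg β]
        have s4 : 8 * β * ((q - 1) * a ^ 2) = 16 * a ^ 2 := by linear_combination 8 * a ^ 2 * hq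
        have s5 : 8 * β * (a * (1 - θ)) ≤ 8 * β * ((q - 1) * a ^ 2 + (1 - θ) * (β / 8)) := by
          nlinarith
        exact le_of_mul_le_mul_left s5 (by positivity)
      have e3 := mul_le_mul_of_nonneg_left e2 (show 0 ≤ q by linarith)
      have e4 : q ^ 2 * a ^ 2 ≤ (q * a + y) ^ 2 := by
        have : 0 ≤ q * a := by positivity
        nlinarith
      have e5 : q * ((1 - θ) * β) = (1 - θ) * (2 + β) := by rw [← hqβ]; ring
      have e6 : q * ((1 - θ) * (β / 8)) = (1 - θ) * (2 + β) / 8 := by rw [← hqβ]; ring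
      have e7 : (3 / 2) * θ * y ≤ (2 - α) * θ * y := by
        have : 0 ≤ θ * y := by positivity
        nlinarith
      have e8 : (3 / 2) * y ≤ (3 / 2) * θ * y + (1 - θ) * (7 / 4) := by
        nlinarith
      nlinarith
    · have e1 : a * (2 * α - θ) ≤ 0 := by nlinarith
      have e4 : q * a ^ 2 ≤ (q * a + y) ^ 2 := by
        have : 0 ≤ q * a := by positivity
        nlinarith [sq_nonneg a]
      have e2 : q * ((θ - 1) * β) ≤ q * (τ * y * (1 / 4)) := by
        refine mul_le_mul_of_nonneg_left ?_ (by linarith)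
        exact mul_le_mul (by linarith) hβ4 hβ0.le (by positivity)
      have e3 : (3 / 2) * y ≤ (2 - α) * θ * y := by
        have : (3 / 2) * 1 ≤ (2 - α) * θ := mul_le_mul (by linarith) h1 (by norm_num) (by linarith)
        have := mul_le_mul_of_nonneg_right this hy.le
        linarith
      have e5 : q * (a * (2 * α - θ)) ≤ 0 := mul_nonpos_of_nonneg_of_nonpos (by linarith) e1
      have e6 : τ * (q + 1) * y ≤ 1 * y := mul_le_mul_of_nonneg_right hτq hy.le
      have e7 : 0 ≤ τ * q * y := by positivity
      have e8 : q * (a * (2 * α - θ) + a ^ 2 - (1 - θ) * β) = q * (a * (2 * α - θ)) + q * a ^ 2 + q * ((θ - 1) * β) := by ring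
      rw [e8]
      linarith
  · obtain ⟨n, hn⟩ : ∃ n, a = - n * α := ⟨-a / α, by field_simp⟩
    subst hn
    have hn0 : 0 ≤ n := by nlinarith
    have hn1 : n ≤ 1 := by nlinarith
    have hθ' : θ ≤ 1 - n + τ * y := by
      have : -n * α / α = -n := by field_simp
      rw [this] at hθ; linarith
    have coef : 0 ≤ q * (n * α) + q * β - (2 - α) * y := by
      have : 0 ≤ q * (n * α) := by positivity
      nlinarith
    have m1 := mul_le_mul_of_nonneg_left hθ' coef
    have hy2 : (2 - α) * n * y ≤ 2 * n * α ^ 2 := by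
      have : (2 - α) * n ≤ 2 * n := by nlinarith
      exact mul_le_mul this hy1 hy.le (by positivity)
    have r1 : q * (-n * α * (2 * α) + (n * α) ^ 2 - β) + (q * (n * α) + q * β - (2 - α) * y) * (1 - n + τ * y)
        ≤ - (q * (n * α ^ 2)) + q * (τ * y) - (2 - α) * (1 - n + τ * y) * y := by
      have : q * (τ * y) * (n * α + β) ≤ q * (τ * y) * 1 :=
        mul_le_mul_of_nonneg_left (by nlinarith) (by positivity)
      have h3 : q * (n ^ 2 * α ^ 2 - n ^ 2 * α) ≤ 0 :=
        mul_nonpos_of_nonneg_of_nonpos (by linarith) (by nlinarith [sq_nonneg n])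
      have h4 : q * (-n * α * (2 * α) + (n * α) ^ 2 - β) + (q * (n * α) + q * β) * (1 - n + τ * y)
        = - (q * (n * α ^ 2)) + q * (n ^ 2 * α ^ 2 - n ^ 2 * α) + q * (τ * y) * (n * α + β) := by
        rw [hβ]; ring
      nlinarith
    have r2 : 0 ≤ (2 - α) * (τ * y) * y := by
      have : 0 ≤ 2 - α := by linarith
      positivity
    have r3 : 9 * (n * α ^ 2) ≤ q * (n * α ^ 2) := mul_le_mul_of_nonneg_right hq9 (by positivity)
    have e6 : τ * (q + 1) * y ≤ 1 * y := mul_le_mul_of_nonneg_right hτq hy.le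
    have r4 : 0 ≤ n * α ^ 2 := by positivity
    nlinarith [sq_nonneg (q * (-n * α) + y)]
  · obtain ⟨s, hs⟩ : ∃ s, a = -α - s := ⟨-α - a, by ring⟩
    subst hs
    have hs0 : 0 ≤ s := by linarith
    obtain ⟨ρ, hρ⟩ : ∃ ρ, θ = - ρ := ⟨-θ, by ring⟩
    subst hρ
    have hρ0 : 0 ≤ ρ := by linarith
    have hqα : 2 * y ≤ q * α := by nlinarith
    have e1 : q * s ^ 2 ≤ (q * (-α - s) + y) ^ 2 := by
      have h1 : 0 ≤ q * s := by positivity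
      have h2 : q * s ≤ q * (α + s) - y := by nlinarith
      have h3 : (q * s) ^ 2 ≤ (q * (α + s) - y) ^ 2 := pow_le_pow_left₀ h1 h2 2
      nlinarith [sq_nonneg s]
    have e2 : (2 - α) * ρ * y ≤ q * α * ρ := by
      have : 0 ≤ ρ * y := by positivity
      nlinarith
    have e3 : 0 ≤ q * s * ρ := by positivity
    have e4 : 0 ≤ q * β * ρ := by positivity
    have e5 : q * ((-α - s) * (2 * α - -ρ) + (-α - s) ^ 2 - (1 - -ρ) * β) =
      q * s ^ 2 - q * α ^ 2 - q * α * ρ - q * s * ρ - q * β - q * β * ρ := by ring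
    have e6 : τ * y ≤ 1 := by nlinarith
    rw [e5]
    have : 0 ≤ q * α ^ 2 := by positivity
    nlinarith

theorem pt_alg {α p q U w r y x k F Pm ut uxx uyy R : ℝ} (hU : 0 < U) (hy : 0 < y) (hx : 0 < x) (hk : 0 < k) (hF : 0 < F)
    (hPm : 0 ≤ Pm) (hq : 1 ≤ q) (hp : 1 ≤ p)
    (h1 : ut - (uxx + uyy) = Pm * ((-r * x) ^ 2 + w ^ 2))
    (hr0 : 0 ≤ r) (hr : r ≤ k * F)
    (hR : y ^ 2 * (k * F) * (2 * q / U + p * Pm) ≤ R)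
    (hΦ : q * (Pm * w * y) * (w * y / U) - (q * (w * y / U - α) + y) ^ 2 - q * α + q * (w * y / U) ^ 2
      - p * (Pm * w * y) * (q * (w * y / U - α) + y) + R ≤ 0) :
    k * x * F * (q * ut / U) - k * F * (2 * q * (-r * x) / U + x * (q ^ 2 * (-r * x) ^ 2 / U ^ 2 + q * uxx / U - q * (-r * x) ^ 2 / U ^ 2))
     - k * x * F * ((q * (w / U - α / y) + 1) ^ 2 + q * α / y ^ 2 + q * uyy / U - q * w ^ 2 / U ^ 2)
     - p * Pm * ((-r * x) * (k * F * (1 + x * (q * (-r * x) / U))) + w * (k * x * F * (q * (w / U - α / y) + 1))) ≤ 0 := by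
  have hut : ut = uxx + uyy + Pm * ((-r * x) ^ 2 + w ^ 2) := by linarith
  subst hut
  have key : k * x * F * (q * (uxx + uyy + Pm * ((-r * x) ^ 2 + w ^ 2)) / U) - k * F * (2 * q * (-r * x) / U + x * (q ^ 2 * (-r * x) ^ 2 / U ^ 2 + q * uxx / U - q * (-r * x) ^ 2 / U ^ 2))
     - k * x * F * ((q * (w / U - α / y) + 1) ^ 2 + q * α / y ^ 2 + q * uyy / U - q * w ^ 2 / U ^ 2)
     - p * Pm * ((-r * x) * (k * F * (1 + x * (q * (-r * x) / U))) + w * (k * x * F * (q * (w / U - α / y) + 1)))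
     = k * x * F / y ^ 2 * (q * (Pm * w * y) * (w * y / U) - (q * (w * y / U - α) + y) ^ 2 - q * α + q * (w * y / U) ^ 2
      - p * (Pm * w * y) * (q * (w * y / U - α) + y) + y ^ 2 * r * (2 * q / U + p * Pm)
      - (p - 1) * (q * Pm * (y * r * x) ^ 2 / U) - (q - 1) * (q * (y * r * x) ^ 2 / U ^ 2)) := by
    field_simp
    ring
  rw [key]
  refine mul_nonpos_of_nonneg_of_nonpos (by positivity) ?_
  have n1 : 0 ≤ (p - 1) * (q * Pm * (y * r * x) ^ 2 / U) := mul_nonneg (by linarith) (by positivity)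
  have n2 : 0 ≤ (q - 1) * (q * (y * r * x) ^ 2 / U ^ 2) := mul_nonneg (by linarith) (by positivity)
  have n3 : y ^ 2 * r * (2 * q / U + p * Pm) ≤ y ^ 2 * (k * F) * (2 * q / U + p * Pm) := by
    have : 0 ≤ 2 * q / U + p * Pm := by positivity
    gcongr
  linarith

theorem Phi_eq {α p q A y B : ℝ} (hp : (1 - α) * (p - 1) = 1) :
   q * B * A - (q * (A - α) + y) ^ 2 - q * α + q * A ^ 2 - p * B * (q * (A - α) + y) =
   q * ((A - α) * (2 * α - (p - 1) * B) + (A - α) ^ 2 - (1 - (p - 1) * B) * (α * (1 - α)))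
    - (2 - α) * ((p - 1) * B) * y - (q * (A - α) + y) ^ 2 := by
  have h2 : (2 - α) * (p - 1) = p := by linarith
  have h3 : α * (1 - α) * (p - 1) = α := by linear_combination α * hp
  linear_combination (B * y) * h2 - (q * B * α) * hp

theorem rpow_bd {P D δ r : ℝ} (hP : 0 ≤ P) (hD : 0 ≤ D) (hδ : 0 ≤ δ) (h : P ^ 2 ≤ D ^ 2 * (1 + δ)) (hr : 0 ≤ r) (hr2 : r ≤ 2) :
    P ^ r ≤ D ^ r * (1 + δ) := by
  have h1 : P ≤ D * √(1 + δ) := by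
    refine abs_le_of_sq_le_sq' ?_ (by positivity) |>.2
    rw [mul_pow, Real.sq_sqrt (by linarith)]; exact h
  have h2 : 1 ≤ √(1 + δ) := Real.one_le_sqrt.2 (by linarith)
  calc P ^ r ≤ (D * √(1 + δ)) ^ r := Real.rpow_le_rpow hP h1 hr
    _ = D ^ r * √(1 + δ) ^ r := Real.mul_rpow hD (by positivity)
    _ ≤ D ^ r * √(1 + δ) ^ (2:ℝ) := by
        refine mul_le_mul_of_nonneg_left ?_ (Real.rpow_nonneg hD _)
        exact Real.rpow_le_rpow_of_exponent_le h2 hr2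
    _ = _ := by
        rw [Real.rpow_two, Real.sq_sqrt (by linarith)]

end Alg

section Scal

/-- the barrier profile -/
def Ff (q α U y : ℝ) : ℝ := (U / y ^ α) ^ q * Real.exp y

theorem Ff_bd {q α U y V : ℝ} (hq : 1 ≤ q) (hU : 0 < U) (hy : 0 < y) (hy1 : y ≤ 1) (hUV : U ≤ V * y ^ α) :
    0 < Ff q α U y ∧ Ff q α U y ≤ V ^ q * Real.exp 1 ∧ Ff q α U y / U ≤ V ^ (q - 1) * Real.exp 1 * y ^ (-α) := by
  have hya : 0 < y ^ α := Real.rpow_pos_of_pos hy _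
  have h0 : 0 < U / y ^ α := by positivity
  have h1 : U / y ^ α ≤ V := by rwa [div_le_iff₀ hya]
  have he : Real.exp y ≤ Real.exp 1 := Real.exp_le_exp.2 hy1
  have hV : 0 ≤ V := by linarith
  refine ⟨?_, ?_, ?_⟩
  · unfold Ff; positivity
  · unfold Ff
    exact mul_le_mul (Real.rpow_le_rpow h0.le h1 (by linarith)) he (Real.exp_pos _).le (by positivity)
  · have : Ff q α U y / U = (U / y ^ α) ^ (q - 1) * Real.exp y * y ^ (-α) := by
      unfold Ff
      rw [Real.rpow_sub_one h0.ne', Real.rpow_neg hy.le]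
      field_simp
    rw [this]
    have := Real.rpow_le_rpow h0.le h1 (show 0 ≤ q - 1 by linarith)
    gcongr

theorem rp1 {α y : ℝ} (hα2 : α ≤ 1 / 2) (hy : 0 < y) (hy1 : y ≤ 1) : y ^ (2 - α) ≤ y * √y := by
  have : y * √y = y ^ (3 / 2 : ℝ) := by
    rw [Real.sqrt_eq_rpow]
    nth_rewrite 1 [← Real.rpow_one y]
    rw [← Real.rpow_add hy]; norm_num
  rw [this]
  exact Real.rpow_le_rpow_of_exponent_ge hy hy1 (by linarith)

theorem rp2 {α y : ℝ} (hα2 : α ≤ 1 / 2) (hy : 0 < y) (hy1 : y ≤ 1) : y ^ (2 - 2 * α) ≤ y := by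
  nth_rewrite 2 [← Real.rpow_one y]
  exact Real.rpow_le_rpow_of_exponent_ge hy hy1 (by linarith)

theorem rp3 {α y : ℝ} (hα2 : α ≤ 1 / 2) (hy : 0 < y) (hy1 : y ≤ 1) : y ^ 2 * y ^ (-α) ≤ y := by
  rw [← Real.rpow_two, ← Real.rpow_add hy]
  nth_rewrite 2 [← Real.rpow_one y]
  exact Real.rpow_le_rpow_of_exponent_ge hy hy1 (by linarith)

theorem rp4 {α y : ℝ} (hα2 : α ≤ 1 / 2) (hy : 0 < y) (hy1 : y ≤ 1) : 1 ≤ y ^ (α - 1) :=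
  Real.one_le_rpow_of_pos_of_le_one_of_nonpos hy hy1 (by linarith)

theorem R_bd {α q p τ y U F F0 F1 k Pm K2 : ℝ} (hα2 : α ≤ 1 / 2) (hy : 0 < y) (hy1 : y ≤ 1) (hU : 0 < U)
    (hq : 0 ≤ q) (hp : 0 ≤ p) (hk : 0 ≤ k) (hF : 0 ≤ F) (hF0 : F ≤ F0) (hF1 : F / U ≤ F1 * y ^ (-α))
    (hPm : 0 ≤ Pm) (hPm2 : Pm ≤ K2 * y ^ (-α)) (h : k * (2 * q * F1 + p * F0 * K2) ≤ τ) :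
    y ^ 2 * (k * F) * (2 * q / U + p * Pm) ≤ τ * y := by
  have hya : 0 < y ^ (-α) := Real.rpow_pos_of_pos hy _
  have h3 := rp3 hα2 hy hy1
  have e1 : F * Pm ≤ F0 * (K2 * y ^ (-α)) := mul_le_mul hF0 hPm2 hPm (hF.trans hF0)
  have hF1' : 0 ≤ F1 := by
    have : 0 ≤ F1 * y ^ (-α) := le_trans (by positivity) hF1
    exact nonneg_of_mul_nonneg_left this hya
  have hK2 : 0 ≤ K2 := nonneg_of_mul_nonneg_left (hPm.trans hPm2) hya
  have hF00 : 0 ≤ F0 := hF.trans hF0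
  calc y ^ 2 * (k * F) * (2 * q / U + p * Pm) = y ^ 2 * k * (2 * q * (F / U) + p * (F * Pm)) := by field_simp
    _ ≤ y ^ 2 * k * (2 * q * (F1 * y ^ (-α)) + p * (F0 * (K2 * y ^ (-α)))) := by gcongr
    _ = (k * (2 * q * F1 + p * F0 * K2)) * (y ^ 2 * y ^ (-α)) := by ring
    _ ≤ (k * (2 * q * F1 + p * F0 * K2)) * y := by
        refine mul_le_mul_of_nonneg_left h3 (by positivity)
    _ ≤ τ * y := mul_le_mul_of_nonneg_right h hy.le

theorem dd_pow2 {p y : ℝ} (hp : 2 < p) (hy : 0 < y) : (y ^ (al p - 1)) ^ (p - 2) = y ^ (-(al p)) := by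
  rw [← Real.rpow_mul hy.le]
  congr 1
  linarith [al_mul hp]

theorem Pm_bd {p y P K : ℝ} (hp : 2 < p) (hy : 0 < y) (hP : 0 ≤ P) (hK : 0 ≤ K) (h : P ≤ K * y ^ (al p - 1)) :
    P ^ (p - 2) ≤ K ^ (p - 2) * y ^ (-(al p)) := by
  calc P ^ (p - 2) ≤ (K * y ^ (al p - 1)) ^ (p - 2) := Real.rpow_le_rpow hP h (by linarith)
    _ = _ := by rw [Real.mul_rpow hK (by positivity), dd_pow2 hp hy]

set_option maxHeartbeats 1600000 in
theorem theta_bd {p y U w ξ P C Ξ τ : ℝ} (hp : 2 < p) (hp3 : p ≤ 3) (hy : 0 < y) (hy1 : y ≤ 1) (hU : 0 < U) (hC : 0 < C)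
    (hw : w ≤ dd p * y ^ (al p - 1) + C * y) (hUle : U ≤ dd p / al p * y ^ (al p) + C * y ^ 2 / 2)
    (hP : 0 ≤ P) (hP2 : P ^ 2 = ξ ^ 2 + w ^ 2) (hξ : |ξ| ≤ Ξ) (hτ : 0 ≤ τ) (hτ1 : τ ≤ 1)
    (hb : √y * (2 * C / dd p + C ^ 2 / dd p ^ 2) ≤ τ / 4) (hk : Ξ ^ 2 / dd p ^ 2 ≤ τ / 4) :
    (0 ≤ w * y / U - al p ∧ 0 ≤ (p - 1) * (P ^ (p - 2) * w * y) ∧ (p - 1) * (P ^ (p - 2) * w * y) ≤ 1 + τ * y) ∨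
    (-al p ≤ w * y / U - al p ∧ w * y / U - al p ≤ 0 ∧ (p - 1) * (P ^ (p - 2) * w * y) ≤ 1 + (w * y / U - al p) / al p + τ * y) ∨
    (w * y / U - al p ≤ - al p ∧ (p - 1) * (P ^ (p - 2) * w * y) ≤ 0) := by
  have hα := al_pos hp
  have hα2 := al_le hp hp3
  have hd := dd_pos hp
  have hPm : 0 ≤ P ^ (p - 2) := Real.rpow_nonneg hP _
  have hp1 : 0 ≤ p - 1 := by linarith
  rcases le_or_gt w 0 with h0 | h0
  · right; right
    constructor
    · have : w * y / U ≤ 0 := div_nonpos_of_nonpos_of_nonneg (mul_nonpos_of_nonpos_of_nonneg h0 hy.le) hU.le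
      linarith
    · exact mul_nonpos_of_nonneg_of_nonpos hp1 (mul_nonpos_of_nonpos_of_nonneg (mul_nonpos_of_nonneg_of_nonpos hPm h0) hy.le)
  obtain ⟨D, hD⟩ : ∃ D, D = dd p * y ^ (al p - 1) := ⟨_, rfl⟩
  have hD0 : 0 < D := by rw [hD]; positivity
  have hyD : y / D = y ^ (2 - al p) / dd p := by
    rw [hD, Real.rpow_sub hy, Real.rpow_sub hy, Real.rpow_two, Real.rpow_one]
    field_simp
  have hyD1 : y / D ≤ y * √y / dd p := by
    rw [hyD]; have := rp1 hα2 hy hy1; gcongr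
  have hD2 : 1 / D ^ 2 ≤ y / dd p ^ 2 := by
    have : 1 / D ^ 2 = y ^ (2 - 2 * al p) / dd p ^ 2 := by
      rw [hD, Real.rpow_sub hy, Real.rpow_sub hy, Real.rpow_two, Real.rpow_one, two_mul, Real.rpow_add hy]
      field_simp
    rw [this]; have := rp2 hα2 hy hy1; gcongr
  have hs1 : √y ≤ 1 := Real.sqrt_le_one.2 hy1
  have hs0 : 0 < √y := Real.sqrt_pos.2 hy
  have hs2 : √y * √y = y := Real.mul_self_sqrt hy.le
  obtain ⟨δ, hδ⟩ : ∃ δ, δ = 2 * C * (y / D) + C ^ 2 * (y / D) ^ 2 + Ξ ^ 2 * (1 / D ^ 2) := ⟨_, rfl⟩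
  have hδ0 : 0 ≤ δ := by rw [hδ]; positivity
  have hδ1 : δ ≤ τ / 2 * y := by
    have a1 : C ^ 2 * (y / D) ^ 2 ≤ C ^ 2 * (y * √y / dd p ^ 2) := by
      refine mul_le_mul_of_nonneg_left ?_ (by positivity)
      have : (y / D) ^ 2 ≤ (y * √y / dd p) ^ 2 := by gcongr
      refine this.trans ?_
      rw [div_pow]
      refine div_le_div_of_nonneg_right ?_ (by positivity)
      have e : y * √y ≤ 1 := mul_le_one₀ hy1 hs0.le hs1
      nlinarith [mul_pos hy hs0]
    have a2 : 2 * C * (y / D) ≤ 2 * C * (y * √y / dd p) := by gcongr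
    have a3 : Ξ ^ 2 * (1 / D ^ 2) ≤ Ξ ^ 2 * (y / dd p ^ 2) := by gcongr
    have a4 : 2 * C * (y * √y / dd p) + C ^ 2 * (y * √y / dd p ^ 2) + Ξ ^ 2 * (y / dd p ^ 2)
       = y * (√y * (2 * C / dd p + C ^ 2 / dd p ^ 2) + Ξ ^ 2 / dd p ^ 2) := by ring
    have a5 : y * (√y * (2 * C / dd p + C ^ 2 / dd p ^ 2) + Ξ ^ 2 / dd p ^ 2) ≤ y * (τ / 2) :=
      mul_le_mul_of_nonneg_left (by linarith) hy.le
    linarith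
  have hPD : P ^ 2 ≤ D ^ 2 * (1 + δ) := by
    have e : D ^ 2 * (1 + δ) = (D + C * y) ^ 2 + Ξ ^ 2 := by
      rw [hδ]; field_simp; ring
    rw [e, hP2]
    have : w ^ 2 ≤ (D + C * y) ^ 2 := by rw [← hD] at hw; gcongr
    have : ξ ^ 2 ≤ Ξ ^ 2 := by rw [← sq_abs]; gcongr
    linarith
  have hτy : τ * y ≤ 1 := mul_le_one₀ hτ1 hy.le hy1
  rcases le_total 0 (w * y / U - al p) with ha | ha
  · left
    refine ⟨ha, by positivity, ?_⟩
    have hwP : w ≤ P := by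
      refine abs_le_of_sq_le_sq' ?_ hP |>.2
      rw [hP2]; nlinarith [sq_nonneg ξ]
    have hP0 : 0 < P := by linarith
    have e1 : P ^ (p - 2) * P = P ^ (p - 1) := by
      nth_rewrite 2 [← Real.rpow_one P]
      rw [← Real.rpow_add hP0]; congr 1; ring
    have e2 := rpow_bd hP hD0.le hδ0 hPD (show 0 ≤ p - 1 by linarith) (by linarith)
    rw [hD, dd_pow1 hp hy] at e2
    calc (p - 1) * (P ^ (p - 2) * w * y) ≤ (p - 1) * (P ^ (p - 2) * P * y) := by gcongr
      _ = (p - 1) * (P ^ (p - 1) * y) := by rw [e1]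
      _ ≤ (p - 1) * (((1 - al p) * y⁻¹ * (1 + δ)) * y) := by gcongr
      _ = ((1 - al p) * (p - 1)) * (1 + δ) := by field_simp
      _ ≤ _ := by rw [al_mul hp]; linarith [mul_nonneg hτ hy.le]
  · right; left
    refine ⟨?_, ha, ?_⟩
    · have : 0 ≤ w * y / U := by positivity
      linarith
    have e2 := rpow_bd hP hD0.le hδ0 hPD (show 0 ≤ p - 2 by linarith) (by linarith)
    have e3 : D ^ (p - 2) = D ^ (p - 1) / D := by
      rw [← Real.rpow_sub_one hD0.ne']; congr 1; ring
    have e4 : D ^ (p - 1) = (1 - al p) * y⁻¹ := by rw [hD, dd_pow1 hp hy]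
    have hDy : dd p * y ^ (al p) = D * y := by
      rw [hD, Real.rpow_sub hy, Real.rpow_one]; field_simp
    have hU2 : U ≤ D * y / al p * (1 + al p * C / 2 * (y / D)) := by
      have : D * y / al p * (1 + al p * C / 2 * (y / D)) = dd p / al p * y ^ (al p) + C * y ^ 2 / 2 := by
        rw [show dd p / al p * y ^ (al p) = dd p * y ^ (al p) / al p by ring, hDy]; field_simp
      linarith
    obtain ⟨e', he'⟩ : ∃ e', e' = al p * C / 2 * (y / D) := ⟨_, rfl⟩
    rw [← he'] at hU2
    have he0 : 0 ≤ e' := by rw [he']; positivity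
    have he1 : e' ≤ τ / 4 * y := by
      have b1 : al p * C / 2 * (y / D) ≤ 1 / 2 * C / 2 * (y * √y / dd p) := by gcongr
      have b2 : √y * (2 * C / dd p) ≤ τ / 4 := by
        refine le_trans ?_ hb
        refine mul_le_mul_of_nonneg_left ?_ hs0.le
        have : 0 ≤ C ^ 2 / dd p ^ 2 := by positivity
        linarith
      have b3 := mul_le_mul_of_nonneg_right b2 hy.le
      have b4 : 1 / 2 * C / 2 * (y * √y / dd p) = (√y * (2 * C / dd p) * y) / 8 := by ring
      have : 0 ≤ τ * y := mul_nonneg hτ hy.le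
      linarith
    have hA : 0 ≤ w * y / U := by positivity
    have hA1 : w * y / U / al p ≤ 1 := by rw [div_le_one hα]; linarith
    have c1 : (p - 1) * (P ^ (p - 2) * w * y) ≤ (w * y / U / al p) * ((1 + δ) * (1 + e')) := by
      calc (p - 1) * (P ^ (p - 2) * w * y) = (p - 1) * (w * y / U) * (P ^ (p - 2) * U) := by field_simp
        _ ≤ (p - 1) * (w * y / U) * ((D ^ (p - 2) * (1 + δ)) * (D * y / al p * (1 + e'))) := by
            refine mul_le_mul_of_nonneg_left ?_ (by positivity)
            exact mul_le_mul e2 hU2 hU.le (by positivity)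
        _ = ((1 - al p) * (p - 1)) * ((w * y / U / al p) * ((1 + δ) * (1 + e'))) := by
            rw [e3, e4]; field_simp
        _ = _ := by rw [al_mul hp, one_mul]
    have c2 : (1 + δ) * (1 + e') ≤ 1 + τ * y := by
      have : δ * e' ≤ (τ / 2 * y) * (1 / 4) :=
        mul_le_mul hδ1 (by linarith) he0 (by positivity)
      linarith [mul_nonneg hτ hy.le]
    have c3 : (w * y / U / al p) * ((1 + δ) * (1 + e')) ≤ (w * y / U / al p) * (1 + τ * y) :=
      mul_le_mul_of_nonneg_left c2 (by positivity)
    have c4 : (w * y / U / al p) * (τ * y) ≤ 1 * (τ * y) := mul_le_mul_of_nonneg_right hA1 (by positivity)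
    have c5 : (w * y / U - al p) / al p = w * y / U / al p - 1 := by field_simp
    rw [c5]; linarith

end Scal

section Interior

variable {u : ℝ → ℝ → ℝ → ℝ} {p l T : ℝ}

theorem Ff_dU {q α y U' s : ℝ} {U : ℝ → ℝ} (hy : 0 < y) (hU : 0 < U s) (h : HasDerivAt U U' s) :
    HasDerivAt (fun s => Ff q α (U s) y) (Ff q α (U s) y * (q * U' / U s)) s := by
  have hya : 0 < y ^ α := Real.rpow_pos_of_pos hy _
  have h0 : 0 < U s / y ^ α := by positivity
  have := ((h.div_const (y ^ α)).rpow_const (p := q) (Or.inl h0.ne')).mul_const (Real.exp y)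
  refine this.congr_deriv ?_
  unfold Ff
  rw [Real.rpow_sub_one h0.ne']
  field_simp

theorem Ff_dy {q α U' s : ℝ} {U : ℝ → ℝ} (hs : 0 < s) (hU : 0 < U s) (h : HasDerivAt U U' s) :
    HasDerivAt (fun s => Ff q α (U s) s) (Ff q α (U s) s * (q * (U' / U s - α / s) + 1)) s := by
  have hya : 0 < s ^ α := Real.rpow_pos_of_pos hs _
  have h0 : 0 < U s / s ^ α := by positivity
  have := ((h.div (Real.hasDerivAt_rpow_const (p := α) (Or.inl hs.ne')) hya.ne').rpow_const (p := q)
    (Or.inl h0.ne')).mul (Real.hasDerivAt_exp s)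
  refine this.congr_deriv ?_
  simp only [Pi.div_apply]
  unfold Ff
  rw [Real.rpow_sub_one h0.ne', Real.rpow_sub_one hs.ne']
  field_simp

theorem gxx_d {q α y k x uxx : ℝ} {U U' : ℝ → ℝ} (hy : 0 < y) (hU : 0 < U x) (h : HasDerivAt U (U' x) x)
    (h' : HasDerivAt U' uxx x) :
    HasDerivAt (fun s => k * Ff q α (U s) y * (1 + s * (q * U' s / U s)))
      (k * Ff q α (U x) y * (2 * q * U' x / U x + x * (q ^ 2 * U' x ^ 2 / U x ^ 2 + q * uxx / U x - q * U' x ^ 2 / U x ^ 2))) x := by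
  have h1 := (Ff_dU (q := q) (α := α) hy hU h).const_mul k
  have h2 := (((h'.const_mul q).div h hU.ne').fun_mul (hasDerivAt_id x)).const_add 1
  have := h1.fun_mul h2
  refine (this.congr_deriv ?_).congr_of_eventuallyEq ?_
  · simp only [Pi.div_apply, id]
    field_simp
    ring
  · refine Filter.Eventually.of_forall fun s => ?_
    simp only [Pi.div_apply, id]
    ring

theorem gx_d {q α y k x : ℝ} {U U' : ℝ → ℝ} (hy : 0 < y) (hU : 0 < U x) (h : HasDerivAt U (U' x) x) :
    HasDerivAt (fun s => k * s * Ff q α (U s) y) (k * Ff q α (U x) y * (1 + x * (q * U' x / U x))) x := by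
  have h1 := ((hasDerivAt_id x).const_mul k).fun_mul (Ff_dU (q := q) (α := α) hy hU h)
  refine h1.congr_deriv ?_
  simp only [id]
  ring

theorem gyy_d {q α y k x uyy : ℝ} {U U' : ℝ → ℝ} (hy : 0 < y) (hU : 0 < U y) (h : HasDerivAt U (U' y) y)
    (h' : HasDerivAt U' uyy y) :
    HasDerivAt (fun s => k * x * Ff q α (U s) s * (q * (U' s / U s - α / s) + 1))
      (k * x * Ff q α (U y) y * ((q * (U' y / U y - α / y) + 1) ^ 2 + q * α / y ^ 2 + q * uyy / U y - q * U' y ^ 2 / U y ^ 2)) y := by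
  have h1 := (Ff_dy (q := q) (α := α) hy hU h).const_mul (k * x)
  have h2 := (((h'.fun_div h hU.ne').fun_sub ((hasDerivAt_const y α).fun_div (hasDerivAt_id y) hy.ne')).const_mul q).add_const 1
  have := h1.fun_mul h2
  refine (this.congr_deriv ?_)
  simp only [id]
  field_simp
  ring

theorem Good.w_ge (G : Good p l T u) {C : ℝ} (hC : Cst l T u C) (H : ∀ x ∈ Icc (-l) l, ∀ y ∈ Ioc 0 l, ∀ t, T / 2 ≤ t → t < T →
    pdyy u x y t ≤ C - gradNorm u x y t ^ p) {x : ℝ} (hx : x ∈ Icc (-l) l) {t : ℝ} (ht : T / 2 ≤ t) (htT : t < T)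
    {y : ℝ} (hy : 0 < y) (hy2 : y ≤ l) : -(C + C * l) ≤ pdy u x y t := by
  have hl := G.hl
  have hC0 := hC.pos
  have ax : |x| ≤ 2 * l := abs_le.2 ⟨by linarith [hx.1], by linarith [hx.2]⟩
  have R : ∀ s ∈ Icc y l, HasDerivAt (fun s => pdy u x s t) (pdyy u x s t) s := fun s hs =>
    (G.reg' ax (by linarith [hs.1]) (by linarith [hs.2]) ht htT).dyy
  have := mvt_le hy2 (fun s hs => (R s hs).continuousAt.continuousWithinAt) (fun s hs => R s ⟨hs.1.le, hs.2.le⟩)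
    (m := C) (fun s hs => by
      have h1 := H x hx s ⟨by linarith [hs.1], hs.2.le⟩ t ht htT
      have h2 : 0 ≤ gradNorm u x s t ^ p := Real.rpow_nonneg (gradNorm_nonneg _ _ _ _) _
      linarith)
  have h3 := abs_le.1 (hC.bulk x hx t ht htT)
  nlinarith

set_option maxHeartbeats 1600000 in
theorem Good.int_est (G : Good p l T u) {C : ℝ} (hC : Cst l T u C) (H : ∀ x ∈ Icc (-l) l, ∀ y ∈ Ioc 0 l, ∀ t, T / 2 ≤ t → t < T →
    pdyy u x y t ≤ C - gradNorm u x y t ^ p) {q τ k V K x y t : ℝ} (hq : (q - 1) * (al p * (1 - al p)) = 2) (hq1 : 1 ≤ q)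
    (hτ : 0 ≤ τ) (hτ1 : τ ≤ 1) (hτq : τ * (q + 1) ≤ 1) (hk : 0 < k) (hV : V = dd p / al p + C)
    (hK : K = dd p + 2 * C + 2 * C * l)
    (hx : 0 < x) (hxl : x < l) (hy : 0 < y) (hyl : y < l) (hy1 : y ≤ 1) (hyα : y ≤ al p ^ 2)
    (ht : T / 2 ≤ t) (htT : t < T)
    (hb : √y * (2 * C / dd p + C ^ 2 / dd p ^ 2) ≤ τ / 4)
    (hk1 : (k * l * (V ^ q * Real.exp 1)) ^ 2 / dd p ^ 2 ≤ τ / 4)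
    (hk2 : k * (2 * q * (V ^ (q - 1) * Real.exp 1) + p * (V ^ q * Real.exp 1) * K ^ (p - 2)) ≤ τ)
    (hJ : 0 < pdx u x y t + k * x * Ff q (al p) (u x y t) y) :
      ∃ (gx gy : ℝ → ℝ) (gxx gyy gt : ℝ),
        (∀ᶠ s in nhds x, HasDerivAt (fun s => k * s * Ff q (al p) (u s y t) y) (gx s) s) ∧ HasDerivAt gx gxx x ∧
        (∀ᶠ s in nhds y, HasDerivAt (fun s => k * x * Ff q (al p) (u x s t) s) (gy s) s) ∧ HasDerivAt gy gyy y ∧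
        HasDerivAt (fun s => k * x * Ff q (al p) (u x y s) y) gt t ∧
        gt - gxx - gyy - p * gradNorm u x y t ^ (p - 2) * (pdx u x y t * gx x + pdy u x y t * gy y) ≤ 0 := by
  have hp := G.hp
  have hα := al_pos hp
  have hα2 := al_le hp G.hp3
  have hd := dd_pos hp
  have hC0 := hC.pos
  have hl := G.hl
  have hxm : x ∈ Icc (-l) l := ⟨by linarith, hxl.le⟩
  have hV0 : 0 < V := by rw [hV]; positivity
  have ax : |x| ≤ 2 * l := abs_le.2 ⟨by linarith, by linarith⟩
  have ayl : y ≤ 2 * l := by linarith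
  have hξ0 := G.pdx_le hx.le hxl.le hy.le ayl ht htT
  have hu0 := G.nonneg x y t ax hy.le ayl ht htT
  have hya : 0 < y ^ (al p) := Real.rpow_pos_of_pos hy _
  have hU : 0 < u x y t := by
    refine lt_of_le_of_ne hu0 fun h => ?_
    have : Ff q (al p) (u x y t) y = 0 := by
      unfold Ff; rw [← h, zero_div, Real.zero_rpow (by linarith), zero_mul]
    rw [this] at hJ; linarith
  have hUle := G.u_le hC0 H hxm ht htT hy hyl.le
  have hUV : u x y t ≤ V * y ^ (al p) := by
    have : y ^ 2 ≤ y ^ (al p) := by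
      rw [← Real.rpow_two]
      exact Real.rpow_le_rpow_of_exponent_ge hy hy1 (by linarith)
    rw [hV]; nlinarith
  obtain ⟨hF, hF0, hF1⟩ := Ff_bd hq1 hU hy hy1 hUV
  have reg := G.reg' ax hy.le ayl ht htT
  have hcx : ContinuousAt (fun s => u s y t) x := reg.dx.continuousAt
  have hcy : ContinuousAt (fun s => u x s t) y := reg.dy.continuousAt
  refine ⟨fun s => k * Ff q (al p) (u s y t) y * (1 + s * (q * pdx u s y t / u s y t)),
    fun s => k * x * Ff q (al p) (u x s t) s * (q * (pdy u x s t / u x s t - al p / s) + 1), _, _, _, ?_,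
    gxx_d hy hU reg.dx reg.dxx, ?_, gyy_d hy hU reg.dy reg.dyy, (Ff_dU hy hU reg.dt).const_mul (k * x), ?_⟩
  · filter_upwards [hcx.eventually_const_lt hU, Ioo_mem_nhds (show -l < x by linarith) hxl] with s hs hs2
    exact gx_d (U := fun s => u s y t) (U' := fun s => pdx u s y t) hy hs
      (G.reg' (abs_le.2 ⟨by linarith [hs2.1], by linarith [hs2.2]⟩) hy.le ayl ht htT).dx
  · filter_upwards [hcy.eventually_const_lt hU, Ioo_mem_nhds hy hyl] with s hs hs2
    have := (Ff_dy (q := q) (α := al p) (U := fun s => u x s t) hs2.1 hs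
      (G.reg' ax hs2.1.le (by linarith [hs2.2]) ht htT).dy).const_mul (k * x)
    refine this.congr_deriv ?_
    ring
  · obtain ⟨r, hr⟩ : ∃ r, pdx u x y t = -r * x := ⟨-pdx u x y t / x, by field_simp⟩
    have hr0 : 0 ≤ r := by
      by_contra h; push Not at h
      nlinarith
    have hrk : r ≤ k * Ff q (al p) (u x y t) y := by
      rw [hr] at hJ
      by_contra h; push Not at h
      nlinarith
    have hP := gradNorm_nonneg u x y t
    have hP2 : gradNorm u x y t ^ 2 = (pdx u x y t) ^ 2 + (pdy u x y t) ^ 2 := by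
      unfold gradNorm; rw [Real.sq_sqrt (by positivity)]
    have hPp : gradNorm u x y t ^ p = gradNorm u x y t ^ (p - 2) * (gradNorm u x y t) ^ 2 := by
      rcases hP.eq_or_lt with h | h
      · rw [← h, Real.zero_rpow (by linarith)]; simp
      · rw [← Real.rpow_two, ← Real.rpow_add h]; congr 1; ring
    have hPm : 0 ≤ gradNorm u x y t ^ (p - 2) := Real.rpow_nonneg hP _
    have hpde := G.pde x y t ax hy ayl ht htT
    rw [hPp, hP2, hr] at hpde
    have hw := G.w_le hC0 H hxm ht htT hy hyl.le
    have hw2 := G.w_ge hC H hxm ht htT hy hyl.le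
    have hξ : |pdx u x y t| ≤ k * l * (V ^ q * Real.exp 1) := by
      rw [abs_of_nonpos hξ0, hr]
      have : r * x ≤ (k * (V ^ q * Real.exp 1)) * l :=
        mul_le_mul (hrk.trans (mul_le_mul_of_nonneg_left hF0 hk.le)) hxl.le hx.le (by positivity)
      linarith
    have hPK : gradNorm u x y t ≤ K * y ^ (al p - 1) := by
      have h1 := grad_le_add u x y t
      have h2 := G.pdx_abs hC hxm hy.le hyl.le ht htT
      rw [abs_of_pos hx] at h2
      have h3 : C * x ≤ C * l := by gcongr
      have h4 := rp4 hα2 hy hy1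
      have h5 : |pdy u x y t| ≤ dd p * y ^ (al p - 1) + 2 * C + C * l := by
        have : C * y ≤ C * 1 := by gcongr
        have : 0 ≤ C * l := by positivity
        have : 0 ≤ dd p * y ^ (al p - 1) := by positivity
        exact abs_le.2 ⟨by linarith, by linarith⟩
      have h6 : (2 * C + 2 * C * l) * 1 ≤ (2 * C + 2 * C * l) * y ^ (al p - 1) := by gcongr
      rw [hK]; linarith
    have hPm2 := Pm_bd hp hy hP (by rw [hK]; positivity) hPK
    have hR := R_bd hα2 hy hy1 hU (show 0 ≤ q by linarith) (show 0 ≤ p by linarith) hk.le hF.le hF0 hF1 hPm hPm2 hk2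
    have hth := theta_bd hp G.hp3 hy hy1 hU hC0 hw hUle hP hP2 hξ hτ hτ1 hb hk1
    have hneg := Phi_neg hα hα2 hq hτ hτq hy hyα (le_refl (τ * y)) hth
    have heq := Phi_eq (α := al p) (p := p) (q := q) (A := pdy u x y t * y / u x y t) (y := y)
      (B := gradNorm u x y t ^ (p - 2) * pdy u x y t * y) (al_mul hp)
    rw [← heq] at hneg
    have := pt_alg (α := al p) hU hy hx hk hF hPm hq1 (show 1 ≤ p by linarith) hpde hr0 hrk hR hneg
    simp only [hr]
    refine le_trans (le_of_eq ?_) this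
    ring

end Interior

section MainEst

variable {u : ℝ → ℝ → ℝ → ℝ} {p l T : ℝ}

theorem Ff_lin {q α U y M : ℝ} (hα : 0 < α) (hq : 1 ≤ q) (hqα : 1 ≤ (1 - α) * q) (hU : 0 ≤ U) (hy : 0 ≤ y) (hy1 : y ≤ 1) (hM : 0 ≤ M)
    (hUM : U ≤ M * y) : 0 ≤ Ff q α U y ∧ Ff q α U y ≤ M ^ q * Real.exp 1 * y := by
  rcases hy.eq_or_lt with rfl | hy0
  · unfold Ff
    rw [Real.zero_rpow hα.ne', div_zero, Real.zero_rpow (by linarith)]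
    simp
  · have hya : 0 < y ^ α := Real.rpow_pos_of_pos hy0 _
    refine ⟨by unfold Ff; positivity, ?_⟩
    have e1 : U / y ^ α ≤ M * y ^ (1 - α) := by
      rw [Real.rpow_sub hy0, Real.rpow_one, div_le_iff₀ hya]
      refine hUM.trans (le_of_eq ?_)
      field_simp
    have e2 : (U / y ^ α) ^ q ≤ M ^ q * y := by
      calc (U / y ^ α) ^ q ≤ (M * y ^ (1 - α)) ^ q := Real.rpow_le_rpow (by positivity) e1 (by linarith)
        _ = M ^ q * y ^ ((1 - α) * q) := by rw [Real.mul_rpow hM (by positivity), ← Real.rpow_mul hy]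
        _ ≤ M ^ q * y ^ (1:ℝ) := by
            refine mul_le_mul_of_nonneg_left ?_ (by positivity)
            exact Real.rpow_le_rpow_of_exponent_ge hy0 hy1 hqα
        _ = M ^ q * y := by rw [Real.rpow_one]
    unfold Ff
    calc (U / y ^ α) ^ q * Real.exp y ≤ M ^ q * y * Real.exp 1 :=
          mul_le_mul e2 (Real.exp_le_exp.2 hy1) (Real.exp_pos _).le (by positivity)
      _ = _ := by ring

theorem Good.u_lin (G : Good p l T u) {x y t M : ℝ} (hx : x ∈ Icc (-l) l) (hy : 0 ≤ y) (hyl : y ≤ l) (ht : T / 2 ≤ t) (htT : t < T)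
    (hM : ∀ s ∈ Icc 0 y, |pdy u x s t| ≤ M) : u x y t ≤ M * y := by
  have hl := G.hl
  have ax : |x| ≤ 2 * l := abs_le.2 ⟨by linarith [hx.1], by linarith [hx.2]⟩
  have R : ∀ s ∈ Icc 0 y, HasDerivAt (fun s => u x s t) (pdy u x s t) s := fun s hs =>
    (G.reg' ax hs.1 (by linarith [hs.2]) ht htT).dy
  have := mvt_le hy (fun s hs => (R s hs).continuousAt.continuousWithinAt) (fun s hs => R s ⟨hs.1.le, hs.2.le⟩)
    (m := M) (fun s hs => (abs_le.1 (hM s ⟨hs.1.le, hs.2.le⟩)).2)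
  rw [G.bc x t ax ht htT] at this
  linarith

theorem Good.g_cont (G : Good p l T u) {q k x1 y1 t0 t1 : ℝ} (hq : 1 ≤ q) (hqα : 1 ≤ (1 - al p) * q) (hk : 0 < k)
    (hx1 : x1 ≤ l) (hy1 : y1 ≤ l) (hy11 : y1 ≤ 1) (ht0 : T / 2 ≤ t0) (ht1 : t1 < T) :
    ContinuousOn (fun z : ℝ × ℝ × ℝ => k * z.1 * Ff q (al p) (u z.1 z.2.1 z.2.2) z.2.1)
      (Icc 0 x1 ×ˢ Icc 0 y1 ×ˢ Icc t0 t1) := by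
  have hl := G.hl
  have hα := al_pos G.hp
  rintro ⟨x, y, t⟩ ⟨hx, hy, ht⟩
  simp only at hx hy ht
  have reg := G.reg' (x := x) (abs_le.2 ⟨by linarith [hx.1], by linarith [hx.2]⟩) hy.1 (by linarith [hy.2]) (ht0.trans ht.1) (lt_of_le_of_lt ht.2 ht1)
  rcases hy.1.eq_or_lt with h0 | h0
  · subst h0
    obtain ⟨M, hM0, hM⟩ := G.bddK (show 0 < T - t1 by linarith)
    have hz : ∀ z ∈ Icc 0 x1 ×ˢ Icc 0 y1 ×ˢ Icc t0 t1,
        0 ≤ k * z.1 * Ff q (al p) (u z.1 z.2.1 z.2.2) z.2.1 ∧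
        k * z.1 * Ff q (al p) (u z.1 z.2.1 z.2.2) z.2.1 ≤ k * z.1 * (M ^ q * Real.exp 1 * z.2.1) := by
      rintro ⟨a, b, s⟩ ⟨ha, hb, hs⟩
      simp only at ha hb hs ⊢
      have aa : |a| ≤ 2 * l := abs_le.2 ⟨by linarith [ha.1], by linarith [ha.2]⟩
      have hsT : s < T := lt_of_le_of_lt hs.2 ht1
      have hU := G.nonneg a b s aa hb.1 (by linarith [hb.2]) (ht0.trans hs.1) hsT
      have hUM := G.u_lin (M := M) ⟨by linarith [ha.1], by linarith [ha.2]⟩ hb.1 (by linarith [hb.2]) (ht0.trans hs.1) hsT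
        (fun r hr => (hM a r s aa hr.1 (by linarith [hr.2, hb.2]) (ht0.trans hs.1) hsT.le (Or.inr (Or.inr (by linarith [hs.2])))).2.1)
      have := Ff_lin hα hq hqα hU hb.1 (by linarith [hb.2]) hM0.le hUM
      have hka : 0 ≤ k * a := mul_nonneg hk.le ha.1
      exact ⟨mul_nonneg hka this.1, mul_le_mul_of_nonneg_left this.2 hka⟩
    have hv : k * x * Ff q (al p) (u x 0 t) 0 = 0 := by
      unfold Ff
      rw [Real.zero_rpow hα.ne', div_zero, Real.zero_rpow (by linarith)]
      simp
    unfold ContinuousWithinAt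
    simp only [hv]
    refine squeeze_zero' (g := fun z : ℝ × ℝ × ℝ => k * z.1 * (M ^ q * Real.exp 1 * z.2.1)) ?_ ?_ ?_
    · filter_upwards [self_mem_nhdsWithin] with z hz'
      exact (hz z hz').1
    · filter_upwards [self_mem_nhdsWithin] with z hz'
      exact (hz z hz').2
    · have : Continuous (fun z : ℝ × ℝ × ℝ => k * z.1 * (M ^ q * Real.exp 1 * z.2.1)) := by fun_prop
      have h2 := (this.tendsto (x, 0, t)).mono_left (nhdsWithin_le_nhds (s := Icc 0 x1 ×ˢ Icc 0 y1 ×ˢ Icc t0 t1))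
      simpa using h2
  · apply ContinuousAt.continuousWithinAt
    have hya : y ^ (al p) ≠ 0 := (Real.rpow_pos_of_pos h0 _).ne'
    have c1 : ContinuousAt (fun z : ℝ × ℝ × ℝ => z.2.1 ^ (al p)) (x, y, t) := by
      refine ContinuousAt.rpow_const (by fun_prop) (Or.inl h0.ne')
    have c2 := (reg.cu.div c1 hya).rpow_const (p := q) (Or.inr (by linarith))
    unfold Ff
    exact (show ContinuousAt (fun z : ℝ × ℝ × ℝ => k * z.1) (x, y, t) by fun_prop).mul
      (c2.mul (show ContinuousAt (fun z : ℝ × ℝ × ℝ => Real.exp z.2.1) (x, y, t) by fun_prop))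

set_option maxHeartbeats 1600000 in
theorem Good.main_est (G : Good p l T u) {C : ℝ} (hC : Cst l T u C) (H : ∀ x ∈ Icc (-l) l, ∀ y ∈ Ioc 0 l, ∀ t, T / 2 ≤ t → t < T →
    pdyy u x y t ≤ C - gradNorm u x y t ^ p) : ∃ q k x1 y1 t0 : ℝ, 1 ≤ q ∧ 0 < k ∧ 0 < x1 ∧ x1 < l ∧ 0 < y1 ∧ y1 < l ∧ T / 2 < t0 ∧ t0 < T ∧
    ∀ x ∈ Icc 0 x1, ∀ y ∈ Icc 0 y1, ∀ t, t0 ≤ t → t < T → pdx u x y t + k * x * Ff q (al p) (u x y t) y ≤ 0 := by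
  have hp := G.hp
  have hα := al_pos hp
  have hα2 := al_le hp G.hp3
  have hd := dd_pos hp
  have hC0 := hC.pos
  have hl := G.hl
  have hβ : 0 < al p * (1 - al p) := mul_pos hα (by linarith)
  have hβ4 : al p * (1 - al p) ≤ 1 / 4 := by nlinarith [sq_nonneg (al p - 1 / 2)]
  obtain ⟨q, hqd⟩ : ∃ q, q = 1 + 2 / (al p * (1 - al p)) := ⟨_, rfl⟩
  have hq : (q - 1) * (al p * (1 - al p)) = 2 := by
    rw [hqd, add_sub_cancel_left, div_mul_cancel₀ _ hβ.ne']
  have hq9 : 9 ≤ q := by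
    have : 8 ≤ 2 / (al p * (1 - al p)) := by rw [le_div_iff₀ hβ]; linarith
    linarith
  have hq1 : 1 ≤ q := by linarith
  have hqα : 1 ≤ (1 - al p) * q := by nlinarith
  obtain ⟨τ, hτd⟩ : ∃ τ, τ = 1 / (q + 1) := ⟨_, rfl⟩
  have hτ0 : 0 < τ := by rw [hτd]; positivity
  have hτq : τ * (q + 1) ≤ 1 := by rw [hτd, div_mul_cancel₀ _ (by linarith)]
  have hτ1 : τ ≤ 1 := by nlinarith
  obtain ⟨c1, hc1⟩ : ∃ c1, c1 = 2 * C / dd p + C ^ 2 / dd p ^ 2 := ⟨_, rfl⟩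
  have hc10 : 0 < c1 := by rw [hc1]; positivity
  obtain ⟨b, hbd⟩ : ∃ b, b = min (min l 1) (min (al p ^ 2) ((τ / 4 / c1) ^ 2)) := ⟨_, rfl⟩
  have hb0 : 0 < b := by rw [hbd]; positivity
  have hbl : b ≤ l := by rw [hbd]; exact (min_le_left _ _).trans (min_le_left _ _)
  have hb1 : b ≤ 1 := by rw [hbd]; exact (min_le_left _ _).trans (min_le_right _ _)
  have hbα : b ≤ al p ^ 2 := by rw [hbd]; exact (min_le_right _ _).trans (min_le_left _ _)
  have hbτ : b ≤ (τ / 4 / c1) ^ 2 := by rw [hbd]; exact (min_le_right _ _).trans (min_le_right _ _)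
  obtain ⟨x1, y1, t0, c, hx10, hx1l, hy10, hy1b, ht0, ht0T, hc, B1, B2, B3⟩ := G.pos_bdry hC H hb0 hbl
  obtain ⟨M1, hM10, hM1⟩ := G.bddK (show 0 < T - t0 by linarith)
  obtain ⟨M2, hM20, hM2⟩ := G.bddK hx10
  obtain ⟨V, hV⟩ : ∃ V, V = dd p / al p + C := ⟨_, rfl⟩
  have hV0 : 0 < V := by rw [hV]; positivity
  obtain ⟨K, hK⟩ : ∃ K, K = dd p + 2 * C + 2 * C * l := ⟨_, rfl⟩
  have hK0 : 0 < K := by rw [hK]; positivity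
  obtain ⟨m, hm⟩ : ∃ m, m = min (τ / 4) c := ⟨_, rfl⟩
  have hm0 : 0 < m := by rw [hm]; positivity
  have hmτ : m ≤ τ / 4 := by rw [hm]; exact min_le_left _ _
  have hmc : m ≤ c := by rw [hm]; exact min_le_right _ _
  obtain ⟨Z1, hZ1⟩ : ∃ Z, Z = (l * (V ^ q * Real.exp 1)) ^ 2 / dd p ^ 2 := ⟨_, rfl⟩
  obtain ⟨Z2, hZ2⟩ : ∃ Z, Z = 2 * q * (V ^ (q - 1) * Real.exp 1) + p * (V ^ q * Real.exp 1) * K ^ (p - 2) := ⟨_, rfl⟩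
  obtain ⟨Z3, hZ3⟩ : ∃ Z, Z = M1 ^ q * Real.exp 1 := ⟨_, rfl⟩
  obtain ⟨Z4, hZ4⟩ : ∃ Z, Z = l * (M2 ^ q * Real.exp 1) := ⟨_, rfl⟩
  obtain ⟨Z5, hZ5⟩ : ∃ Z, Z = V ^ q * Real.exp 1 := ⟨_, rfl⟩
  have z1 : 0 ≤ Z1 := by rw [hZ1]; positivity
  have z2 : 0 ≤ Z2 := by rw [hZ2]; positivity
  have z3 : 0 ≤ Z3 := by rw [hZ3]; positivity
  have z4 : 0 ≤ Z4 := by rw [hZ4]; positivity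
  have z5 : 0 ≤ Z5 := by rw [hZ5]; positivity
  obtain ⟨S, hS⟩ : ∃ S, S = 1 + m + Z1 + Z2 + Z3 + Z4 + Z5 := ⟨_, rfl⟩
  have hS0 : 0 < S := by rw [hS]; positivity
  obtain ⟨k, hkd⟩ : ∃ k, k = m / S := ⟨_, rfl⟩
  have hk : 0 < k := by rw [hkd]; positivity
  have hkS : k * S = m := by rw [hkd, div_mul_cancel₀ _ hS0.ne']
  have kz : ∀ Z, Z ≤ S → k * Z ≤ m := fun Z hZ => by rw [← hkS]; exact mul_le_mul_of_nonneg_left hZ hk.le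
  have hk1 : k ≤ 1 := by rw [hkd, div_le_one hS0, hS]; linarith
  have k1 := kz Z1 (by rw [hS]; linarith)
  have k2 := kz Z2 (by rw [hS]; linarith)
  have k3 := kz Z3 (by rw [hS]; linarith)
  have k4 := kz Z4 (by rw [hS]; linarith)
  have k5 := kz Z5 (by rw [hS]; linarith)
  refine ⟨q, k, x1, y1, t0, hq1, hk, hx10, hx1l, hy10, hy1b.trans_le hbl, ht0, ht0T, ?_⟩
  intro x hx y hy t ht htT
  refine G.Jlem (fun x y t => k * x * Ff q (al p) (u x y t) y) le_rfl hx1l.le le_rfl (hy1b.le.trans hbl) ht0.le htT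
    (G.g_cont hq1 hqα hk hx1l.le (hy1b.le.trans hbl) (hy1b.le.trans hb1) ht0.le htT) ?_ ?_ x hx y hy t ⟨ht, le_rfl⟩
  · intro x hx y hy s hs hh
    have hsT : s < T := lt_of_le_of_lt hs.2 htT
    have hs2 : T / 2 ≤ s := ht0.le.trans hs.1
    have hyl : y ≤ l := by linarith [hy.2]
    have hy1' : y ≤ 1 := by linarith [hy.2]
    have hxm : x ∈ Icc (-l) l := ⟨by linarith [hx.1], by linarith [hx.2]⟩
    have ax : |x| ≤ 2 * l := abs_le.2 ⟨by linarith [hx.1], by linarith [hx.2]⟩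
    have hU := G.nonneg x y s ax hy.1 (by linarith) hs2 hsT
    have hkx : 0 ≤ k * x := mul_nonneg hk.le hx.1
    rcases hh with h | h | h | h | h
    · subst h
      rw [G.pdx_zero hy.1 (by linarith) hs2 hsT]; simp
    · subst h
      have hUM := G.u_lin (M := M2) hxm hy.1 hyl hs2 hsT (fun r hr =>
        (hM2 x r s ax hr.1 (by linarith [hr.2]) hs2 hsT.le (Or.inl (le_abs_self _))).2.1)
      have h1 := Ff_lin hα hq1 hqα hU hy.1 hy1' hM20.le hUM
      have h2 := B2 y hy s hs.1 hsT
      have h3 : k * x * Ff q (al p) (u x y s) y ≤ k * l * (M2 ^ q * Real.exp 1 * y) :=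
        mul_le_mul (mul_le_mul_of_nonneg_left hx1l.le hk.le) h1.2 h1.1 (by positivity)
      have h4 : k * l * (M2 ^ q * Real.exp 1 * y) = k * Z4 * y := by rw [hZ4]; ring
      have h5 : k * Z4 * y ≤ c * y := mul_le_mul_of_nonneg_right (k4.trans hmc) hy.1
      linarith
    · subst h
      have : Ff q (al p) (u x 0 s) 0 = 0 := by
        unfold Ff
        rw [Real.zero_rpow hα.ne', div_zero, Real.zero_rpow (by linarith), zero_mul]
      rw [this, G.pdx_bc (abs_le.2 ⟨hxm.1, hxm.2⟩) hs2 hsT]; simp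
    · subst h
      have hUle := G.u_le hC0 H hxm hs2 hsT hy10 hyl
      have hUV : u x y s ≤ V * y ^ (al p) := by
        have : y ^ 2 ≤ y ^ (al p) := by
          rw [← Real.rpow_two]
          exact Real.rpow_le_rpow_of_exponent_ge hy10 hy1' (by linarith)
        rw [hV]; nlinarith
      have hFle : Ff q (al p) (u x y s) y ≤ Z5 := by
        rcases hU.eq_or_lt with h | h
        · unfold Ff
          rw [← h, zero_div, Real.zero_rpow (by linarith), zero_mul]; exact z5
        · rw [hZ5]; exact (Ff_bd hq1 h hy10 hy1' hUV).2.1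
      have h2 := B3 x hx s hs.1 hsT
      have h3 : k * x * Ff q (al p) (u x y s) y ≤ k * x * Z5 := mul_le_mul_of_nonneg_left hFle hkx
      have h5 : k * Z5 * x ≤ c * x := mul_le_mul_of_nonneg_right (k5.trans hmc) hx.1
      linarith
    · subst h
      have hUM := G.u_lin (M := M1) hxm hy.1 hyl hs2 hsT (fun r hr =>
        (hM1 x r s ax hr.1 (by linarith [hr.2]) hs2 hsT.le (Or.inr (Or.inr (by linarith)))).2.1)
      have h1 := Ff_lin hα hq1 hqα hU hy.1 hy1' hM10.le hUM
      have h2 := B1 x hx y hy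
      have h3 : k * x * Ff q (al p) (u x y s) y ≤ k * x * (M1 ^ q * Real.exp 1 * y) :=
        mul_le_mul_of_nonneg_left h1.2 hkx
      have h4 : k * x * (M1 ^ q * Real.exp 1 * y) = k * Z3 * (x * y) := by rw [hZ3]; ring
      have h5 : k * Z3 * (x * y) ≤ c * (x * y) := mul_le_mul_of_nonneg_right (k3.trans hmc) (mul_nonneg hx.1 hy.1)
      linarith
  · intro x hx y hy s hs hJ
    have hyb : y ≤ b := by linarith [hy.2]
    refine G.int_est hC H hq hq1 hτ0.le hτ1 hτq hk hV hK hx.1 (hx.2.trans hx1l) hy.1 (by linarith [hy.2])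
      (hyb.trans hb1) (hyb.trans hbα) (ht0.le.trans hs.1.le) (lt_of_le_of_lt hs.2 htT) ?_ ?_ ?_ hJ
    · rw [← hc1]
      have : √y ≤ τ / 4 / c1 := Real.sqrt_le_iff.2 ⟨by positivity, hyb.trans hbτ⟩
      rwa [le_div_iff₀ hc10] at this
    · have e : (k * l * (V ^ q * Real.exp 1)) ^ 2 / dd p ^ 2 = k * (k * Z1) := by rw [hZ1]; ring
      rw [e]
      have : k * (k * Z1) ≤ 1 * (k * Z1) := mul_le_mul_of_nonneg_right hk1 (by positivity)
      linarith
    · rw [← hZ2]; linarith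

end MainEst

section FinalPart

variable {u : ℝ → ℝ → ℝ → ℝ} {p l T : ℝ}

theorem lim_T_le {f : ℝ × ℝ × ℝ → ℝ} {x y t0 m : ℝ} (hf : ContinuousAt f (x, y, T)) (ht0 : t0 < T)
    (h : ∀ t, t0 ≤ t → t < T → f (x, y, t) ≤ m) : f (x, y, T) ≤ m := by
  have c : ContinuousAt (fun t : ℝ => f (x, y, t)) T :=
    ContinuousAt.comp (f := fun s : ℝ => ((x, y, s) : ℝ × ℝ × ℝ)) (x := T) hf (by fun_prop)
  have c2 : Tendsto (fun t : ℝ => f (x, y, t)) (nhdsWithin T (Iio T)) (nhds (f (x, y, T))) :=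
    c.tendsto.mono_left nhdsWithin_le_nhds
  refine le_of_tendsto c2 ?_
  filter_upwards [Ioo_mem_nhdsLT ht0] with t ht
  exact h t ht.1.le ht.2

theorem lim_T_ge {f : ℝ × ℝ × ℝ → ℝ} {x y t0 m : ℝ} (hf : ContinuousAt f (x, y, T)) (ht0 : t0 < T)
    (h : ∀ t, t0 ≤ t → t < T → m ≤ f (x, y, t)) : m ≤ f (x, y, T) := by
  have := lim_T_le (f := fun z => - f z) (m := -m) hf.neg ht0 (fun t h1 h2 => by linarith [h t h1 h2])
  linarith

theorem Good.bounds (G : Good p l T u) : ∃ C c ρ : ℝ, 0 < c ∧ c ≤ C ∧ 0 < ρ ∧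
    ∀ y : ℝ, 0 < y → y < ρ → -C ≤ pdxx u 0 y T ∧ pdxx u 0 y T ≤ -c := by
  obtain ⟨C, hC, H⟩ := G.cst
  obtain ⟨c0, hc0, ρ, hρ, hlow⟩ := G.u_final_ge hC H
  obtain ⟨q, k, x1, y1, t0, hq, hk, hx10, hx1l, hy10, hy1l, ht0, ht0T, hmain⟩ := G.main_est hC H
  have hl := G.hl
  have hT := G.hT
  have hT2 : T / 2 < T := by linarith
  have hck : 0 < k * c0 ^ q := by positivity
  refine ⟨max C (k * c0 ^ q), k * c0 ^ q, min ρ y1, hck, le_max_right _ _, by positivity, ?_⟩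
  intro y hy hyρ
  have hy1 : y < y1 := hyρ.trans_le (min_le_right _ _)
  have hyr : y < ρ := hyρ.trans_le (min_le_left _ _)
  have reg : ∀ x, |x| ≤ 2 * l → C21At u x y T := fun x hx =>
    G.reg x y T hx hy.le (by linarith) hT2.le le_rfl (fun h => absurd h.2.1 hy.ne')
  have a0 : |(0:ℝ)| ≤ 2 * l := by simp; linarith
  constructor
  · have := lim_T_ge (t0 := T / 2) (m := -C) (reg 0 a0).cxx hT2 (fun t h1 h2 =>
      hC.uxx 0 ⟨by linarith, by linarith⟩ y ⟨hy.le, by linarith⟩ t h1 h2)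
    simp only at this
    linarith [le_max_left C (k * c0 ^ q)]
  · have hya : 0 < y ^ (al p) := Real.rpow_pos_of_pos hy _
    have hm : ∀ x ∈ Icc 0 x1, pdx u x y T + k * x * Ff q (al p) (u x y T) y ≤ 0 := by
      intro x hx
      have rg := reg x (abs_le.2 ⟨by linarith [hx.1], by linarith [hx.2]⟩)
      have c1 : ContinuousAt (fun z : ℝ × ℝ × ℝ => z.2.1 ^ (al p)) (x, y, T) :=
        ContinuousAt.rpow_const (by fun_prop) (Or.inl hy.ne')
      have c2 := (rg.cu.div c1 hya.ne').rpow_const (p := q) (Or.inr (by linarith))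
      have c3 : ContinuousAt (fun z : ℝ × ℝ × ℝ => pdx u z.1 z.2.1 z.2.2 + k * z.1 * Ff q (al p) (u z.1 z.2.1 z.2.2) z.2.1) (x, y, T) := by
        unfold Ff
        exact rg.cx.add ((show ContinuousAt (fun z : ℝ × ℝ × ℝ => k * z.1) (x, y, T) by fun_prop).mul
          (c2.mul (show ContinuousAt (fun z : ℝ × ℝ × ℝ => Real.exp z.2.1) (x, y, T) by fun_prop)))
      exact lim_T_le c3 ht0T (fun t h1 h2 => hmain x hx y ⟨hy.le, hy1.le⟩ t h1 h2)
    have hz : pdx u 0 y T = 0 := by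
      apply le_antisymm
      · exact lim_T_le (reg 0 a0).cx hT2 (fun t h1 h2 => (G.pdx_zero hy.le (by linarith) h1 h2).le)
      · exact lim_T_ge (reg 0 a0).cx hT2 (fun t h1 h2 => (G.pdx_zero hy.le (by linarith) h1 h2).ge)
    have hlo := hlow y hy hyr
    have hU : 0 < u 0 y T := lt_of_lt_of_le (by positivity) hlo
    have d1 := (reg 0 a0).dxx.fun_add (gx_d (q := q) (α := al p) (k := k) (U := fun s => u s y T)
      (U' := fun s => pdx u s y T) hy hU (reg 0 a0).dx)
    have d2 := deriv_right_nonpos hx10 (fun s hs => by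
      have := hm s ⟨hs.1.le, hs.2.le⟩
      simpa [hz] using this) d1
    have hF : c0 ^ q ≤ Ff q (al p) (u 0 y T) y := by
      unfold Ff
      have e1 : c0 ≤ u 0 y T / y ^ (al p) := by rwa [le_div_iff₀ hya]
      have e2 := Real.rpow_le_rpow hc0.le e1 (show 0 ≤ q by linarith)
      have e3 : 1 ≤ Real.exp y := Real.one_le_exp hy.le
      calc c0 ^ q = c0 ^ q * 1 := by ring
        _ ≤ _ := mul_le_mul e2 e3 zero_le_one (by positivity)
    have := mul_le_mul_of_nonneg_left hF hk.le
    simp only [zero_mul, add_zero, mul_one] at d2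
    linarith

theorem zero_deriv {f : ℝ → ℝ} {S : Set ℝ} {x d : ℝ} (hS : UniqueDiffOn ℝ S) (hx : x ∈ S) (h0 : ∀ s ∈ S, f s = 0)
    (hd : HasDerivAt f d x) : d = 0 := by
  refine UniqueDiffWithinAt.eq_deriv S (hS x hx) hd.hasDerivWithinAt ?_
  exact (hasDerivWithinAt_const x S (0:ℝ)).congr h0 (h0 x hx)

theorem Good.zero_side (G : Good p l T u) {S : Set ℝ} (hS : UniqueDiffOn ℝ S) (hS1 : ∀ s ∈ S, s ≠ 0 ∧ |s| ≤ 2 * l) :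
    ∀ x ∈ S, pdxx u x 0 T = 0 := by
  have hl := G.hl
  have hT := G.hT
  have hT2 : T / 2 < T := by linarith
  have reg : ∀ x ∈ S, C21At u x 0 T := fun x hx =>
    G.reg x 0 T (hS1 x hx).2 le_rfl (by linarith) hT2.le le_rfl (fun h => (hS1 x hx).1 h.1)
  have h0 : ∀ x ∈ S, u x 0 T = 0 := by
    intro x hx
    apply le_antisymm
    · exact lim_T_le (reg x hx).cu hT2 (fun t h1 h2 => (G.bc x t (hS1 x hx).2 h1 h2).le)
    · exact lim_T_ge (reg x hx).cu hT2 (fun t h1 h2 => (G.bc x t (hS1 x hx).2 h1 h2).ge)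
  have h1 : ∀ x ∈ S, pdx u x 0 T = 0 := fun x hx => zero_deriv hS hx h0 (reg x hx).dx
  exact fun x hx => zero_deriv hS hx h1 (reg x hx).dxx

theorem Good.zero (G : Good p l T u) : ∀ x : ℝ, x ≠ 0 → |x| ≤ 2 * l → pdxx u x 0 T = 0 := by
  intro x hx hxl
  have hxl' := abs_le.1 hxl
  rcases lt_or_gt_of_ne hx with h | h
  · refine G.zero_side (S := Ico (-(2 * l)) 0) (uniqueDiffOn_Ico _ _) ?_ x ⟨hxl'.1, h⟩
    intro s hs
    exact ⟨hs.2.ne, abs_le.2 ⟨hs.1, by linarith [hs.2, G.hl]⟩⟩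
  · refine G.zero_side (S := Ioc 0 (2 * l)) (uniqueDiffOn_Ioc _ _) ?_ x ⟨h, hxl'.2⟩
    intro s hs
    exact ⟨hs.1.ne', abs_le.2 ⟨by linarith [hs.1, G.hl], hs.2⟩⟩

theorem no_lim {f : ℝ → ℝ → ℝ} {A c ρ : ℝ} (hA : 0 < A) (hc : 0 < c) (hρ : 0 < ρ) (h1 : ∀ y, 0 < y → y < ρ → f 0 y ≤ -c)
    (h2 : ∀ x, x ≠ 0 → |x| ≤ A → f x 0 = 0) :
    ¬ ∃ l : ℝ, Filter.Tendsto (fun q : ℝ × ℝ => f q.1 q.2)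
          (nhdsWithin ((0:ℝ), (0:ℝ)) ((Icc (-A) A ×ˢ Icc (0:ℝ) A) \ {((0:ℝ), (0:ℝ))})) (nhds l) := by
  rintro ⟨m, hm⟩
  have t1 : Tendsto (fun y : ℝ => ((0:ℝ), y)) (nhdsWithin 0 (Ioi 0))
      (nhdsWithin ((0:ℝ), (0:ℝ)) ((Icc (-A) A ×ˢ Icc (0:ℝ) A) \ {((0:ℝ), (0:ℝ))})) := by
    refine tendsto_nhdsWithin_iff.2 ⟨?_, ?_⟩
    · exact (Continuous.tendsto' (by fun_prop) _ _ rfl).mono_left nhdsWithin_le_nhds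
    · filter_upwards [Ioo_mem_nhdsGT hA] with y hy
      refine ⟨⟨⟨by linarith, hA.le⟩, ⟨hy.1.le, hy.2.le⟩⟩, ?_⟩
      simp [hy.1.ne']
  have t2 : Tendsto (fun x : ℝ => (x, (0:ℝ))) (nhdsWithin 0 (Ioi 0))
      (nhdsWithin ((0:ℝ), (0:ℝ)) ((Icc (-A) A ×ˢ Icc (0:ℝ) A) \ {((0:ℝ), (0:ℝ))})) := by
    refine tendsto_nhdsWithin_iff.2 ⟨?_, ?_⟩
    · exact (Continuous.tendsto' (by fun_prop) _ _ rfl).mono_left nhdsWithin_le_nhds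
    · filter_upwards [Ioo_mem_nhdsGT hA] with y hy
      refine ⟨⟨⟨by linarith [hy.1], hy.2.le⟩, ⟨le_rfl, hA.le⟩⟩, ?_⟩
      simp [hy.1.ne']
  have l1 : m ≤ -c := by
    refine le_of_tendsto (hm.comp t1) ?_
    filter_upwards [Ioo_mem_nhdsGT hρ] with y hy
    exact h1 y hy.1 hy.2
  have l2 : 0 ≤ m := by
    refine ge_of_tendsto (hm.comp t2) ?_
    filter_upwards [Ioo_mem_nhdsGT hA] with x hx
    exact (h2 x hx.1.ne' (abs_le.2 ⟨by linarith [hx.1], hx.2.le⟩)).ge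
  linarith

theorem mkGood {L : ℝ} (hp : 2 < p) (hp3 : p ≤ 3) (hL : 0 < L) (hT : 0 < T)
    (hsol : ClassicalSolution p L T u) (hgbu : IsolatedGBU L T u)
    (hext : ExtC21 L T u) (hmon : MonCond L T u) : Good p (L / 4) T u where
  hp := hp
  hp3 := hp3
  hl := by linarith
  hT := hT
  reg x y t hx hy hy2 ht ht2 hn := hext (by linarith) ⟨hy, by linarith⟩ ⟨ht, ht2⟩ hn
  pde x y t hx hy hy2 ht ht2 := hsol.pde (by linarith) ⟨hy, by linarith⟩ ⟨by linarith, ht2⟩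
  bc x t hx ht ht2 := hsol.bc (by linarith) ⟨by linarith, ht2⟩
  nonneg x y t hx hy hy2 ht ht2 := hsol.nonneg (by linarith) ⟨hy, by linarith⟩ ⟨by linarith, ht2⟩
  mon x y t hx hy hy2 ht ht2 := hmon (by linarith) ⟨hy, by linarith⟩ ⟨by linarith, ht2⟩
  blow M δ hδ := by
    obtain ⟨x, y, t, _, hy, ht, h1, h2, h3, h4⟩ := hgbu.blowup M δ hδ
    exact ⟨x, y, t, hy.1, ht.2, h1, h2, h3, h4⟩

end FinalPart

/-- Remark 5.2 / Remark (f): for `2 < p ≤ 3`, `-C ≤ u_xx(0,y,T) ≤ -c < 0` for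
`y > 0` small; since `u_xx(x,0,T) = 0` for `x ≠ 0`, the final profile
`u_xx(·,·,T)` is discontinuous near the origin (it has no limit at `(0,0)`). -/
theorem uxx_final_profile_discontinuous (p L T : ℝ) (hp : 2 < p) (hp3 : p ≤ 3)
    (hL : 0 < L) (hT : 0 < T) (u : ℝ → ℝ → ℝ → ℝ)
    (hsol : ClassicalSolution p L T u) (hgbu : IsolatedGBU L T u)
    (hext : ExtC21 L T u) (hmon : MonCond L T u) :
    ∃ C c ρ : ℝ, 0 < c ∧ c ≤ C ∧ 0 < ρ ∧
      (∀ y : ℝ, 0 < y → y < ρ → -C ≤ pdxx u 0 y T ∧ pdxx u 0 y T ≤ -c) ∧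
      (∀ x : ℝ, x ≠ 0 → |x| ≤ L/2 → pdxx u x 0 T = 0) ∧
      ¬ ∃ l : ℝ, Filter.Tendsto (fun q : ℝ × ℝ => pdxx u q.1 q.2 T)
          (nhdsWithin ((0:ℝ), (0:ℝ))
            ((Icc (-(L/2)) (L/2) ×ˢ Icc (0:ℝ) (L/2)) \ {((0:ℝ), (0:ℝ))}))
          (nhds l) := by
  have G := mkGood hp hp3 hL hT hsol hgbu hext hmon
  obtain ⟨C, c, ρ, hc, hcC, hρ, hb⟩ := G.bounds
  have hz : ∀ x : ℝ, x ≠ 0 → |x| ≤ L / 2 → pdxx u x 0 T = 0 :=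
    fun x hx hxl => G.zero x hx (by linarith)
  exact ⟨C, c, ρ, hc, hcC, hρ, hb, hz,
    no_lim (f := fun x y => pdxx u x y T) (by linarith) hc hρ (fun y h1 h2 => (hb y h1 h2).2) hz⟩
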